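/- Let 1 < p, q < ∞ and fix φ and φ_i as in the context. There exists a constant C_{p,q} such that for all f ∈ L^p(ℝ) and g ∈ L^q(ℝ), ‖ sup_{N_0 ≤ N_1, N_0, N_1 ∈ ℤ} | Σ_{N_0 < i < j ≤ N_1} (φ_i * f)(x) (φ_j * g)(x) | ‖_{pq/(p+q)} ≤ C_{p,q} ‖f‖_{L^p} ‖g‖_{L^q}, where the left-hand side is the L^{pq/(p+q)}(dx) quasi-norm of the pointwise supremum over all pairs of integers N_0 ≤ N_1. -/

import Mathlib

open MeasureTheory ENNReal
open scoped FourierTransform NNReal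

noncomputable section

/-- The dilate `φ_i(x) = 2^i φ(2^i x)` of a Schwartz function `φ`. -/
def dilate (φ : SchwartzMap ℝ ℂ) (i : ℤ) : ℝ → ℂ :=
  fun x => ((2 : ℝ) ^ i : ℝ) • φ (((2 : ℝ) ^ i) * x)

/-- Convolution `(φ_i * h)(x) = ∫ φ_i(x - y) h(y) dy`. -/
def conv (φi : ℝ → ℂ) (h : ℝ → ℂ) : ℝ → ℂ :=
  fun x => ∫ y : ℝ, φi (x - y) * h y

/-- uncentered Hardy-Littlewood maximal function -/
def MF (w : ℝ → ℝ≥0∞) (x : ℝ) : ℝ≥0∞ :=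
  ⨆ (c : ℝ) (ρ : ℝ) (_ : x ∈ Metric.ball c ρ),
    (∫⁻ y in Metric.ball c ρ, w y) / ENNReal.ofReal (2 * ρ)

lemma MF_lt_iff (w : ℝ → ℝ≥0∞) (x : ℝ) (t : ℝ≥0∞) :
    t < MF w x ↔ ∃ c ρ, x ∈ Metric.ball c ρ ∧
      t < (∫⁻ y in Metric.ball c ρ, w y) / ENNReal.ofReal (2 * ρ) := by
  simp only [MF, lt_iSup_iff, exists_prop]

lemma isOpen_MF (w : ℝ → ℝ≥0∞) (t : ℝ≥0∞) : IsOpen {x | t < MF w x} := by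
  rw [isOpen_iff_forall_mem_open]
  intro x hx
  obtain ⟨c, ρ, h1, h2⟩ := (MF_lt_iff w x t).1 hx
  exact ⟨Metric.ball c ρ, fun y hy => (MF_lt_iff w y t).2 ⟨c, ρ, hy, h2⟩, Metric.isOpen_ball, h1⟩

lemma measurable_MF (w : ℝ → ℝ≥0∞) : Measurable (MF w) :=
  measurable_of_Ioi fun t => (isOpen_MF w t).measurableSet

lemma lintegral_ball_le_MF (w : ℝ → ℝ≥0∞) {x c ρ : ℝ} (h : x ∈ Metric.ball c ρ) :
    ∫⁻ y in Metric.ball c ρ, w y ≤ ENNReal.ofReal (2 * ρ) * MF w x := by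
  have hρ : 0 < ρ := Metric.pos_of_mem_ball h
  have : (∫⁻ y in Metric.ball c ρ, w y) / ENNReal.ofReal (2 * ρ) ≤ MF w x :=
    le_iSup₂_of_le c ρ (le_iSup_of_le h le_rfl)
  rw [ENNReal.div_le_iff_le_mul (Or.inl (by simp; linarith)) (Or.inl ENNReal.ofReal_ne_top)] at this
  rwa [mul_comm]

lemma MF_mono {w v : ℝ → ℝ≥0∞} (h : ∀ x, w x ≤ v x) (x : ℝ) : MF w x ≤ MF v x := by
  unfold MF; gcongr; exact h _

lemma MF_weak (w : ℝ → ℝ≥0∞) (t : ℝ≥0∞) (ht : t ≠ 0) (ht' : t ≠ ∞) :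
    t * volume {x | t < MF w x} ≤ 4 * ∫⁻ y, w y := by
  by_cases hw : ∫⁻ y, w y = ∞
  · simp [hw, ENNReal.mul_top]
  -- family of balls
  let T : Set (ℝ × ℝ) := {a | 0 < a.2 ∧ t * ENNReal.ofReal (2 * a.2) ≤ ∫⁻ y in Metric.ball a.1 a.2, w y}
  have hsub : ∀ x, t < MF w x → ∃ a ∈ T, x ∈ Metric.ball a.1 a.2 := by
    intro x hx
    obtain ⟨c, ρ, h1, h2⟩ := (MF_lt_iff w x t).1 hx
    have hρ : 0 < ρ := Metric.pos_of_mem_ball h1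
    refine ⟨(c, ρ), ⟨hρ, ?_⟩, h1⟩
    have := h2.le
    rwa [ENNReal.le_div_iff_mul_le (Or.inl (by simp; linarith)) (Or.inl ENNReal.ofReal_ne_top)] at this
  have hR : ∀ a ∈ T, a.2 ≤ ((∫⁻ y, w y) / t).toReal := by
    intro a ha
    have h1 : ENNReal.ofReal (2 * a.2) ≤ (∫⁻ y, w y) / t := by
      rw [ENNReal.le_div_iff_mul_le (Or.inl ht) (Or.inl ht'), mul_comm]
      exact ha.2.trans (setLIntegral_le_lintegral _ _)
    have h2 := (ENNReal.ofReal_le_iff_le_toReal (ENNReal.div_ne_top hw ht)).1 h1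
    linarith [ha.1]
  obtain ⟨u, hu, hdisj, hcov⟩ := Vitali.exists_disjoint_subfamily_covering_enlargement_ball T
    Prod.fst Prod.snd _ hR 4 (by norm_num)
  have hcount : u.Countable := hdisj.countable_of_isOpen (fun _ _ => Metric.isOpen_ball)
    (fun a ha => ⟨a.1, Metric.mem_ball_self (hu ha).1⟩)
  have hc : {x | t < MF w x} ⊆ ⋃ a ∈ u, Metric.ball a.1 (4 * a.2) := by
    intro x hx
    obtain ⟨a, ha, hxa⟩ := hsub x hx
    obtain ⟨b, hb, hab⟩ := hcov a ha
    exact Set.mem_biUnion hb (hab hxa)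
  have := hcount.to_subtype
  calc t * volume {x | t < MF w x} ≤ t * ∑' a : u, volume (Metric.ball a.1.1 (4 * a.1.2)) := by
        gcongr
        refine (measure_mono hc).trans ?_
        rw [Set.biUnion_eq_iUnion]
        exact measure_iUnion_le _
    _ = ∑' a : u, 4 * (t * ENNReal.ofReal (2 * a.1.2)) := by
        rw [← ENNReal.tsum_mul_left]
        congr 1; ext a
        rw [Real.volume_ball, show 2 * (4 * a.1.2) = 4 * (2 * a.1.2) by ring,
          ENNReal.ofReal_mul (by norm_num)]
        simp; ring
    _ ≤ ∑' a : u, 4 * ∫⁻ y in Metric.ball a.1.1 a.1.2, w y := by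
        gcongr with a; exact (hu a.2).2
    _ = 4 * ∫⁻ y in ⋃ a : u, Metric.ball a.1.1 a.1.2, w y := by
        rw [ENNReal.tsum_mul_left, lintegral_iUnion (fun a => measurableSet_ball)]
        intro a b hab
        exact hdisj a.2 b.2 (fun h => hab (Subtype.ext h))
    _ ≤ 4 * ∫⁻ y, w y := mul_le_mul' le_rfl (setLIntegral_le_lintegral _ _)

/-- discretised layer cake, upper bound -/
lemma rpow_le_tsum (r : ℝ) (hr : 0 < r) (h : ℝ≥0∞) :
    h ^ r ≤ (2:ℝ≥0∞) ^ r * ∑' k : ℤ, (if (2:ℝ≥0∞) ^ k < h then ((2:ℝ≥0∞) ^ k) ^ r else 0) := by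
  rcases eq_or_ne h 0 with rfl | h0
  · simp [ENNReal.zero_rpow_of_pos hr]
  rcases eq_or_ne h ∞ with rfl | h1
  · have : ∑' k : ℤ, (if (2:ℝ≥0∞) ^ k < ∞ then ((2:ℝ≥0∞) ^ k) ^ r else 0) = ∞ := by
      rw [eq_top_iff]
      have h2 : ∀ k : ℕ, (if (2:ℝ≥0∞) ^ (k:ℤ) < ∞ then ((2:ℝ≥0∞) ^ (k:ℤ)) ^ r else 0) ≥ 1 := by
        intro k
        rw [if_pos (by simpa using ENNReal.pow_lt_top (by simp))]
        apply ENNReal.one_le_rpow _ hr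
        simpa using one_le_pow₀ (by norm_num)
      calc (∞:ℝ≥0∞) = ∑' k : ℕ, (1:ℝ≥0∞) := by simp [ENNReal.tsum_const_eq_top_of_ne_zero]
        _ ≤ ∑' k : ℕ, (if (2:ℝ≥0∞) ^ (k:ℤ) < ∞ then ((2:ℝ≥0∞) ^ (k:ℤ)) ^ r else 0) :=
          ENNReal.tsum_le_tsum h2
        _ ≤ _ := ENNReal.tsum_comp_le_tsum_of_injective (f := fun k : ℕ => (k:ℤ))
            Nat.cast_injective (fun k : ℤ => if (2:ℝ≥0∞) ^ k < ∞ then ((2:ℝ≥0∞) ^ k) ^ r else 0)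
    rw [this, ENNReal.mul_top]
    · exact le_top
    · simp [hr.le]
  obtain ⟨n, hn1, hn2⟩ := ENNReal.exists_mem_Ioc_zpow h0 h1 (y := 2) (by norm_num) (by simp)
  calc h ^ r ≤ ((2:ℝ≥0∞) ^ (n+1)) ^ r := by gcongr
    _ = 2 ^ r * ((2:ℝ≥0∞) ^ n) ^ r := by
      rw [ENNReal.zpow_add (by simp) (by simp), ENNReal.mul_rpow_of_nonneg _ _ hr.le, mul_comm]
      simp
    _ ≤ _ := by
      gcongr
      refine le_trans ?_ (ENNReal.le_tsum n)
      rw [if_pos hn1]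

/-- discretised layer cake, lower bound -/
lemma tsum_le_rpow (r : ℝ) (hr : 0 < r) : ∃ C : ℝ≥0∞, C ≠ ∞ ∧ ∀ h : ℝ≥0∞,
    ∑' k : ℤ, (if (2:ℝ≥0∞) ^ k < h then ((2:ℝ≥0∞) ^ k) ^ r else 0) ≤ C * h ^ r := by
  have hlt : (2:ℝ≥0∞) ^ (-r) < 1 := ENNReal.rpow_lt_one_of_one_lt_of_neg (by norm_num) (by linarith)
  refine ⟨1 + (1 - (2:ℝ≥0∞) ^ (-r))⁻¹, ?_, ?_⟩
  · have : 1 - (2:ℝ≥0∞) ^ (-r) ≠ 0 := (tsub_pos_of_lt hlt).ne'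
    simp [this]
  intro h
  rcases eq_or_ne h 0 with rfl | h0
  · simp
  rcases eq_or_ne h ∞ with rfl | h1
  · rw [ENNReal.top_rpow_of_pos hr, ENNReal.mul_top (by simp)]; exact le_top
  obtain ⟨n, hn1, hn2⟩ := ENNReal.exists_mem_Ioc_zpow h0 h1 (y := 2) (by norm_num) (by simp)
  have hmono : ∀ k : ℤ, (2:ℝ≥0∞) ^ k < h → k ≤ n := by
    intro k hk
    by_contra hcon
    push Not at hcon
    have := ENNReal.zpow_le_of_le (x := 2) (by norm_num) (show n + 1 ≤ k by omega)
    exact absurd (hk.trans_le hn2) (not_lt.2 this)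
  have hinj : Function.Injective (fun m : ℕ => n - (m:ℤ)) := by
    intro a b hab; simpa using hab
  rw [← hinj.tsum_eq]
  · calc ∑' c : ℕ, (if (2:ℝ≥0∞) ^ (n - (c:ℤ)) < h then ((2:ℝ≥0∞) ^ (n - (c:ℤ))) ^ r else 0)
        ≤ ∑' c : ℕ, h ^ r * ((2:ℝ≥0∞) ^ (-r)) ^ c := by
          refine ENNReal.tsum_le_tsum fun c => ?_
          split_ifs with hc
          · rw [sub_eq_add_neg, ENNReal.zpow_add (by simp) (by simp),
              ENNReal.mul_rpow_of_nonneg _ _ hr.le]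
            have : ((2:ℝ≥0∞) ^ (-(c:ℤ))) ^ r = ((2:ℝ≥0∞) ^ (-r)) ^ c := by
              rw [← ENNReal.rpow_intCast, ← ENNReal.rpow_natCast, ← ENNReal.rpow_mul,
                ← ENNReal.rpow_mul]
              congr 1; push_cast; ring
            rw [this]
            gcongr
          · simp
      _ = h ^ r * (1 - (2:ℝ≥0∞) ^ (-r))⁻¹ := by
          rw [ENNReal.tsum_mul_left, ENNReal.tsum_geometric]
      _ ≤ _ := by rw [mul_comm]; gcongr; exact le_add_self
  · intro k hk
    have : (2:ℝ≥0∞) ^ k < h := by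
      by_contra hcon
      simp [hcon] at hk
    exact ⟨(n - k).toNat, by have := hmono k this; simp; omega⟩

lemma lintegral_rpow_le_tsum (r : ℝ) (hr : 0 < r) (h : ℝ → ℝ≥0∞) (hh : Measurable h) :
    ∫⁻ x, h x ^ r ≤ (2:ℝ≥0∞) ^ r * ∑' k : ℤ, ((2:ℝ≥0∞) ^ k) ^ r * volume {x | (2:ℝ≥0∞) ^ k < h x} := by
  calc ∫⁻ x, h x ^ r ≤ ∫⁻ x, (2:ℝ≥0∞) ^ r * ∑' k : ℤ, (if (2:ℝ≥0∞) ^ k < h x then ((2:ℝ≥0∞) ^ k) ^ r else 0) :=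
        lintegral_mono fun x => rpow_le_tsum r hr _
    _ = (2:ℝ≥0∞) ^ r * ∑' k : ℤ, ∫⁻ x, (if (2:ℝ≥0∞) ^ k < h x then ((2:ℝ≥0∞) ^ k) ^ r else 0) := by
        rw [lintegral_const_mul' _ _ (by simp), lintegral_tsum]
        intro k
        exact (Measurable.ite (measurableSet_lt measurable_const hh) measurable_const
          measurable_const).aemeasurable
    _ = _ := by
        congr 2; ext k
        rw [← lintegral_indicator_const (measurableSet_lt measurable_const hh)]
        congr 1; ext x; simp [Set.indicator]

lemma tsum_le_lintegral_rpow (r : ℝ) (hr : 0 < r) : ∃ C : ℝ≥0∞, C ≠ ∞ ∧ ∀ h : ℝ → ℝ≥0∞, Measurable h →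
    ∑' k : ℤ, ((2:ℝ≥0∞) ^ k) ^ r * volume {x | (2:ℝ≥0∞) ^ k < h x} ≤ C * ∫⁻ x, h x ^ r := by
  obtain ⟨C, hC, hh⟩ := tsum_le_rpow r hr
  refine ⟨C, hC, fun h hm => ?_⟩
  calc ∑' k : ℤ, ((2:ℝ≥0∞) ^ k) ^ r * volume {x | (2:ℝ≥0∞) ^ k < h x}
      = ∑' k : ℤ, ∫⁻ x, (if (2:ℝ≥0∞) ^ k < h x then ((2:ℝ≥0∞) ^ k) ^ r else 0) := by
        congr 1; ext k
        rw [← lintegral_indicator_const (measurableSet_lt measurable_const hm)]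
        congr 1; ext x; simp [Set.indicator]
    _ = ∫⁻ x, ∑' k : ℤ, (if (2:ℝ≥0∞) ^ k < h x then ((2:ℝ≥0∞) ^ k) ^ r else 0) := by
        rw [lintegral_tsum]
        intro k
        exact (Measurable.ite (measurableSet_lt measurable_const hm) measurable_const
          measurable_const).aemeasurable
    _ ≤ ∫⁻ x, C * h x ^ r := lintegral_mono fun x => hh _
    _ = _ := lintegral_const_mul' _ _ hC

lemma MF_add_le (w v : ℝ → ℝ≥0∞) (hw : Measurable w) (x : ℝ) :
    MF (fun y => w y + v y) x ≤ MF w x + MF v x := by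
  refine iSup₂_le fun c ρ => iSup_le fun h => ?_
  rw [lintegral_add_left hw, ENNReal.add_div]
  exact add_le_add (le_iSup₂_of_le c ρ (le_iSup_of_le h le_rfl))
    (le_iSup₂_of_le c ρ (le_iSup_of_le h le_rfl))

lemma MF_const_le (t : ℝ≥0∞) (x : ℝ) : MF (fun _ => t) x ≤ t := by
  refine iSup₂_le fun c ρ => iSup_le fun h => ?_
  have hρ : 0 < ρ := Metric.pos_of_mem_ball h
  rw [ENNReal.div_le_iff_le_mul (Or.inl (by simp; linarith)) (Or.inl ENNReal.ofReal_ne_top)]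
  simp

lemma MF_strong (p : ℝ) (hp : 1 < p) : ∃ C : ℝ≥0∞, C ≠ ∞ ∧ ∀ w : ℝ → ℝ≥0∞, Measurable w →
    ∫⁻ x, MF w x ^ p ≤ C * ∫⁻ x, w x ^ p := by
  obtain ⟨C, hC, hh⟩ := tsum_le_rpow (p - 1) (by linarith)
  refine ⟨2 ^ p * ((2 ^ p * 4) * C), by
    refine ENNReal.mul_ne_top (by simp) (ENNReal.mul_ne_top (ENNReal.mul_ne_top (by simp) (by simp)) hC), ?_⟩
  intro w hw
  refine (lintegral_rpow_le_tsum p (by linarith) _ (measurable_MF w)).trans ?_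
  rw [mul_assoc]
  gcongr
  -- one level
  have key : ∀ k : ℤ, ((2:ℝ≥0∞) ^ k) * volume {x | (2:ℝ≥0∞) ^ (k + 1) < MF w x} ≤
      4 * ∫⁻ x, (if (2:ℝ≥0∞) ^ k < w x then w x else 0) := by
    intro k
    have hk0 : (2:ℝ≥0∞) ^ k ≠ 0 := (ENNReal.zpow_pos (by simp) (by simp) k).ne'
    have hkt : (2:ℝ≥0∞) ^ k ≠ ∞ := ENNReal.zpow_ne_top (by simp) (by simp) k
    have hmeas : Measurable (fun x => if (2:ℝ≥0∞) ^ k < w x then w x else 0) :=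
      Measurable.ite (measurableSet_lt measurable_const hw) hw measurable_const
    refine le_trans ?_ (MF_weak _ _ hk0 hkt)
    refine mul_le_mul' le_rfl (measure_mono ?_)
    intro x hx
    have h1 : MF w x ≤ MF (fun x => if (2:ℝ≥0∞) ^ k < w x then w x else 0) x + 2 ^ k := by
      refine le_trans ?_ ((MF_add_le _ (fun _ => 2 ^ k) hmeas x).trans
        (add_le_add le_rfl (MF_const_le _ _)))
      refine MF_mono (fun y => ?_) x
      split_ifs with h
      · exact le_self_add
      · simpa using h
    have h2 : (2:ℝ≥0∞) ^ (k+1) = 2 ^ k + 2 ^ k := by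
      rw [ENNReal.zpow_add (by simp) (by simp)]; simp [mul_two]
    have hx' : (2:ℝ≥0∞) ^ (k+1) < MF w x := hx
    rw [h2] at hx'
    exact (ENNReal.add_lt_add_iff_right hkt).1 (hx'.trans_le h1)
  have shift : ∑' k : ℤ, ((2:ℝ≥0∞) ^ k) ^ p * volume {x | (2:ℝ≥0∞) ^ k < MF w x} =
      ∑' k : ℤ, ((2:ℝ≥0∞) ^ (k+1)) ^ p * volume {x | (2:ℝ≥0∞) ^ (k+1) < MF w x} :=
    ((Equiv.addRight (1:ℤ)).tsum_eq (fun k : ℤ => ((2:ℝ≥0∞) ^ k) ^ p * volume {x | (2:ℝ≥0∞) ^ k < MF w x})).symm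
  rw [shift]
  calc ∑' k : ℤ, ((2:ℝ≥0∞) ^ (k+1)) ^ p * volume {x | (2:ℝ≥0∞) ^ (k+1) < MF w x}
      ≤ ∑' k : ℤ, (2 ^ p * 4) * ∫⁻ x, (if (2:ℝ≥0∞) ^ k < w x then ((2:ℝ≥0∞) ^ k) ^ (p-1) * w x else 0) := by
        refine ENNReal.tsum_le_tsum fun k => ?_
        have hk0 : (2:ℝ≥0∞) ^ k ≠ 0 := (ENNReal.zpow_pos (by simp) (by simp) k).ne'
        have hkt : (2:ℝ≥0∞) ^ k ≠ ∞ := ENNReal.zpow_ne_top (by simp) (by simp) k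
        have e1 : ((2:ℝ≥0∞) ^ (k+1)) ^ p = 2 ^ p * (((2:ℝ≥0∞) ^ k) ^ (p-1) * (2:ℝ≥0∞) ^ k) := by
          rw [ENNReal.zpow_add (by simp) (by simp), ENNReal.mul_rpow_of_nonneg _ _ (by linarith), mul_comm]
          congr 1
          · simp
          · conv_rhs => rw [← ENNReal.rpow_one ((2:ℝ≥0∞) ^ k), ← ENNReal.rpow_mul]
            rw [one_mul, ← ENNReal.rpow_add _ _ hk0 hkt]; congr 1; ring
        have e2 : ∫⁻ x, (if (2:ℝ≥0∞) ^ k < w x then ((2:ℝ≥0∞) ^ k) ^ (p-1) * w x else 0)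
            = ((2:ℝ≥0∞) ^ k) ^ (p-1) * ∫⁻ x, (if (2:ℝ≥0∞) ^ k < w x then w x else 0) := by
          rw [← lintegral_const_mul']
          · congr 1; ext x; split_ifs <;> simp
          · exact ENNReal.rpow_ne_top_of_nonneg (by linarith) hkt
        rw [e1, e2]
        calc 2 ^ p * (((2:ℝ≥0∞) ^ k) ^ (p-1) * (2:ℝ≥0∞) ^ k) * volume {x | (2:ℝ≥0∞) ^ (k+1) < MF w x}
            = 2 ^ p * ((2:ℝ≥0∞) ^ k) ^ (p-1) * ((2:ℝ≥0∞) ^ k * volume {x | (2:ℝ≥0∞) ^ (k+1) < MF w x}) := by ring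
          _ ≤ 2 ^ p * ((2:ℝ≥0∞) ^ k) ^ (p-1) * (4 * ∫⁻ x, (if (2:ℝ≥0∞) ^ k < w x then w x else 0)) :=
            mul_le_mul' le_rfl (key k)
          _ = _ := by ring
    _ = (2 ^ p * 4) * ∫⁻ x, ∑' k : ℤ, (if (2:ℝ≥0∞) ^ k < w x then ((2:ℝ≥0∞) ^ k) ^ (p-1) * w x else 0) := by
        rw [ENNReal.tsum_mul_left, lintegral_tsum]
        intro k
        exact (Measurable.ite (measurableSet_lt measurable_const hw) (hw.const_mul _)
          measurable_const).aemeasurable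
    _ ≤ (2 ^ p * 4) * ∫⁻ x, C * w x ^ p := by
        gcongr with x
        have : ∀ k : ℤ, (if (2:ℝ≥0∞) ^ k < w x then ((2:ℝ≥0∞) ^ k) ^ (p-1) * w x else 0)
          = (if (2:ℝ≥0∞) ^ k < w x then ((2:ℝ≥0∞) ^ k) ^ (p-1) else 0) * w x := by
          intro k; split_ifs <;> simp
        simp_rw [this]
        rw [ENNReal.tsum_mul_right]
        refine (mul_le_mul' (hh _) le_rfl).trans ?_
        rw [mul_assoc]
        gcongr
        rcases eq_or_ne (w x) 0 with h0 | h0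
        · simp [h0]
        rcases eq_or_ne (w x) ∞ with h1 | h1
        · rw [h1, ENNReal.top_rpow_of_pos (by linarith : 0 < p)]; exact le_top
        conv_lhs => rw [← ENNReal.rpow_one (w x), ← ENNReal.rpow_mul]
        rw [one_mul, ← ENNReal.rpow_add _ _ h0 h1]
        apply le_of_eq; congr 1; ring
    _ = _ := by rw [lintegral_const_mul' _ _ hC]; ring



lemma le_MF_ae (w : ℝ → ℝ≥0∞) (hw : Measurable w) (hfin : ∫⁻ x, w x ≠ ∞) :
    ∀ᵐ x, w x ≤ MF w x := by
  filter_upwards [(Besicovitch.vitaliFamily (volume : Measure ℝ)).ae_tendsto_lintegral_div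
    hw.aemeasurable hfin] with x hx
  have h2 := hx.comp (Besicovitch.tendsto_filterAt volume x)
  refine le_of_tendsto h2 ?_
  filter_upwards [self_mem_nhdsWithin] with r hr
  have hr : 0 < r := hr
  simp only [Function.comp]
  rw [Real.volume_closedBall]
  have : ∫⁻ y in Metric.closedBall x r, w y = ∫⁻ y in Metric.ball x r, w y := by
    apply setLIntegral_congr
    rw [Real.closedBall_eq_Icc, Real.ball_eq_Ioo]
    exact Ioo_ae_eq_Icc.symm
  rw [this]
  exact le_iSup₂_of_le x r (le_iSup_of_le (Metric.mem_ball_self hr) le_rfl)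

lemma open_decomp (Ω : Set ℝ) (hΩ : IsOpen Ω) (hfin : volume Ω ≠ ∞) :
    ∃ T : Set (ℝ × ℝ), T.Countable ∧ (∀ a ∈ T, a.1 < a.2) ∧
      T.PairwiseDisjoint (fun a => Set.Ioo a.1 a.2) ∧ Ω = (⋃ a ∈ T, Set.Ioo a.1 a.2) ∧
      ∀ a ∈ T, a.1 ∉ Ω ∧ a.2 ∉ Ω := by
  let C := fun x => connectedComponentIn Ω x
  have hopen : ∀ x, IsOpen (C x) := fun x => hΩ.connectedComponentIn
  have hsub : ∀ x, C x ⊆ Ω := fun x => connectedComponentIn_subset Ω x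
  have hpre : ∀ x, IsPreconnected (C x) := fun x => isPreconnected_connectedComponentIn
  have hmem : ∀ x ∈ Ω, x ∈ C x := fun x hx => mem_connectedComponentIn hx
  have hvol : ∀ x, volume (C x) ≠ ∞ := fun x => ((measure_mono (hsub x)).trans_lt hfin.lt_top).ne
  have hba : ∀ x ∈ Ω, BddAbove (C x) := by
    intro x hx
    by_contra hcon
    have : Set.Ici x ⊆ C x := by
      intro y hy
      obtain ⟨z, hz, hyz⟩ := not_bddAbove_iff.1 hcon y
      exact (hpre x).ordConnected.out (hmem x hx) hz ⟨hy, hyz.le⟩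
    have h := measure_mono (μ := volume) this
    rw [Real.volume_Ici, top_le_iff] at h
    exact hvol x h
  have hbb : ∀ x ∈ Ω, BddBelow (C x) := by
    intro x hx
    by_contra hcon
    have : Set.Iic x ⊆ C x := by
      intro y hy
      obtain ⟨z, hz, hyz⟩ := not_bddBelow_iff.1 hcon y
      exact (hpre x).ordConnected.out hz (hmem x hx) ⟨hyz.le, hy⟩
    have h := measure_mono (μ := volume) this
    rw [Real.volume_Iic, top_le_iff] at h
    exact hvol x h
  have hIoo : ∀ x ∈ Ω, C x = Set.Ioo (sInf (C x)) (sSup (C x)) := by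
    intro x hx
    apply Set.Subset.antisymm
    · intro y hy
      obtain ⟨ε, hε, hball⟩ := Metric.isOpen_iff.1 (hopen x) y hy
      rw [Real.ball_eq_Ioo] at hball
      have h1 := csInf_le (hbb x hx) (hball ⟨by linarith, by linarith⟩ : y - ε/2 ∈ C x)
      have h2 := le_csSup (hba x hx) (hball ⟨by linarith, by linarith⟩ : y + ε/2 ∈ C x)
      exact ⟨by linarith, by linarith⟩
    · exact IsConnected.Ioo_csInf_csSup_subset ⟨⟨x, hmem x hx⟩, hpre x⟩ (hbb x hx) (hba x hx)
  have hlt : ∀ x ∈ Ω, sInf (C x) < sSup (C x) := by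
    intro x hx
    have := hmem x hx
    rw [hIoo x hx] at this
    exact this.1.trans this.2
  have hclos : ∀ x ∈ Ω, ∀ y ∈ closure (C x), y ∉ C x → y ∉ Ω := by
    intro x hx y hy hyn hyΩ
    obtain ⟨z, hz1, hz2⟩ := mem_closure_iff.1 hy (C y) (hopen y) (hmem y hyΩ)
    have e1 : C x = C z := connectedComponentIn_eq hz2
    have e2 : C y = C z := connectedComponentIn_eq hz1
    exact hyn (by rw [e1, ← e2]; exact hmem y hyΩ)
  let T : Set (ℝ × ℝ) := (fun x => (sInf (C x), sSup (C x))) '' Ω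
  have hT : T.PairwiseDisjoint (fun a => Set.Ioo a.1 a.2) := by
    rintro _ ⟨x, hx, rfl⟩ _ ⟨y, hy, rfl⟩ hne
    simp only [Function.onFun]
    rw [← hIoo x hx, ← hIoo y hy, Set.disjoint_left]
    intro z hz1 hz2
    have e1 : C x = C z := connectedComponentIn_eq hz1
    have e2 : C y = C z := connectedComponentIn_eq hz2
    apply hne; simp only [e1, e2]
  refine ⟨T, ?_, ?_, hT, ?_, ?_⟩
  · refine hT.countable_of_isOpen (fun _ _ => isOpen_Ioo) ?_
    rintro _ ⟨x, hx, rfl⟩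
    exact Set.nonempty_Ioo.2 (hlt x hx)
  · rintro _ ⟨x, hx, rfl⟩; exact hlt x hx
  · apply Set.Subset.antisymm
    · intro x hx
      refine Set.mem_biUnion (Set.mem_image_of_mem _ hx) ?_
      rw [← hIoo x hx]; exact hmem x hx
    · intro y hy
      simp only [Set.mem_iUnion] at hy
      obtain ⟨_, ⟨x, hx, rfl⟩, hy⟩ := hy
      rw [← hIoo x hx] at hy
      exact hsub x hy
  · rintro _ ⟨x, hx, rfl⟩
    constructor
    · apply hclos x hx
      · exact csInf_mem_closure ⟨x, hmem x hx⟩ (hbb x hx)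
      · intro h; rw [hIoo x hx] at h; exact lt_irrefl _ h.1
    · apply hclos x hx
      · exact csSup_mem_closure ⟨x, hmem x hx⟩ (hba x hx)
      · intro h; rw [hIoo x hx] at h; exact lt_irrefl _ h.2

/-- measure of a countable disjoint family of intervals -/
lemma tsum_len {T : Set (ℝ × ℝ)} (hc : T.Countable)
    (hd : T.PairwiseDisjoint (fun a => Set.Ioo a.1 a.2)) :
    ∑' a : T, ENNReal.ofReal (a.1.2 - a.1.1) = volume (⋃ a ∈ T, Set.Ioo a.1 a.2) := by
  have := hc.to_subtype
  rw [measure_biUnion hc hd (fun _ _ => measurableSet_Ioo)]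
  simp

/-- one level good-lambda -/
lemma good_lambda_level (H K : ℝ → ℝ≥0∞) (hH : Measurable H) (hK : Measurable K)
    (ε : ℝ) (hε1 : ε < 1) (κ l : ℝ≥0∞)
    (hosc : ∀ c ρ : ℝ, 0 < ρ → ∀ x1 ∈ Metric.ball c ρ, K x1 ≤ κ → ∃ Z : Set ℝ,
      volume Z ≤ ENNReal.ofReal (ε * ρ) ∧ ∀ x ∈ Metric.ball c ρ, ∀ x' ∈ Metric.ball c ρ,
        x ∉ Z → x' ∉ Z → H x ≤ H x' + l)
    (hfin : volume {x | l < H x} ≠ ∞) :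
    volume {x | 2 * l < H x} ≤ 8 * ENNReal.ofReal ε * volume {x | l < H x} + volume {x | κ < K x} := by
  set A : Set ℝ := {x | l < H x} with hA
  have hAm : MeasurableSet A := measurableSet_lt measurable_const hH
  let w : ℝ → ℝ≥0∞ := A.indicator 1
  have hw : Measurable w := measurable_one.indicator hAm
  have hwint : ∫⁻ x, w x = volume A := lintegral_indicator_one hAm
  set Ω : Set ℝ := {x | (1/2 : ℝ≥0∞) < MF w x} with hΩ
  have hweak := MF_weak w (1/2) (by simp) (by simp)
  have hΩvol : volume Ω ≤ 8 * volume A := by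
    rw [hwint] at hweak
    calc volume Ω = 2 * (1/2 * volume Ω) := by
          rw [← mul_assoc, one_div, ENNReal.mul_inv_cancel (by simp) (by simp), one_mul]
      _ ≤ 2 * (4 * volume A) := by gcongr
      _ = 8 * volume A := by rw [← mul_assoc]; norm_num
  obtain ⟨T, hc, hlt, hd, hU, hend⟩ := open_decomp Ω (isOpen_MF w _)
    (ne_top_of_le_ne_top (ENNReal.mul_ne_top (by simp) hfin) hΩvol)
  have hae : ∀ᵐ x, w x ≤ MF w x := le_MF_ae w hw (by rwa [hwint])
  have hcover : volume {x | 2 * l < H x} ≤ volume ({x | 2 * l < H x} ∩ Ω) := by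
    apply measure_mono_ae
    filter_upwards [hae] with x hx hx2
    have hx2 : 2 * l < H x := hx2
    refine ⟨hx2, ?_⟩
    have hxA : x ∈ A := lt_of_le_of_lt (by rw [two_mul]; exact le_self_add) hx2
    simp only [w, Set.indicator_of_mem hxA] at hx
    refine lt_of_lt_of_le ?_ hx
    simp
  have hpiece : ∀ a ∈ T, volume (({x | 2 * l < H x} ∩ {x | K x ≤ κ}) ∩ Set.Ioo a.1 a.2) ≤
      ENNReal.ofReal ε * ENNReal.ofReal (a.2 - a.1) := by
    intro a ha
    have hl := hlt a ha
    by_cases hex : ∃ x1 ∈ Set.Ioo a.1 a.2, K x1 ≤ κ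
    swap
    · push Not at hex
      have : ({x | 2 * l < H x} ∩ {x | K x ≤ κ}) ∩ Set.Ioo a.1 a.2 = ∅ := by
        ext x; simp only [Set.mem_inter_iff, Set.mem_ofPred_eq, Set.mem_empty_iff_false, iff_false]
        rintro ⟨⟨_, h2⟩, h3⟩
        exact absurd h2 (not_le.2 (hex x h3))
      rw [this]; simp
    obtain ⟨x1, hx1, hKx1⟩ := hex
    set ρ := a.2 - a.1 with hρ
    have hρ0 : 0 < ρ := by linarith
    have hball : Metric.ball a.1 ρ = Set.Ioo (a.1 - ρ) a.2 := by
      rw [Real.ball_eq_Ioo]; congr 1; simp [hρ]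
    have hIsub : Set.Ioo a.1 a.2 ⊆ Metric.ball a.1 ρ := by
      rw [hball]; exact Set.Ioo_subset_Ioo_left (by linarith)
    obtain ⟨Z, hZ, hZ2⟩ := hosc a.1 ρ hρ0 x1 (hIsub hx1) hKx1
    -- a good point
    have hgood : ∃ x' ∈ Metric.ball a.1 ρ, x' ∉ Z ∧ H x' ≤ l := by
      by_contra hcon
      push Not at hcon
      have hsub : Metric.ball a.1 ρ ⊆ Z ∪ (A ∩ Metric.ball a.1 ρ) := by
        intro x hx
        by_cases hz : x ∈ Z
        · exact Or.inl hz
        · exact Or.inr ⟨hcon x hx hz, hx⟩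
      have h1 : volume (A ∩ Metric.ball a.1 ρ) ≤ ENNReal.ofReal ρ := by
        have hMF : MF w a.1 ≤ 1/2 := not_lt.1 (hend a ha).1
        have h2 := lintegral_ball_le_MF w (Metric.mem_ball_self (x := a.1) hρ0)
        have h3 : ∫⁻ y in Metric.ball a.1 ρ, w y = volume (A ∩ Metric.ball a.1 ρ) := by
          simp only [w]
          rw [lintegral_indicator_one hAm, Measure.restrict_apply hAm]
        rw [← h3]
        refine h2.trans ((mul_le_mul' le_rfl hMF).trans ?_)
        rw [mul_comm 2 ρ, ENNReal.ofReal_mul hρ0.le, mul_assoc]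
        simp [ENNReal.mul_inv_cancel]
      have h2 := (measure_mono (μ := volume) hsub).trans (measure_union_le _ _)
      rw [Real.volume_ball] at h2
      have h3 := h2.trans (add_le_add hZ h1)
      by_cases hε0 : 0 ≤ ε
      · rw [← ENNReal.ofReal_add (by positivity) hρ0.le, ENNReal.ofReal_le_ofReal_iff (by positivity)] at h3
        nlinarith
      · have hz : ENNReal.ofReal (ε * ρ) = 0 := ENNReal.ofReal_of_nonpos (by nlinarith)
        rw [hz, zero_add, ENNReal.ofReal_le_ofReal_iff hρ0.le] at h3
        linarith
    obtain ⟨x', hx'b, hx'Z, hx'H⟩ := hgood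
    calc volume (({x | 2 * l < H x} ∩ {x | K x ≤ κ}) ∩ Set.Ioo a.1 a.2) ≤ volume Z := by
          apply measure_mono
          rintro x ⟨⟨h1, _⟩, h3⟩
          by_contra hxZ
          have := hZ2 x (hIsub h3) x' hx'b hxZ hx'Z
          have h4 : H x ≤ 2 * l := by rw [two_mul]; exact this.trans (by gcongr)
          exact absurd h1 (not_lt.2 h4)
      _ ≤ ENNReal.ofReal (ε * ρ) := hZ
      _ = _ := by rw [ENNReal.ofReal_mul' hρ0.le]
  have := hc.to_subtype
  calc volume {x | 2 * l < H x} ≤ volume ({x | 2 * l < H x} ∩ Ω) := hcover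
    _ ≤ volume ((⋃ a : T, (({x | 2 * l < H x} ∩ {x | K x ≤ κ}) ∩ Set.Ioo a.1.1 a.1.2)) ∪ {x | κ < K x}) := by
        apply measure_mono
        rintro x ⟨h1, h2⟩
        rw [hU] at h2
        simp only [Set.mem_iUnion] at h2
        obtain ⟨a, ha, hxa⟩ := h2
        by_cases hk : K x ≤ κ
        · exact Or.inl (Set.mem_iUnion.2 ⟨⟨a, ha⟩, ⟨h1, hk⟩, hxa⟩)
        · exact Or.inr (not_le.1 hk)
    _ ≤ (∑' a : T, ENNReal.ofReal ε * ENNReal.ofReal (a.1.2 - a.1.1)) + volume {x | κ < K x} := by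
        refine (measure_union_le _ _).trans (add_le_add ((measure_iUnion_le _).trans ?_) le_rfl)
        exact ENNReal.tsum_le_tsum fun a => hpiece a.1 a.2
    _ = ENNReal.ofReal ε * volume Ω + volume {x | κ < K x} := by
        rw [ENNReal.tsum_mul_left, tsum_len hc hd, ← hU]
    _ ≤ ENNReal.ofReal ε * (8 * volume A) + volume {x | κ < K x} := by gcongr
    _ = _ := by ring

lemma good_lambda (r : ℝ) (hr : 0 < r) : ∃ ε : ℝ, 0 < ε ∧ ε < 1 ∧ ∀ γ : ℝ≥0∞, γ ≠ 0 → γ ≠ ∞ →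
    ∃ C : ℝ≥0∞, C ≠ ∞ ∧ ∀ (H K : ℝ → ℝ≥0∞), Measurable H → Measurable K →
    (∀ k : ℤ, ∀ c ρ : ℝ, 0 < ρ → ∀ x1 ∈ Metric.ball c ρ, K x1 ≤ γ * 2 ^ k → ∃ Z : Set ℝ,
      volume Z ≤ ENNReal.ofReal (ε * ρ) ∧ ∀ x ∈ Metric.ball c ρ, ∀ x' ∈ Metric.ball c ρ,
        x ∉ Z → x' ∉ Z → H x ≤ H x' + 2 ^ k) →
    ∫⁻ x, H x ^ r ≠ ∞ → ∫⁻ x, H x ^ r ≤ C * ∫⁻ x, K x ^ r := by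
  obtain ⟨C1, hC1, h1⟩ := tsum_le_lintegral_rpow r hr
  have h2r : (0:ℝ) < 2 ^ r := by positivity
  have h2r1 : (1:ℝ) ≤ 2 ^ r := Real.one_le_rpow (by norm_num) hr.le
  refine ⟨1 / (16 * 2 ^ r), by positivity, ?_, ?_⟩
  · rw [div_lt_one (by positivity)]; nlinarith
  intro γ hγ0 hγt
  refine ⟨2 ^ r * (2 * 2 ^ r * (C1 * (γ⁻¹) ^ r)), by finiteness, ?_⟩
  intro H K hH hK hosc hfin
  set ε : ℝ := 1 / (16 * 2 ^ r) with hε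
  have hz : ∀ k : ℤ, (2:ℝ≥0∞) ^ k ≠ 0 := fun k => (ENNReal.zpow_pos (by simp) (by simp) k).ne'
  have hzt : ∀ k : ℤ, (2:ℝ≥0∞) ^ k ≠ ∞ := fun k => ENNReal.zpow_ne_top (by simp) (by simp) k
  set X := ∑' k : ℤ, ((2:ℝ≥0∞) ^ k) ^ r * volume {x | (2:ℝ≥0∞) ^ k < H x} with hX
  have hXfin : X ≠ ∞ := ne_top_of_le_ne_top (ENNReal.mul_ne_top hC1 hfin) (h1 H hH)
  have hV : ∀ k : ℤ, volume {x | (2:ℝ≥0∞) ^ k < H x} ≠ ∞ := by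
    intro k h
    have := ENNReal.ne_top_of_tsum_ne_top hXfin k
    rw [h] at this
    apply this
    rw [ENNReal.mul_top]
    exact (ENNReal.rpow_pos (pos_iff_ne_zero.2 (hz k)) (hzt k)).ne'
  set Y := ∑' k : ℤ, ((2:ℝ≥0∞) ^ k) ^ r * volume {x | γ * (2:ℝ≥0∞) ^ k < K x} with hY
  have hYle : Y ≤ C1 * (γ⁻¹) ^ r * ∫⁻ x, K x ^ r := by
    have := h1 (fun x => γ⁻¹ * K x) (hK.const_mul _)
    have e : ∀ k : ℤ, {x | γ * (2:ℝ≥0∞) ^ k < K x} = {x | (2:ℝ≥0∞) ^ k < γ⁻¹ * K x} := by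
      intro k; ext x
      simp only [Set.mem_ofPred_eq]
      rw [mul_comm γ⁻¹, ← div_eq_mul_inv, ENNReal.lt_div_iff_mul_lt (Or.inl hγ0) (Or.inl hγt), mul_comm]
    rw [hY]
    simp_rw [e]
    refine this.trans_eq ?_
    simp_rw [ENNReal.mul_rpow_of_nonneg _ _ hr.le]
    rw [lintegral_const_mul _ (hK.pow_const r), mul_assoc]
  have hXY : X ≤ 2 ^ r * (8 * ENNReal.ofReal ε) * X + 2 ^ r * Y := by
    conv_lhs => rw [hX, ← (Equiv.addRight (1:ℤ)).tsum_eq]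
    rw [hX, hY, ← ENNReal.tsum_mul_left, ← ENNReal.tsum_mul_left, ← ENNReal.tsum_add]
    refine ENNReal.tsum_le_tsum fun k => ?_
    have e2 : (2:ℝ≥0∞) ^ (k + 1) = 2 * 2 ^ k := by
      rw [ENNReal.zpow_add (by simp) (by simp), zpow_one, mul_comm]
    simp only [Equiv.coe_addRight, e2, ENNReal.mul_rpow_of_nonneg _ _ hr.le]
    have := good_lambda_level H K hH hK ε (by
      rw [hε, div_lt_one (by positivity)]; nlinarith) (γ * 2 ^ k) (2 ^ k) (hosc k) (hV k)
    calc _ ≤ 2 ^ r * ((2:ℝ≥0∞) ^ k) ^ r * (8 * ENNReal.ofReal ε * volume {x | 2 ^ k < H x} + volume {x | γ * 2 ^ k < K x}) := by gcongr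
      _ = _ := by ring
  have hhalf : 2 ^ r * (8 * ENNReal.ofReal ε) = (2⁻¹ : ℝ≥0∞) := by
    have : (2:ℝ≥0∞) ^ r = ENNReal.ofReal (2 ^ r) := by
      rw [← ENNReal.ofReal_rpow_of_pos (by norm_num)]; simp
    rw [this, show (8:ℝ≥0∞) = ENNReal.ofReal 8 by simp, ← ENNReal.ofReal_mul (by norm_num),
      ← ENNReal.ofReal_mul (by positivity), hε]
    rw [show (2:ℝ) ^ r * (8 * (1 / (16 * 2 ^ r))) = 2⁻¹ by field_simp; norm_num]
    rw [ENNReal.ofReal_inv_of_pos (by norm_num)]; simp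
  have hX2 : X ≤ 2 * 2 ^ r * Y := by
    rw [hhalf] at hXY
    have h3 : X = 2⁻¹ * X + 2⁻¹ * X := by
      rw [← add_mul, ENNReal.inv_two_add_inv_two, one_mul]
    have h4 : 2⁻¹ * X ≤ 2 ^ r * Y := by
      have h5 : 2⁻¹ * X ≠ ∞ := by finiteness
      apply (ENNReal.add_le_add_iff_left h5).1
      rw [← h3]; exact hXY
    calc X = 2 * (2⁻¹ * X) := by rw [← mul_assoc, ENNReal.mul_inv_cancel (by simp) (by simp), one_mul]
      _ ≤ 2 * (2 ^ r * Y) := by gcongr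
      _ = _ := by ring
  calc ∫⁻ x, H x ^ r ≤ 2 ^ r * X := lintegral_rpow_le_tsum r hr H hH
    _ ≤ 2 ^ r * (2 * 2 ^ r * (C1 * (γ⁻¹) ^ r * ∫⁻ x, K x ^ r)) := by gcongr; exact hX2.trans (by gcongr)
    _ = _ := by ring



/-- the model kernel `2^j (1+2^j|x|)^{-n}` -/
def kn (n : ℕ) (j : ℤ) (x : ℝ) : ℝ≥0∞ := ENNReal.ofReal (2 ^ j / (1 + 2 ^ j * |x|) ^ n)

lemma two_zpow_pos (j : ℤ) : (0:ℝ) < 2 ^ j := by positivity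

lemma om_pos (j : ℤ) (x : ℝ) : (1:ℝ) ≤ 1 + 2 ^ j * |x| := by
  have : (0:ℝ) ≤ 2 ^ j * |x| := by positivity
  linarith

lemma om_sub (j : ℤ) (x y z : ℝ) :
    1 + 2 ^ j * |x - z| ≤ (1 + 2 ^ j * |x - y|) * (1 + 2 ^ j * |y - z|) := by
  have h := abs_sub_le x y z
  have h2 := two_zpow_pos j
  have h3 : 0 ≤ (2 ^ j * |x - y|) * (2 ^ j * |y - z|) := by positivity
  nlinarith

@[fun_prop] lemma kn_continuous (n : ℕ) (j : ℤ) : Continuous (kn n j) := by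
  unfold kn
  refine ENNReal.continuous_ofReal.comp (Continuous.div (by fun_prop) (by fun_prop) ?_)
  intro x
  have := om_pos j x
  positivity

@[fun_prop] lemma kn_measurable (n : ℕ) (j : ℤ) : Measurable (kn n j) := (kn_continuous n j).measurable

lemma kn_neg (n : ℕ) (j : ℤ) (x : ℝ) : kn n j (-x) = kn n j x := by simp [kn]

lemma kn_comm (n : ℕ) (j : ℤ) (x y : ℝ) : kn n j (x - y) = kn n j (y - x) := by
  simp [kn, abs_sub_comm]

lemma kn_ne_top (n : ℕ) (j : ℤ) (x : ℝ) : kn n j x ≠ ∞ := by simp [kn]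

lemma kn_anti {n m : ℕ} (h : n ≤ m) (j : ℤ) (x : ℝ) : kn m j x ≤ kn n j x := by
  unfold kn
  have := om_pos j x
  have h2 := two_zpow_pos j
  gcongr

lemma kn_MF (j : ℤ) (w : ℝ → ℝ≥0∞) (hw : Measurable w) (x : ℝ) :
    ∫⁻ z, kn 2 j (x - z) * w z ≤ 16 * MF w x := by
  have h2 := two_zpow_pos j
  have key : ∀ z, kn 2 j (x - z) * w z ≤ ∑' k : ℕ, ENNReal.ofReal (2 ^ j * (4 * (1/4) ^ k)) *
      (Metric.ball x (2 ^ k / 2 ^ j)).indicator w z := by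
    intro z
    have hex : ∃ k : ℕ, 2 ^ j * |x - z| < 2 ^ k := pow_unbounded_of_one_lt _ (by norm_num)
    classical
    set k := Nat.find hex with hk
    have hk1 : 2 ^ j * |x - z| < 2 ^ k := Nat.find_spec hex
    refine le_trans ?_ (ENNReal.le_tsum k)
    have hz : z ∈ Metric.ball x (2 ^ k / 2 ^ j) := by
      rw [Metric.mem_ball, Real.dist_eq, lt_div_iff₀ h2, abs_sub_comm, mul_comm]; exact hk1
    rw [Set.indicator_of_mem hz]
    refine mul_le_mul' (ENNReal.ofReal_le_ofReal ?_) le_rfl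
    rw [div_eq_mul_inv]
    refine mul_le_mul_of_nonneg_left ?_ h2.le
    have h0 : 0 ≤ 2 ^ j * |x - z| := by positivity
    rcases Nat.eq_zero_or_pos k with h | h
    · rw [h]
      simp only [pow_zero, mul_one]
      have : (1 + 2 ^ j * |x - z|) ^ 2 ≥ 1 := by nlinarith
      exact (inv_le_one_of_one_le₀ this).trans (by norm_num)
    · obtain ⟨l, hl⟩ : ∃ l, k = l + 1 := ⟨k - 1, by omega⟩
      have h3 : (2:ℝ) ^ l ≤ 2 ^ j * |x - z| := by
        have := Nat.find_min hex (m := l) (by omega)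
        exact not_lt.1 this
      rw [hl, pow_succ (1/4 : ℝ)]
      have e : (4 * ((1 / 4 : ℝ) ^ l * (1 / 4))) = ((2:ℝ) ^ l * 2 ^ l)⁻¹ := by
        rw [← mul_pow, ← inv_pow]; norm_num; ring
      rw [e]
      apply inv_anti₀ (by positivity)
      have : (0:ℝ) < 2 ^ l := by positivity
      nlinarith
  calc _ ≤ ∫⁻ z, ∑' k : ℕ, ENNReal.ofReal (2 ^ j * (4 * (1/4) ^ k)) *
      (Metric.ball x (2 ^ k / 2 ^ j)).indicator w z := lintegral_mono key
    _ ≤ ∑' k : ℕ, ENNReal.ofReal (8 * (1/2)^k) * MF w x := by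
      rw [lintegral_tsum (fun k => ((hw.indicator measurableSet_ball).const_mul _).aemeasurable)]
      refine ENNReal.tsum_le_tsum fun k => ?_
      rw [lintegral_const_mul _ (hw.indicator measurableSet_ball), lintegral_indicator measurableSet_ball]
      have h3 : (0:ℝ) < 2 ^ k / 2 ^ j := by positivity
      refine (mul_le_mul' le_rfl (lintegral_ball_le_MF w (Metric.mem_ball_self h3))).trans ?_
      rw [← mul_assoc, ← ENNReal.ofReal_mul (by positivity)]
      refine mul_le_mul' (ENNReal.ofReal_le_ofReal (le_of_eq ?_)) le_rfl
      field_simp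
      rw [show (1/4:ℝ) = 1/2 * (1/2) by norm_num, mul_pow, one_div, inv_pow]; field_simp; norm_num
    _ ≤ _ := by
      rw [ENNReal.tsum_mul_right]
      gcongr
      rw [← ENNReal.ofReal_tsum_of_nonneg (fun _ => by positivity)
        ((summable_geometric_of_lt_one (by norm_num) (by norm_num)).mul_left _)]
      rw [tsum_mul_left, tsum_geometric_of_lt_one (by norm_num) (by norm_num)]
      norm_num


lemma kn_int (j : ℤ) (x : ℝ) : ∫⁻ z, kn 2 j (x - z) ≤ 16 := by
  have h := kn_MF j (fun _ => 1) measurable_const x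
  simp only [mul_one] at h
  refine h.trans ?_
  calc 16 * MF (fun _ => 1) x ≤ 16 * 1 := by gcongr; exact MF_const_le 1 x
    _ = 16 := by simp

lemma kn_int' (j : ℤ) (x : ℝ) : ∫⁻ z, kn 2 j (z - x) ≤ 16 := by
  simp_rw [kn_comm 2 j _ x]; exact kn_int j x

lemma kn_slow (n : ℕ) (j : ℤ) (x y z : ℝ) :
    kn n j (x - z) ≤ ENNReal.ofReal ((1 + 2 ^ j * |x - y|) ^ n) * kn n j (y - z) := by
  unfold kn
  have h1 := om_pos j (x - y)
  have h2 := om_pos j (x - z)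
  have h3 := om_pos j (y - z)
  rw [← ENNReal.ofReal_mul (by positivity)]
  apply ENNReal.ofReal_le_ofReal
  have h4 := om_sub j y x z
  rw [abs_sub_comm y x] at h4
  rw [mul_div_assoc', div_le_div_iff₀ (by positivity) (by positivity), mul_comm _ ((2:ℝ)^j), mul_assoc, ← mul_pow]
  gcongr

/-- splitting off powers -/
lemma kn_split (n m : ℕ) (j : ℤ) (x : ℝ) :
    ENNReal.ofReal ((1 + 2 ^ j * |x|) ^ n) * kn (n + m) j x = kn m j x := by
  unfold kn
  have h1 := om_pos j x
  rw [← ENNReal.ofReal_mul (by positivity)]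
  congr 1
  rw [pow_add]
  field_simp

lemma kn_conv (n : ℕ) (j : ℤ) (x z : ℝ) :
    ∫⁻ y, kn n j (x - y) * kn (n + 2) j (y - z) ≤ 16 * kn n j (x - z) := by
  calc _ ≤ ∫⁻ y, kn n j (x - z) * kn 2 j (y - z) := by
        refine lintegral_mono fun y => ?_
        have := kn_slow n j (y - x) (z - x) 0
        rw [sub_zero, sub_zero, sub_sub_sub_cancel_right, ← kn_split n 2 j (y - z)] at *
        rw [kn_comm n j x y, kn_comm n j x z]
        calc _ ≤ _ := mul_le_mul' this le_rfl
          _ = _ := by ring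
    _ = kn n j (x - z) * ∫⁻ y, kn 2 j (y - z) := by rw [lintegral_const_mul _ (by fun_prop)]
    _ ≤ _ := by rw [mul_comm]; gcongr; exact kn_int' j z

lemma kn_far (n : ℕ) (j : ℤ) (x ρ : ℝ) (hρ : 0 ≤ ρ) (h : ρ ≤ |x|) :
    kn (n + 1) j x ≤ ENNReal.ofReal (1 / (1 + 2 ^ j * ρ)) * kn n j x := by
  unfold kn
  have h1 := om_pos j x
  have h2 := two_zpow_pos j
  rw [← ENNReal.ofReal_mul (by positivity)]
  apply ENNReal.ofReal_le_ofReal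
  rw [pow_succ, div_mul_div_comm, one_mul, mul_comm (1 + 2 ^ j * ρ)]
  gcongr

lemma geom_nat (d : ℝ) : ∑' k : ℕ, ENNReal.ofReal (d * (1/2) ^ k) ≤ ENNReal.ofReal (2 * d) := by
  rcases le_or_gt 0 d with h | h
  · rw [← ENNReal.ofReal_tsum_of_nonneg (fun _ => by positivity)
        ((summable_geometric_of_lt_one (by norm_num) (by norm_num)).mul_left _)]
    rw [tsum_mul_left, tsum_geometric_of_lt_one (by norm_num) (by norm_num)]
    apply le_of_eq; congr 1; norm_num; ring
  · have : ∀ k : ℕ, ENNReal.ofReal (d * (1/2) ^ k) = 0 := fun k =>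
      ENNReal.ofReal_of_nonpos (mul_nonpos_of_nonpos_of_nonneg h.le (by positivity))
    simp_rw [this]; simp

lemma sum_min (d : ℝ) (hd : 0 < d) :
    ∑' j : ℤ, ENNReal.ofReal (min (2 ^ j * d) (1 / (2 ^ j * d))) ≤ 8 := by
  obtain ⟨k, hk1, hk2⟩ := exists_mem_Ico_zpow hd (by norm_num : (1:ℝ) < 2)
  -- 2^k ≤ d < 2^(k+1)
  have hb : ∀ j : ℤ, (0:ℝ) < 2 ^ j := two_zpow_pos
  rw [← (Equiv.addRight (-k)).tsum_eq]
  rw [tsum_of_nat_of_neg_add_one ENNReal.summable ENNReal.summable]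
  have hg := geom_nat 1
  have e1 : ∀ c : ℤ, (2:ℝ) ^ c ≤ 2 ^ (c + -k) * d ∧ 2 ^ (c + -k) * d ≤ 2 ^ (c + 1) := by
    intro c
    have h0 := hb (c + -k)
    constructor
    · calc (2:ℝ) ^ c = 2 ^ (c + -k) * 2 ^ k := by rw [← zpow_add₀ (by norm_num)]; congr 1; ring
        _ ≤ _ := by gcongr
    · calc 2 ^ (c + -k) * d ≤ 2 ^ (c + -k) * 2 ^ (k + 1) := by gcongr
        _ = _ := by rw [← zpow_add₀ (by norm_num)]; congr 1; ring
  calc _ ≤ (∑' n : ℕ, ENNReal.ofReal (1 * (1/2) ^ n)) + ∑' n : ℕ, ENNReal.ofReal (1 * (1/2) ^ n) := by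
        refine add_le_add (ENNReal.tsum_le_tsum fun n => ENNReal.ofReal_le_ofReal ?_)
          (ENNReal.tsum_le_tsum fun n => ENNReal.ofReal_le_ofReal ?_)
        · refine (min_le_right _ _).trans ?_
          rw [one_mul, one_div_pow]
          simp only [Equiv.coe_addRight]
          refine one_div_le_one_div_of_le (by positivity) ?_
          have := (e1 n).1
          rwa [zpow_natCast] at this
        · refine (min_le_left _ _).trans ?_
          rw [one_mul, one_div_pow]
          simp only [Equiv.coe_addRight]
          refine (e1 _).2.trans (le_of_eq ?_)
          rw [one_div, ← zpow_natCast, ← zpow_neg]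
          congr 1; ring
    _ ≤ _ := by
      refine (add_le_add hg hg).trans ?_
      rw [← ENNReal.ofReal_add (by norm_num) (by norm_num)]
      norm_num

lemma schwartz_decay (θ : SchwartzMap ℝ ℂ) (n : ℕ) : ∃ C : ℝ, 0 < C ∧ ∀ x, ‖θ x‖ ≤ C / (1 + |x|) ^ n := by
  refine ⟨2 ^ n * (Finset.Iic (n, 0)).sup (fun m => SchwartzMap.seminorm ℝ m.1 m.2) θ + 1, by positivity, fun x => ?_⟩
  have := SchwartzMap.one_add_le_sup_seminorm_apply (𝕜 := ℝ) (m := (n, 0)) le_rfl le_rfl θ x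
  rw [norm_iteratedFDeriv_zero, Real.norm_eq_abs] at this
  rw [le_div_iff₀ (by positivity), mul_comm]
  linarith

lemma schwartz_diff (θ : SchwartzMap ℝ ℂ) (n : ℕ) : ∃ C : ℝ, 0 < C ∧ ∀ x y,
    ‖θ x - θ y‖ ≤ C * min 1 |x - y| * (1 / (1 + |x|) ^ n + 1 / (1 + |y|) ^ n) := by
  obtain ⟨C1, hC1, h1⟩ := schwartz_decay θ n
  obtain ⟨C2, hC2, h2⟩ := schwartz_decay (SchwartzMap.derivCLM ℝ ℂ θ) n
  refine ⟨C1 + C2 * 2 ^ n, by positivity, fun x y => ?_⟩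
  have hx : 0 < 1 / (1 + |x|) ^ n := by positivity
  have hy : 0 < 1 / (1 + |y|) ^ n := by positivity
  rcases le_total 1 |x - y| with h | h
  · rw [min_eq_left h]
    have a1 := h1 x
    have a2 := h1 y
    rw [div_eq_mul_one_div] at a1 a2
    refine (norm_sub_le _ _).trans ((add_le_add a1 a2).trans ?_)
    have : 0 < C2 * 2 ^ n := by positivity
    nlinarith
  · rw [min_eq_right h]
    have hb : ∀ t ∈ Set.uIcc y x, ‖deriv θ t‖ ≤ C2 * 2 ^ n * (1 / (1 + |x|) ^ n) := by
      intro t ht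
      have h3 := h2 t
      rw [SchwartzMap.derivCLM_apply] at h3
      refine h3.trans ?_
      have ht2 : |x - t| ≤ |x - y| := by
        rw [Set.mem_uIcc] at ht
        rcases ht with ht | ht
        · rw [abs_of_nonneg (by linarith), abs_of_nonneg (by linarith)]; linarith
        · rw [abs_of_nonpos (by linarith), abs_of_nonpos (by linarith)]; linarith
      have h4 : 1 + |x| ≤ 2 * (1 + |t|) := by
        have := abs_sub_abs_le_abs_sub x t
        have := abs_nonneg t
        linarith
      rw [mul_assoc, div_eq_mul_one_div]
      refine mul_le_mul_of_nonneg_left ?_ hC2.le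
      rw [mul_one_div, div_le_div_iff₀ (by positivity) (by positivity), one_mul, ← mul_pow]
      gcongr
    have hmv := (convex_uIcc y x).norm_image_sub_le_of_norm_deriv_le
      (fun t _ => θ.differentiableAt) hb Set.left_mem_uIcc Set.right_mem_uIcc
    refine hmv.trans ?_
    rw [Real.norm_eq_abs]
    have := abs_nonneg (x - y)
    have e : (0:ℝ) < C2 * 2 ^ n := by positivity
    calc _ = (C2 * 2 ^ n) * |x - y| * (1 / (1 + |x|) ^ n) := by ring
      _ ≤ _ := by gcongr <;> linarith

lemma dilate_le (θ : SchwartzMap ℝ ℂ) (n : ℕ) : ∃ C : ℝ≥0∞, C ≠ ∞ ∧ ∀ j x,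
    ‖dilate θ j x‖ₑ ≤ C * kn n j x := by
  obtain ⟨C, hC, h⟩ := schwartz_decay θ n
  refine ⟨ENNReal.ofReal C, by simp, fun j x => ?_⟩
  unfold kn dilate
  have hj := two_zpow_pos j
  rw [← ENNReal.ofReal_mul hC.le, ← ofReal_norm, norm_smul, Real.norm_eq_abs, abs_of_pos hj]
  apply ENNReal.ofReal_le_ofReal
  have := h (2 ^ j * x)
  rw [abs_mul, abs_of_pos hj] at this
  calc _ ≤ _ := mul_le_mul_of_nonneg_left this hj.le
    _ = _ := by ring

lemma dilate_diff (θ : SchwartzMap ℝ ℂ) (n : ℕ) : ∃ C : ℝ≥0∞, C ≠ ∞ ∧ ∀ j x y,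
    ‖dilate θ j x - dilate θ j y‖ₑ ≤ C * ENNReal.ofReal (min 1 (2 ^ j * |x - y|)) * (kn n j x + kn n j y) := by
  obtain ⟨C, hC, h⟩ := schwartz_diff θ n
  refine ⟨ENNReal.ofReal C, by simp, fun j x y => ?_⟩
  unfold kn dilate
  have hj := two_zpow_pos j
  rw [← ENNReal.ofReal_mul hC.le, ← ENNReal.ofReal_add (by positivity) (by positivity),
    ← ENNReal.ofReal_mul (by positivity), ← smul_sub, ← ofReal_norm, norm_smul, Real.norm_eq_abs, abs_of_pos hj]
  apply ENNReal.ofReal_le_ofReal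
  have := h (2 ^ j * x) (2 ^ j * y)
  rw [← mul_sub, abs_mul, abs_mul, abs_mul, abs_of_pos hj] at this
  calc _ ≤ _ := mul_le_mul_of_nonneg_left this hj.le
    _ = _ := by ring



/-- measurable functions that are uniformly locally integrable -/
def Tame (f : ℝ → ℂ) : Prop :=
  Measurable f ∧ ∃ M : ℝ≥0∞, M ≠ ∞ ∧ ∀ x, ∫⁻ y, kn 2 0 (x - y) * ‖f y‖ₑ ≤ M

lemma kn_le_zero (j : ℤ) : ∃ C : ℝ≥0∞, C ≠ ∞ ∧ ∀ x, kn 2 j x ≤ C * kn 2 0 x := by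
  have hj := two_zpow_pos j
  refine ⟨ENNReal.ofReal (2 ^ j * (1 + (2 ^ j)⁻¹) ^ 2), by simp, fun x => ?_⟩
  unfold kn
  rw [← ENNReal.ofReal_mul (by positivity)]
  apply ENNReal.ofReal_le_ofReal
  have h1 := om_pos j x
  rw [zpow_zero, one_mul, mul_one_div, div_le_div_iff₀ (by positivity) (by positivity), mul_assoc, ← mul_pow]
  gcongr
  have : (1 + (2 ^ j)⁻¹) * (1 + 2 ^ j * |x|) = 1 + |x| + (2 ^ j)⁻¹ + 2 ^ j * |x| := by
    field_simp; ring
  rw [this]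
  have h3 : (0:ℝ) < (2 ^ j)⁻¹ := by positivity
  have h4 : (0:ℝ) ≤ 2 ^ j * |x| := by positivity
  linarith

lemma Tame.kn {f : ℝ → ℂ} (hf : Tame f) (j : ℤ) :
    ∃ M : ℝ≥0∞, M ≠ ∞ ∧ ∀ x, ∫⁻ y, kn 2 j (x - y) * ‖f y‖ₑ ≤ M := by
  obtain ⟨hm, M, hM, h⟩ := hf
  obtain ⟨C, hC, h2⟩ := kn_le_zero j
  refine ⟨C * M, by finiteness, fun x => ?_⟩
  calc _ ≤ ∫⁻ y, C * (_root_.kn 2 0 (x - y) * ‖f y‖ₑ) := by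
        refine lintegral_mono fun y => ?_
        rw [← mul_assoc]
        exact mul_le_mul' (h2 _) le_rfl
    _ = C * ∫⁻ y, (_root_.kn 2 0 (x - y) * ‖f y‖ₑ) := by
        rw [lintegral_const_mul _ (by fun_prop)]
    _ ≤ _ := by gcongr; exact h x

lemma tame_of_bdd {f : ℝ → ℂ} (hm : Measurable f) (M : ℝ≥0∞) (hM : M ≠ ∞) (h : ∀ x, ‖f x‖ₑ ≤ M) :
    Tame f := by
  refine ⟨hm, 16 * M, by finiteness, fun x => ?_⟩
  calc _ ≤ ∫⁻ y, kn 2 0 (x - y) * M := by gcongr; exact h _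
    _ = (∫⁻ y, kn 2 0 (x - y)) * M := by rw [lintegral_mul_const _ (by fun_prop)]
    _ ≤ _ := by gcongr; exact kn_int _ _

lemma tame_of_lp {f : ℝ → ℂ} (hm : Measurable f) (p : ℝ) (hp : 1 ≤ p) (h : ∫⁻ x, ‖f x‖ₑ ^ p ≠ ∞) :
    Tame f := by
  refine ⟨hm, 16 + ∫⁻ x, ‖f x‖ₑ ^ p, by finiteness, fun x => ?_⟩
  calc _ ≤ ∫⁻ y, (kn 2 0 (x - y) + ‖f y‖ₑ ^ p) := by
        refine lintegral_mono fun y => ?_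
        rcases le_total ‖f y‖ₑ 1 with h1 | h1
        · exact le_add_right (mul_le_of_le_one_right' h1)
        · refine le_add_left ?_
          have hk : kn 2 0 (x - y) ≤ 1 := by
            unfold kn
            rw [← ENNReal.ofReal_one]
            apply ENNReal.ofReal_le_ofReal
            have := om_pos 0 (x - y)
            rw [zpow_zero] at *
            rw [div_le_one (by positivity)]
            exact one_le_pow₀ this
          refine (mul_le_of_le_one_left' hk).trans ?_
          calc ‖f y‖ₑ = ‖f y‖ₑ ^ (1:ℝ) := by simp
            _ ≤ _ := ENNReal.rpow_le_rpow_of_exponent_le h1 hp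
    _ = (∫⁻ y, kn 2 0 (x - y)) + ∫⁻ x, ‖f x‖ₑ ^ p := by rw [lintegral_add_left (by fun_prop)]
    _ ≤ _ := by gcongr; exact kn_int _ _

@[fun_prop] lemma dilate_continuous (θ : SchwartzMap ℝ ℂ) (j : ℤ) : Continuous (dilate θ j) := by
  unfold dilate; fun_prop

@[fun_prop] lemma dilate_measurable (θ : SchwartzMap ℝ ℂ) (j : ℤ) : Measurable (dilate θ j) :=
  (dilate_continuous θ j).measurable

lemma conv_le (θ : SchwartzMap ℝ ℂ) (n : ℕ) : ∃ C : ℝ≥0∞, C ≠ ∞ ∧ ∀ (j : ℤ) (f : ℝ → ℂ), Measurable f →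
    ∀ x, ‖conv (dilate θ j) f x‖ₑ ≤ C * ∫⁻ y, kn n j (x - y) * ‖f y‖ₑ := by
  obtain ⟨C, hC, h⟩ := dilate_le θ n
  refine ⟨C, hC, fun j f hf x => ?_⟩
  rw [← lintegral_const_mul _ (by fun_prop)]
  refine (enorm_integral_le_lintegral_enorm _).trans (lintegral_mono fun y => ?_)
  rw [enorm_mul, ← mul_assoc]
  exact mul_le_mul' (h _ _) le_rfl

lemma conv_meas (θ : SchwartzMap ℝ ℂ) (j : ℤ) {f : ℝ → ℂ} (hf : Measurable f) :
    Measurable (conv (dilate θ j) f) := by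
  unfold conv
  have : StronglyMeasurable (Function.uncurry fun x y => dilate θ j (x - y) * f y) := by
    apply Measurable.stronglyMeasurable
    unfold Function.uncurry
    fun_prop
  exact this.integral_prod_right.measurable

lemma Tame.integrable {f : ℝ → ℂ} (hf : Tame f) (θ : SchwartzMap ℝ ℂ) (j : ℤ) (x : ℝ) :
    Integrable (fun y => dilate θ j (x - y) * f y) := by
  obtain ⟨C, hC, h⟩ := dilate_le θ 2
  obtain ⟨M, hM, hM2⟩ := hf.kn j
  have hm := hf.1
  refine ⟨by fun_prop, ?_⟩
  rw [hasFiniteIntegral_iff_enorm]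
  refine lt_of_le_of_lt (b := C * M) ?_ (by finiteness)
  calc _ ≤ ∫⁻ y, C * (_root_.kn 2 j (x - y) * ‖f y‖ₑ) := by
        refine lintegral_mono fun y => ?_
        rw [enorm_mul, ← mul_assoc]
        exact mul_le_mul' (h _ _) le_rfl
    _ = C * ∫⁻ y, (_root_.kn 2 j (x - y) * ‖f y‖ₑ) := by rw [lintegral_const_mul _ (by fun_prop)]
    _ ≤ _ := by gcongr; exact hM2 x

lemma Tame.conv_bdd {f : ℝ → ℂ} (hf : Tame f) (θ : SchwartzMap ℝ ℂ) (j : ℤ) :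
    ∃ M : ℝ≥0∞, M ≠ ∞ ∧ ∀ x, ‖conv (dilate θ j) f x‖ₑ ≤ M := by
  obtain ⟨C, hC, h⟩ := conv_le θ 2
  obtain ⟨M, hM, hM2⟩ := hf.kn j
  exact ⟨C * M, by finiteness, fun x => (h j f hf.1 x).trans (by gcongr; exact hM2 x)⟩

lemma Tame.conv {f : ℝ → ℂ} (hf : Tame f) (θ : SchwartzMap ℝ ℂ) (j : ℤ) :
    Tame (_root_.conv (dilate θ j) f) := by
  obtain ⟨M, hM, h⟩ := hf.conv_bdd θ j
  exact tame_of_bdd (conv_meas θ j hf.1) M hM h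

lemma Tame.mono {f g : ℝ → ℂ} (hf : Tame f) (hg : Measurable g) (h : ∀ x, ‖g x‖ₑ ≤ ‖f x‖ₑ) : Tame g := by
  obtain ⟨_, M, hM, h2⟩ := hf
  exact ⟨hg, M, hM, fun x => (lintegral_mono fun y => by gcongr; exact h y).trans (h2 x)⟩

lemma Tame.add {f g : ℝ → ℂ} (hf : Tame f) (hg : Tame g) : Tame (fun x => f x + g x) := by
  obtain ⟨hfm, M, hM, h⟩ := hf
  obtain ⟨hgm, M', hM', h'⟩ := hg
  refine ⟨by fun_prop, M + M', by finiteness, fun x => ?_⟩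
  calc _ ≤ ∫⁻ y, (_root_.kn 2 0 (x - y) * ‖f y‖ₑ + _root_.kn 2 0 (x - y) * ‖g y‖ₑ) := by
        refine lintegral_mono fun y => ?_
        rw [← mul_add]
        gcongr
        exact enorm_add_le _ _
    _ = _ := lintegral_add_left (by fun_prop) _
    _ ≤ _ := add_le_add (h x) (h' x)

lemma Tame.neg {f : ℝ → ℂ} (hf : Tame f) : Tame (fun x => - f x) :=
  hf.mono hf.1.neg (by simp)

lemma Tame.sub {f g : ℝ → ℂ} (hf : Tame f) (hg : Tame g) : Tame (fun x => f x - g x) := by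
  simp_rw [sub_eq_add_neg]; exact hf.add hg.neg

lemma Tame.sum {ι : Type*} {s : Finset ι} {f : ι → ℝ → ℂ} (hf : ∀ i ∈ s, Tame (f i)) :
    Tame (fun x => ∑ i ∈ s, f i x) := by
  classical
  induction s using Finset.induction_on with
  | empty => simp only [Finset.sum_empty]; exact tame_of_bdd measurable_const 0 (by simp) (by simp)
  | insert a s ha ih =>
    simp_rw [Finset.sum_insert ha]
    exact (hf a (Finset.mem_insert_self _ _)).add (ih fun i hi => hf i (Finset.mem_insert_of_mem hi))

lemma Tame.indicator {f : ℝ → ℂ} (hf : Tame f) {s : Set ℝ} (hs : MeasurableSet s) :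
    Tame (s.indicator f) :=
  hf.mono (hf.1.indicator hs) fun x => by
    by_cases h : x ∈ s <;> simp [h]

lemma conv_add (θ : SchwartzMap ℝ ℂ) (j : ℤ) {f g : ℝ → ℂ} (hf : Tame f) (hg : Tame g) (x : ℝ) :
    conv (dilate θ j) (fun y => f y + g y) x = conv (dilate θ j) f x + conv (dilate θ j) g x := by
  unfold conv
  rw [← integral_add (hf.integrable θ j x) (hg.integrable θ j x)]
  simp_rw [mul_add]

lemma conv_sub (θ : SchwartzMap ℝ ℂ) (j : ℤ) {f g : ℝ → ℂ} (hf : Tame f) (hg : Tame g) (x : ℝ) :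
    conv (dilate θ j) (fun y => f y - g y) x = conv (dilate θ j) f x - conv (dilate θ j) g x := by
  unfold conv
  rw [← integral_sub (hf.integrable θ j x) (hg.integrable θ j x)]
  simp_rw [mul_sub]

lemma conv_sum (θ : SchwartzMap ℝ ℂ) (j : ℤ) {ι : Type*} {s : Finset ι} {f : ι → ℝ → ℂ}
    (hf : ∀ i ∈ s, Tame (f i)) (x : ℝ) :
    conv (dilate θ j) (fun y => ∑ i ∈ s, f i y) x = ∑ i ∈ s, conv (dilate θ j) (f i) x := by
  unfold conv
  rw [← integral_finsetSum _ (fun i hi => (hf i hi).integrable θ j x)]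
  simp_rw [Finset.mul_sum]

lemma conv_fubini (θ η : SchwartzMap ℝ ℂ) (k j : ℤ) {w f : ℝ → ℂ} (hw : Measurable w)
    (M : ℝ≥0∞) (hM : M ≠ ∞) (hwM : ∀ x, ‖w x‖ₑ ≤ M) (hf : Tame f) (x : ℝ) :
    conv (dilate θ k) (fun t => w t * conv (dilate η j) f t) x =
      ∫ y, conv (dilate θ k) (fun t => w t * dilate η j (t - y)) x * f y := by
  obtain ⟨C1, hC1, h1⟩ := dilate_le θ 2
  obtain ⟨C2, hC2, h2⟩ := dilate_le η 2
  obtain ⟨M', hM', hM2⟩ := hf.kn j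
  have hfm := hf.1
  unfold conv
  have e1 : ∀ t, dilate θ k (x - t) * (w t * ∫ y, dilate η j (t - y) * f y) =
      ∫ y, dilate θ k (x - t) * (w t * dilate η j (t - y)) * f y := by
    intro t
    rw [← mul_assoc, ← integral_const_mul]
    congr 1; ext y; ring
  have e2 : ∀ y, (∫ t, dilate θ k (x - t) * (w t * dilate η j (t - y))) * f y =
      ∫ t, dilate θ k (x - t) * (w t * dilate η j (t - y)) * f y := by
    intro y; rw [integral_mul_const]
  simp_rw [e1, e2]
  apply integral_integral_swap
  refine ⟨by unfold Function.uncurry; fun_prop, ?_⟩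
  rw [hasFiniteIntegral_iff_enorm, lintegral_prod _ (by unfold Function.uncurry; fun_prop)]
  simp only [Function.uncurry]
  refine lt_of_le_of_lt (b := C1 * 16 * (M * C2 * M')) ?_ (by finiteness)
  calc _ ≤ ∫⁻ t, C1 * kn 2 k (x - t) * (M * C2 * M') := by
        refine lintegral_mono fun t => ?_
        calc _ ≤ ∫⁻ y, C1 * kn 2 k (x - t) * (M * C2) * (kn 2 j (t - y) * ‖f y‖ₑ) := by
              refine lintegral_mono fun y => ?_
              rw [enorm_mul, enorm_mul, enorm_mul]
              calc _ ≤ C1 * kn 2 k (x - t) * (M * (C2 * kn 2 j (t - y))) * ‖f y‖ₑ := by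
                    gcongr
                    · exact h1 _ _
                    · exact hwM _
                    · exact h2 _ _
                _ = _ := by ring
          _ = C1 * kn 2 k (x - t) * (M * C2) * ∫⁻ y, (kn 2 j (t - y) * ‖f y‖ₑ) := by
              rw [lintegral_const_mul _ (by fun_prop)]
          _ ≤ C1 * kn 2 k (x - t) * (M * C2) * M' := by gcongr; exact hM2 t
          _ = _ := by ring
    _ = C1 * (∫⁻ t, kn 2 k (x - t)) * (M * C2 * M') := by
        rw [lintegral_mul_const _ (by fun_prop), lintegral_const_mul _ (by fun_prop)]
    _ ≤ _ := by gcongr; exact kn_int _ _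



/-- the dilate as a Schwartz function -/
def dilS (θ : SchwartzMap ℝ ℂ) (j : ℤ) : SchwartzMap ℝ ℂ :=
  ((2:ℝ) ^ j) • SchwartzMap.compCLMOfContinuousLinearEquiv ℝ
    (ContinuousLinearEquiv.unitsEquivAut ℝ (Units.mk0 ((2:ℝ) ^ j) (two_zpow_pos j).ne')) θ

lemma dilS_apply (θ : SchwartzMap ℝ ℂ) (j : ℤ) (x : ℝ) : dilS θ j x = dilate θ j x := by
  simp [dilS, dilate, mul_comm]

lemma dilS_coe (θ : SchwartzMap ℝ ℂ) (j : ℤ) : ⇑(dilS θ j) = dilate θ j := funext (dilS_apply θ j)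

lemma fourier_dilS (θ : SchwartzMap ℝ ℂ) (j : ℤ) (ξ : ℝ) :
    𝓕 (⇑(dilS θ j)) ξ = 𝓕 (⇑θ) (ξ / 2 ^ j) := by
  have hj := two_zpow_pos j
  rw [dilS_coe, Real.fourier_real_eq, Real.fourier_real_eq]
  have := Measure.integral_comp_mul_left (fun v => 𝐞 (-(v * (ξ / 2 ^ j))) • θ v) ((2:ℝ) ^ j)
  rw [abs_of_pos (by positivity)] at this
  have h2 : ∫ (y : ℝ), 𝐞 (-(y * (ξ / 2 ^ j))) • θ y =
      (2:ℝ) ^ j • ∫ (x : ℝ), 𝐞 (-(2 ^ j * x * (ξ / 2 ^ j))) • θ (2 ^ j * x) := by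
    rw [this, smul_smul, mul_inv_cancel₀ hj.ne', one_smul]
  rw [h2, ← integral_smul]
  congr 1; ext v
  rw [show 2 ^ j * v * (ξ / 2 ^ j) = v * ξ by field_simp]
  unfold dilate
  rw [smul_comm]

lemma fourier_translate (θ : SchwartzMap ℝ ℂ) (a ξ : ℝ) :
    𝓕 (⇑(θ.compSubConstCLM ℝ a)) ξ = 𝐞 (-(a * ξ)) • 𝓕 (⇑θ) ξ := by
  rw [Real.fourier_real_eq, Real.fourier_real_eq]
  rw [← integral_add_right_eq_self _ a]
  simp only [SchwartzMap.compSubConstCLM_apply, add_sub_cancel_right]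
  rw [Circle.smul_def, ← integral_smul]
  congr 1; ext v
  rw [← Circle.smul_def, smul_smul, ← AddChar.map_add_eq_mul]
  congr 3; ring

/-- adjoint kernel -/
def adjS (θ : SchwartzMap ℝ ℂ) : SchwartzMap ℝ ℂ :=
  (SchwartzMap.compCLMOfContinuousLinearEquiv ℝ (ContinuousLinearEquiv.neg ℝ) θ).postcompCLM
    (Complex.conjCLE : ℂ →L[ℝ] ℂ)

lemma adjS_apply (θ : SchwartzMap ℝ ℂ) (x : ℝ) : adjS θ x = (starRingEnd ℂ) (θ (-x)) := by
  simp [adjS]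

lemma dilate_adjS (θ : SchwartzMap ℝ ℂ) (j : ℤ) (x : ℝ) :
    dilate (adjS θ) j x = (starRingEnd ℂ) (dilate θ j (-x)) := by
  simp only [dilate, adjS_apply, Complex.real_smul, map_mul, Complex.conj_ofReal, mul_neg]

lemma fourier_adjS (θ : SchwartzMap ℝ ℂ) (ξ : ℝ) :
    𝓕 (⇑(adjS θ)) ξ = (starRingEnd ℂ) (𝓕 (⇑θ) ξ) := by
  rw [Real.fourier_real_eq, Real.fourier_real_eq, ← integral_conj, ← integral_neg_eq_self]
  congr 1; ext v
  rw [adjS_apply, neg_neg, Circle.smul_def, Circle.smul_def, smul_eq_mul, smul_eq_mul, map_mul]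
  congr 1
  rw [← Circle.coe_inv_eq_conj, ← AddChar.map_neg_eq_inv]
  congr 2; ring

lemma conv_schwartz_eq (a b c : SchwartzMap ℝ ℂ)
    (h : ∀ ξ, 𝓕 (⇑a) ξ * 𝓕 (⇑b) ξ = 𝓕 (⇑c) ξ) (x : ℝ) : conv a b x = c x := by
  have h1 : SchwartzMap.convolution (ContinuousLinearMap.mul ℂ ℂ) b a = c := by
    apply (FourierTransform.fourierEquiv ℂ (SchwartzMap ℝ ℂ)).injective
    ext ξ
    simp only [FourierTransform.fourierEquiv_apply]
    rw [SchwartzMap.fourier_convolution, SchwartzMap.pairing_apply_apply]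
    simp only [SchwartzMap.fourier_coe, ContinuousLinearMap.mul_apply']
    rw [mul_comm]; exact h ξ
  rw [← h1, SchwartzMap.convolution_apply]
  unfold conv MeasureTheory.convolution
  congr 1; ext y
  simp [mul_comm]

lemma mul_support (a b : SchwartzMap ℝ ℂ) : ∃ c : SchwartzMap ℝ ℂ, (∀ x, c x = a x * b x) ∧
    ∀ ξ, 𝓕 (⇑c) ξ ≠ 0 → ∃ η, 𝓕 (⇑a) η ≠ 0 ∧ 𝓕 (⇑b) (ξ - η) ≠ 0 := by
  refine ⟨𝓕⁻ (SchwartzMap.convolution (ContinuousLinearMap.mul ℂ ℂ) (𝓕 a) (𝓕 b)), ?_, ?_⟩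
  · intro x
    have h1 : ∀ f : SchwartzMap ℝ ℂ, (𝓕⁻ f) x = (𝓕 f) (-x) := by
      intro f
      rw [SchwartzMap.fourierInv_coe, Real.fourierInv_eq_fourier_neg, SchwartzMap.fourier_coe]
    rw [h1, SchwartzMap.fourier_convolution, SchwartzMap.pairing_apply_apply, ← h1, ← h1]
    simp
  · intro ξ h
    rw [← SchwartzMap.fourier_coe, FourierTransform.fourier_fourierInv_eq, SchwartzMap.convolution_apply] at h
    by_contra hcon
    push Not at hcon
    apply h
    unfold MeasureTheory.convolution
    rw [integral_eq_zero_of_ae]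
    filter_upwards with η
    simp only [SchwartzMap.fourier_coe, ContinuousLinearMap.mul_apply', Pi.zero_apply, mul_eq_zero]
    by_cases h0 : 𝓕 (⇑a) η = 0
    · exact Or.inl h0
    · exact Or.inr (hcon η h0)

/-- a smooth low pass multiplier -/
lemma exists_lowpass (R : ℝ) (hR : 0 < R) : ∃ ψ : SchwartzMap ℝ ℂ,
    (∀ ξ, |ξ| ≤ R → 𝓕 (⇑ψ) ξ = 1) ∧ (∀ ξ, 𝓕 (⇑ψ) ξ ≠ 0 → |ξ| < 2 * R) := by
  let χ : ContDiffBump (0:ℝ) := ⟨R, 2 * R, hR, by linarith⟩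
  have h1 : HasCompactSupport (fun x => (χ x : ℂ)) :=
    χ.hasCompactSupport.comp_left (g := Complex.ofReal) (by simp)
  have h2 : ContDiff ℝ (⊤ : ℕ∞) (fun x => (χ x : ℂ)) := Complex.ofRealCLM.contDiff.comp χ.contDiff
  have e : ∀ ξ, 𝓕 (⇑(𝓕⁻ (h1.toSchwartzMap h2) : SchwartzMap ℝ ℂ)) ξ = χ ξ := by
    intro ξ
    rw [← SchwartzMap.fourier_coe, FourierTransform.fourier_fourierInv_eq]; rfl
  refine ⟨𝓕⁻ (h1.toSchwartzMap h2), fun ξ hξ => ?_, fun ξ hξ => ?_⟩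
  · rw [e, χ.one_of_mem_closedBall (by simpa using hξ)]; simp
  · rw [e] at hξ
    by_contra hcon
    apply hξ
    rw [χ.zero_of_le_dist (by simpa using hcon)]; simp

lemma exists_bandpass (a R : ℝ) (ha : 0 < a) (haR : a < R) : ∃ θ : SchwartzMap ℝ ℂ,
    (∀ ξ, a ≤ |ξ| → |ξ| ≤ R → 𝓕 (⇑θ) ξ = 1) ∧ (∀ ξ, 𝓕 (⇑θ) ξ ≠ 0 → a / 2 < |ξ| ∧ |ξ| < 2 * R) := by
  obtain ⟨ψ1, h1, h1'⟩ := exists_lowpass R (ha.trans haR)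
  obtain ⟨ψ2, h2, h2'⟩ := exists_lowpass (a/2) (by linarith)
  have e : ∀ ξ, 𝓕 (⇑(ψ1 - ψ2)) ξ = 𝓕 (⇑ψ1) ξ - 𝓕 (⇑ψ2) ξ := by
    intro ξ
    simp only [← SchwartzMap.fourier_coe]
    have := map_sub (FourierTransform.fourierEquiv ℂ (SchwartzMap ℝ ℂ)) ψ1 ψ2
    simp only [FourierTransform.fourierEquiv_apply] at this
    rw [this]; rfl
  refine ⟨ψ1 - ψ2, fun ξ hξ hξ2 => ?_, fun ξ hξ => ?_⟩
  · rw [e, h1 ξ hξ2]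
    have : 𝓕 (⇑ψ2) ξ = 0 := by
      by_contra hc
      have := h2' ξ hc
      linarith
    rw [this, sub_zero]
  · rw [e] at hξ
    constructor
    · by_contra hc
      push Not at hc
      apply hξ
      rw [h1 ξ (by linarith), h2 ξ hc, sub_self]
    · by_contra hc
      push Not at hc
      apply hξ
      have z1 : 𝓕 (⇑ψ1) ξ = 0 := by
        by_contra h; have := h1' ξ h; linarith
      have z2 : 𝓕 (⇑ψ2) ξ = 0 := by
        by_contra h; have := h2' ξ h; linarith
      rw [z1, z2, sub_self]



/-- Fourier support in the annulus -/
def Ann (N : ℕ) (θ : SchwartzMap ℝ ℂ) : Prop :=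
  ∀ ξ : ℝ, 𝓕 (⇑θ) ξ ≠ 0 → ((2:ℝ) ^ N)⁻¹ < |ξ| ∧ |ξ| < 2 ^ N

lemma Ann.adj {N : ℕ} {θ : SchwartzMap ℝ ℂ} (h : Ann N θ) : Ann N (adjS θ) := by
  intro ξ hξ
  apply h ξ
  intro h0
  rw [fourier_adjS, h0] at hξ
  simp at hξ

lemma Ann.scale {N : ℕ} {θ : SchwartzMap ℝ ℂ} (h : Ann N θ) (j : ℤ) (ξ : ℝ)
    (hξ : 𝓕 (⇑θ) (ξ / 2 ^ j) ≠ 0) : (2:ℝ) ^ (j - N) < |ξ| ∧ |ξ| < 2 ^ (j + N) := by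
  have hj := two_zpow_pos j
  have := h _ hξ
  rw [abs_div, abs_of_pos hj, lt_div_iff₀ hj, div_lt_iff₀ hj] at this
  rw [zpow_sub₀ (by norm_num), zpow_add₀ (by norm_num), zpow_natCast, div_eq_inv_mul, mul_comm ((2:ℝ)^j)]
  exact this

lemma conv_comp_eq_zero (θ η : SchwartzMap ℝ ℂ) (k j : ℤ)
    (h : ∀ ξ, 𝓕 (⇑θ) (ξ / 2 ^ k) * 𝓕 (⇑η) (ξ / 2 ^ j) = 0) {f : ℝ → ℂ} (hf : Tame f) (x : ℝ) :
    conv (dilate θ k) (conv (dilate η j) f) x = 0 := by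
  have := conv_fubini θ η k j (w := fun _ => 1) measurable_const 1 (by simp) (by simp) hf x
  simp only [one_mul] at this
  rw [show conv (dilate η j) f = fun t => conv (dilate η j) f t from rfl, this]
  apply integral_eq_zero_of_ae
  filter_upwards with y
  have h2 := conv_schwartz_eq (dilS θ k) ((dilS η j).compSubConstCLM ℝ y) 0 (by
    intro ξ
    rw [fourier_translate, fourier_dilS, fourier_dilS, mul_smul_comm, h ξ, smul_zero]
    rw [Real.fourier_real_eq]; simp) x
  rw [dilS_coe] at h2
  have e : ⇑((dilS η j).compSubConstCLM ℝ y) = fun t => dilate η j (t - y) := by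
    ext t; simp [dilS_apply]
  rw [e] at h2
  rw [h2]; simp

lemma conv_comp_self (θ η : SchwartzMap ℝ ℂ) (k j : ℤ)
    (h : ∀ ξ, 𝓕 (⇑η) (ξ / 2 ^ j) ≠ 0 → 𝓕 (⇑θ) (ξ / 2 ^ k) = 1) {f : ℝ → ℂ} (hf : Tame f) (x : ℝ) :
    conv (dilate θ k) (conv (dilate η j) f) x = conv (dilate η j) f x := by
  have := conv_fubini θ η k j (w := fun _ => 1) measurable_const 1 (by simp) (by simp) hf x
  simp only [one_mul] at this
  rw [show conv (dilate θ k) (conv (dilate η j) f) x = conv (dilate θ k) (fun t => conv (dilate η j) f t) x from rfl, this]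
  conv_rhs => unfold conv
  congr 1; ext y
  have h2 := conv_schwartz_eq (dilS θ k) ((dilS η j).compSubConstCLM ℝ y) ((dilS η j).compSubConstCLM ℝ y) (by
    intro ξ
    rw [fourier_translate, fourier_dilS, fourier_dilS]
    by_cases h0 : 𝓕 (⇑η) (ξ / 2 ^ j) = 0
    · rw [h0]; simp
    · rw [h ξ h0, one_mul]) x
  rw [dilS_coe] at h2
  have e : ⇑((dilS η j).compSubConstCLM ℝ y) = fun t => dilate η j (t - y) := by
    ext t; simp [dilS_apply]
  rw [e] at h2
  rw [h2]

lemma Ann.far_zero {N : ℕ} {θ η : SchwartzMap ℝ ℂ} (h : Ann N θ) (h' : Ann N η) (k j : ℤ)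
    (hjk : (2 * N : ℤ) ≤ |j - k|) {f : ℝ → ℂ} (hf : Tame f) (x : ℝ) :
    conv (dilate θ k) (conv (dilate η j) f) x = 0 := by
  apply conv_comp_eq_zero _ _ _ _ _ hf
  intro ξ
  by_contra hcon
  obtain ⟨h1, h2⟩ := mul_ne_zero_iff.1 hcon
  have a1 := h.scale k ξ h1
  have a2 := h'.scale j ξ h2
  have b1 := (zpow_lt_zpow_iff_right₀ (by norm_num : (1:ℝ) < 2)).1 (a1.1.trans a2.2)
  have b2 := (zpow_lt_zpow_iff_right₀ (by norm_num : (1:ℝ) < 2)).1 (a2.1.trans a1.2)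
  rcases abs_cases (j - k) with hh | hh <;> omega

lemma MF_two : ∃ C : ℝ≥0∞, C ≠ ∞ ∧ ∀ w : ℝ → ℝ≥0∞, Measurable w → ∫⁻ x, MF w x ^ 2 ≤ C * ∫⁻ x, w x ^ 2 := by
  obtain ⟨C, hC, h⟩ := MF_strong 2 (by norm_num)
  refine ⟨C, hC, fun w hw => ?_⟩
  have := h w hw
  simpa only [ENNReal.rpow_two] using this

lemma conv_le_MF (θ : SchwartzMap ℝ ℂ) : ∃ C : ℝ≥0∞, C ≠ ∞ ∧ ∀ (j : ℤ) (f : ℝ → ℂ), Measurable f →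
    ∀ x, ‖conv (dilate θ j) f x‖ₑ ≤ C * MF (fun y => ‖f y‖ₑ) x := by
  obtain ⟨C, hC, h⟩ := conv_le θ 2
  refine ⟨C * 16, by finiteness, fun j f hf x => (h j f hf x).trans ?_⟩
  rw [mul_assoc]
  gcongr
  exact kn_MF j _ (by fun_prop) x

lemma conv_L2 (θ : SchwartzMap ℝ ℂ) : ∃ C : ℝ≥0∞, C ≠ ∞ ∧ ∀ (j : ℤ) (f : ℝ → ℂ), Measurable f →
    ∫⁻ x, ‖conv (dilate θ j) f x‖ₑ ^ 2 ≤ C * ∫⁻ x, ‖f x‖ₑ ^ 2 := by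
  obtain ⟨C, hC, h⟩ := conv_le_MF θ
  obtain ⟨C2, hC2, h2⟩ := MF_two
  refine ⟨C ^ 2 * C2, by finiteness, fun j f hf => ?_⟩
  calc _ ≤ ∫⁻ x, C ^ 2 * MF (fun y => ‖f y‖ₑ) x ^ 2 := by
        refine lintegral_mono fun x => ?_
        rw [← mul_pow]
        gcongr
        exact h j f hf x
    _ = C ^ 2 * ∫⁻ x, MF (fun y => ‖f y‖ₑ) x ^ 2 := by
        rw [lintegral_const_mul _ ((measurable_MF _).pow_const 2)]
    _ ≤ C ^ 2 * (C2 * ∫⁻ x, ‖f x‖ₑ ^ 2) := by gcongr; exact h2 _ (by fun_prop)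
    _ = _ := by ring

lemma tame_of_L2 {f : ℝ → ℂ} (hm : Measurable f) (h : ∫⁻ x, ‖f x‖ₑ ^ 2 ≠ ∞) : Tame f :=
  tame_of_lp hm 2 (by norm_num) (by simpa only [ENNReal.rpow_two] using h)

lemma mul_le_sq_add_sq (a b : ℝ≥0∞) : a * b ≤ a ^ 2 + b ^ 2 := by
  rcases le_total a b with h | h
  · exact le_add_left (by rw [sq]; gcongr)
  · exact le_add_right (by rw [sq]; gcongr)

lemma integrable_mul_L2 {f g : ℝ → ℂ} (hf : Measurable f) (hg : Measurable g)
    (h : ∫⁻ x, ‖f x‖ₑ ^ 2 ≠ ∞) (h' : ∫⁻ x, ‖g x‖ₑ ^ 2 ≠ ∞) : Integrable (fun x => f x * g x) := by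
  refine ⟨by fun_prop, ?_⟩
  rw [hasFiniteIntegral_iff_enorm]
  refine lt_of_le_of_lt (b := (∫⁻ x, ‖f x‖ₑ ^ 2) + ∫⁻ x, ‖g x‖ₑ ^ 2) ?_ (by finiteness)
  rw [← lintegral_add_left (by fun_prop)]
  refine lintegral_mono fun x => ?_
  rw [enorm_mul]; exact mul_le_sq_add_sq _ _

lemma conv_adjoint (θ : SchwartzMap ℝ ℂ) (j : ℤ) {g w : ℝ → ℂ} (hg : Measurable g) (hw : Measurable w)
    (h : ∫⁻ x, ‖g x‖ₑ ^ 2 ≠ ∞) (h' : ∫⁻ x, ‖w x‖ₑ ^ 2 ≠ ∞) :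
    ∫ x, conv (dilate θ j) g x * (starRingEnd ℂ) (w x) =
      ∫ y, g y * (starRingEnd ℂ) (conv (dilate (adjS θ) j) w y) := by
  obtain ⟨C, hC, hd⟩ := dilate_le θ 2
  obtain ⟨C2, hC2, h2⟩ := MF_two
  unfold conv
  have e1 : ∀ x, (∫ y, dilate θ j (x - y) * g y) * (starRingEnd ℂ) (w x) =
      ∫ y, dilate θ j (x - y) * g y * (starRingEnd ℂ) (w x) := fun x => by rw [integral_mul_const]
  have e2 : ∀ y, g y * (starRingEnd ℂ) (∫ x, dilate (adjS θ) j (y - x) * w x) =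
      ∫ x, dilate θ j (x - y) * g y * (starRingEnd ℂ) (w x) := by
    intro y
    rw [← integral_conj, ← integral_const_mul]
    congr 1; ext x
    rw [map_mul, dilate_adjS, Complex.conj_conj, neg_sub]; ring
  simp_rw [e1, e2]
  have hcw : Measurable (fun x => (starRingEnd ℂ) (w x)) := Complex.continuous_conj.measurable.comp hw
  have hF : Measurable (Function.uncurry fun x y => dilate θ j (x - y) * g y * (starRingEnd ℂ) (w x)) := by
    unfold Function.uncurry
    exact ((by fun_prop : Measurable fun p : ℝ × ℝ => dilate θ j (p.1 - p.2)).mul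
      (hg.comp measurable_snd)).mul (hcw.comp measurable_fst)
  apply integral_integral_swap
  refine ⟨hF.aestronglyMeasurable, ?_⟩
  rw [hasFiniteIntegral_iff_enorm, lintegral_prod _ hF.enorm.aemeasurable]
  simp only [Function.uncurry]
  refine lt_of_le_of_lt (b := C * 16 * ((C2 * ∫⁻ x, ‖g x‖ₑ ^ 2) + ∫⁻ x, ‖w x‖ₑ ^ 2)) ?_ (by finiteness)
  calc _ ≤ ∫⁻ x, C * 16 * (MF (fun y => ‖g y‖ₑ) x ^ 2 + ‖w x‖ₑ ^ 2) := by
        refine lintegral_mono fun x => ?_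
        calc _ ≤ ∫⁻ y, (C * ‖w x‖ₑ) * (kn 2 j (x - y) * ‖g y‖ₑ) := by
              refine lintegral_mono fun y => ?_
              rw [enorm_mul, enorm_mul]
              calc _ ≤ C * kn 2 j (x - y) * ‖g y‖ₑ * ‖w x‖ₑ := by
                    gcongr
                    · exact hd _ _
                    · simp
                _ = _ := by ring
          _ = (C * ‖w x‖ₑ) * ∫⁻ y, (kn 2 j (x - y) * ‖g y‖ₑ) := by rw [lintegral_const_mul _ (by fun_prop)]
          _ ≤ (C * ‖w x‖ₑ) * (16 * MF (fun y => ‖g y‖ₑ) x) := by gcongr; exact kn_MF j _ (by fun_prop) x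
          _ = C * 16 * (MF (fun y => ‖g y‖ₑ) x * ‖w x‖ₑ) := by ring
          _ ≤ _ := by gcongr; exact mul_le_sq_add_sq _ _
    _ = C * 16 * ((∫⁻ x, MF (fun y => ‖g y‖ₑ) x ^ 2) + ∫⁻ x, ‖w x‖ₑ ^ 2) := by
        have := measurable_MF (fun y => ‖g y‖ₑ)
        rw [lintegral_const_mul _ (by fun_prop), lintegral_add_left (by fun_prop)]
    _ ≤ _ := by gcongr; exact h2 _ (by fun_prop)



lemma enn_sq_sum {ι : Type*} (s : Finset ι) (b : ι → ℝ≥0∞) :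
    (∑ i ∈ s, b i) ^ 2 ≤ s.card * ∑ i ∈ s, b i ^ 2 := by
  have := ENNReal.rpow_sum_le_const_mul_sum_rpow s b (p := 2) (by norm_num)
  norm_num at this
  exact this

lemma enn_sq_add (a b : ℝ≥0∞) : (a + b) ^ 2 ≤ 2 * (a ^ 2 + b ^ 2) := by
  have := enn_sq_sum (Finset.univ : Finset (Fin 2)) ![a, b]
  simpa [Fin.sum_univ_two] using this

lemma sum_near (N : ℕ) (J : Finset ℤ) (n : ℤ → ℝ≥0∞) :
    ∑ j ∈ J, ∑ k ∈ J, (if |j - k| < 2 * (N:ℤ) then n j + n k else 0) ≤ (8 * N : ℕ) * ∑ j ∈ J, n j := by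
  have key : ∀ j, ((J.filter (fun k => |j - k| < 2 * (N:ℤ))).card : ℝ≥0∞) ≤ (4 * N : ℕ) := by
    intro j
    have : (J.filter (fun k => |j - k| < 2 * (N:ℤ))) ⊆ Finset.Ioo (j - 2 * N) (j + 2 * N) := by
      intro k hk
      simp only [Finset.mem_filter, abs_lt] at hk
      rw [Finset.mem_Ioo]; omega
    have := Finset.card_le_card this
    rw [Int.card_Ioo] at this
    have h2 : (J.filter (fun k => |j - k| < 2 * (N:ℤ))).card ≤ 4 * N := by omega
    exact_mod_cast h2
  have h1 : ∑ j ∈ J, ∑ k ∈ J, (if |j - k| < 2 * (N:ℤ) then n j else 0) ≤ (4 * N : ℕ) * ∑ j ∈ J, n j := by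
    rw [Finset.mul_sum]
    refine Finset.sum_le_sum fun j _ => ?_
    rw [← Finset.sum_filter, Finset.sum_const, nsmul_eq_mul]
    exact mul_le_mul_left (key j) _
  have h2 : ∑ j ∈ J, ∑ k ∈ J, (if |j - k| < 2 * (N:ℤ) then n k else 0) ≤ (4 * N : ℕ) * ∑ j ∈ J, n j := by
    rw [Finset.sum_comm]
    simp_rw [abs_sub_comm]
    rw [Finset.mul_sum]
    refine Finset.sum_le_sum fun j _ => ?_
    rw [← Finset.sum_filter, Finset.sum_const, nsmul_eq_mul]
    exact mul_le_mul_left (key j) _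
  calc _ = ∑ j ∈ J, ∑ k ∈ J, (if |j - k| < 2 * (N:ℤ) then n j else 0) +
      ∑ j ∈ J, ∑ k ∈ J, (if |j - k| < 2 * (N:ℤ) then n k else 0) := by
        rw [← Finset.sum_add_distrib]
        refine Finset.sum_congr rfl fun j _ => ?_
        rw [← Finset.sum_add_distrib]
        refine Finset.sum_congr rfl fun k _ => ?_
        split_ifs <;> simp
    _ ≤ _ := add_le_add h1 h2
    _ = _ := by push_cast; ring

lemma enorm_integral_conj (h : ℝ → ℂ) (hm : Measurable h) :
    ∫ x, h x * (starRingEnd ℂ) (h x) = ((∫⁻ x, ‖h x‖ₑ ^ 2).toReal : ℂ) := by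
  have : ∀ x, h x * (starRingEnd ℂ) (h x) = ((‖h x‖ ^ 2 : ℝ) : ℂ) := fun x => by
    rw [Complex.mul_conj, Complex.normSq_eq_norm_sq]
  simp_rw [this]
  rw [integral_complex_ofReal, integral_eq_lintegral_of_nonneg_ae (by filter_upwards with x; positivity) (by fun_prop)]
  congr 3; ext x
  rw [ENNReal.ofReal_pow (norm_nonneg _), ofReal_norm]

lemma L2_sum_finite {ι : Type*} (J : Finset ι) {u : ι → ℝ → ℂ} (hm : ∀ j ∈ J, Measurable (u j))
    (h : ∀ j ∈ J, ∫⁻ x, ‖u j x‖ₑ ^ 2 ≠ ∞) : ∫⁻ x, ‖∑ j ∈ J, u j x‖ₑ ^ 2 ≠ ∞ := by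
  refine ne_top_of_le_ne_top (b := J.card * ∑ j ∈ J, ∫⁻ x, ‖u j x‖ₑ ^ 2) ?_ ?_
  · exact ENNReal.mul_ne_top (by simp) (ENNReal.sum_ne_top.2 h)
  · rw [← lintegral_finsetSum' _ (fun j hj => ((hm j hj).enorm.pow_const 2).aemeasurable),
      ← lintegral_const_mul' _ _ (by simp)]
    refine lintegral_mono fun x => ?_
    refine le_trans ?_ (enn_sq_sum J _)
    gcongr
    exact enorm_sum_le _ _

/-- E1 -/
lemma E1 (N : ℕ) (θ : SchwartzMap ℝ ℂ) (hθ : Ann N θ) : ∃ C : ℝ≥0∞, C ≠ ∞ ∧ ∀ (J : Finset ℤ) (v : ℤ → ℝ → ℂ),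
    (∀ j, Measurable (v j)) → (∀ j ∈ J, ∫⁻ x, ‖v j x‖ₑ ^ 2 ≠ ∞) →
    ∫⁻ x, ‖∑ j ∈ J, conv (dilate θ j) (v j) x‖ₑ ^ 2 ≤ C * ∑ j ∈ J, ∫⁻ x, ‖v j x‖ₑ ^ 2 := by
  obtain ⟨C, hC, h⟩ := conv_L2 θ
  refine ⟨(8 * N : ℕ) * C, by finiteness, fun J v hv hf => ?_⟩
  set u : ℤ → ℝ → ℂ := fun j => conv (dilate θ j) (v j) with hu
  have hum : ∀ j, Measurable (u j) := fun j => conv_meas _ _ (hv j)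
  have huf : ∀ j ∈ J, ∫⁻ x, ‖u j x‖ₑ ^ 2 ≠ ∞ := fun j hj =>
    ne_top_of_le_ne_top (ENNReal.mul_ne_top hC (hf j hj)) (h j _ (hv j))
  have hsm : Measurable (fun x => ∑ j ∈ J, u j x) := by fun_prop
  have hsf := L2_sum_finite J (fun j _ => hum j) huf
  have hconj : ∀ k, Measurable (fun x => (starRingEnd ℂ) (u k x)) := fun k => Complex.continuous_conj.measurable.comp (hum k)
  have hIntg : ∀ j ∈ J, ∀ k ∈ J, Integrable (fun x => u j x * (starRingEnd ℂ) (u k x)) := fun j hj k hk =>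
    integrable_mul_L2 (hum j) (hconj k) (huf j hj) (by simpa using huf k hk)
  have e0 := enorm_integral_conj _ hsm
  have e1 : ∫ x, (∑ j ∈ J, u j x) * (starRingEnd ℂ) (∑ j ∈ J, u j x) =
      ∑ j ∈ J, ∑ k ∈ J, ∫ x, u j x * (starRingEnd ℂ) (u k x) := by
    simp_rw [map_sum, Finset.sum_mul_sum]
    rw [integral_finsetSum _ (fun j hj => integrable_finsetSum _ (fun k hk => hIntg j hj k hk))]
    refine Finset.sum_congr rfl fun j hj => ?_
    rw [integral_finsetSum _ (fun k hk => hIntg j hj k hk)]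
  have e2 : ∫⁻ x, ‖∑ j ∈ J, u j x‖ₑ ^ 2 = ‖∑ j ∈ J, ∑ k ∈ J, ∫ x, u j x * (starRingEnd ℂ) (u k x)‖ₑ := by
    rw [← e1, e0, ← ofReal_norm, Complex.norm_real, Real.norm_eq_abs, abs_of_nonneg ENNReal.toReal_nonneg,
      ENNReal.ofReal_toReal hsf]
  rw [e2]
  have e3 : ∀ j ∈ J, ∀ k ∈ J, ‖∫ x, u j x * (starRingEnd ℂ) (u k x)‖ₑ ≤
      if |j - k| < 2 * (N:ℤ) then (∫⁻ x, ‖u j x‖ₑ ^ 2) + (∫⁻ x, ‖u k x‖ₑ ^ 2) else 0 := by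
    intro j hj k hk
    split_ifs with hjk
    · refine (enorm_integral_le_lintegral_enorm _).trans ?_
      rw [← lintegral_add_left ((hum j).enorm.pow_const 2)]
      refine lintegral_mono fun x => ?_
      rw [enorm_mul]
      refine (mul_le_sq_add_sq _ _).trans ?_
      simp
    · rw [hu]
      simp only
      rw [conv_adjoint θ j (hv j) (hum k) (hf j hj) (huf k hk)]
      simp only [hu]
      have : ∀ y, conv (dilate (adjS θ) j) (conv (dilate θ k) (v k)) y = 0 := fun y =>
        Ann.far_zero hθ.adj hθ j k (by rw [abs_sub_comm]; omega) (tame_of_L2 (hv k) (hf k hk)) y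
      simp [this]
  calc _ ≤ ∑ j ∈ J, ∑ k ∈ J, ‖∫ x, u j x * (starRingEnd ℂ) (u k x)‖ₑ :=
        (enorm_sum_le _ _).trans (Finset.sum_le_sum fun j _ => enorm_sum_le _ _)
    _ ≤ _ := Finset.sum_le_sum fun j hj => Finset.sum_le_sum fun k hk => e3 j hj k hk
    _ ≤ _ := sum_near N J _
    _ ≤ (8 * N : ℕ) * ∑ j ∈ J, C * ∫⁻ x, ‖v j x‖ₑ ^ 2 := by
        gcongr with j hj; exact h j _ (hv j)
    _ = _ := by rw [← Finset.mul_sum, mul_assoc]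

lemma E2 (N : ℕ) (θ : SchwartzMap ℝ ℂ) (hθ : Ann N θ) : ∃ C : ℝ≥0∞, C ≠ ∞ ∧ ∀ (J : Finset ℤ) (g : ℝ → ℂ),
    Measurable g → ∫⁻ x, ‖g x‖ₑ ^ 2 ≠ ∞ →
    ∑ j ∈ J, ∫⁻ x, ‖conv (dilate θ j) g x‖ₑ ^ 2 ≤ C * ∫⁻ x, ‖g x‖ₑ ^ 2 := by
  obtain ⟨C0, hC0, h0⟩ := conv_L2 θ
  obtain ⟨C0', hC0', h0'⟩ := conv_L2 (adjS θ)
  obtain ⟨C, hC, h⟩ := E1 N _ hθ.adj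
  set D := 2 * C + 1 with hD
  have hDt : D ≠ ∞ := by rw [hD]; finiteness
  have hD1 : 1 ≤ D := by rw [hD]; exact le_add_self
  have hD0 : D ≠ 0 := by positivity
  refine ⟨2 * D ^ 2, by finiteness, fun J g hg hf => ?_⟩
  set u : ℤ → ℝ → ℂ := fun j => conv (dilate θ j) g with hu
  have hum : ∀ j, Measurable (u j) := fun j => conv_meas _ _ hg
  have huf : ∀ j, ∫⁻ x, ‖u j x‖ₑ ^ 2 ≠ ∞ := fun j =>
    ne_top_of_le_ne_top (ENNReal.mul_ne_top hC0 hf) (h0 j _ hg)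
  set w : ℤ → ℝ → ℂ := fun j => conv (dilate (adjS θ) j) (u j) with hw
  have hwm : ∀ j, Measurable (w j) := fun j => conv_meas _ _ (hum j)
  have hwf : ∀ j, ∫⁻ x, ‖w j x‖ₑ ^ 2 ≠ ∞ := fun j =>
    ne_top_of_le_ne_top (ENNReal.mul_ne_top hC0' (huf j)) (h0' j _ (hum j))
  set X := ∑ j ∈ J, ∫⁻ x, ‖u j x‖ₑ ^ 2 with hX
  have hXf : X ≠ ∞ := ENNReal.sum_ne_top.2 fun j _ => huf j
  have hconj : ∀ k, Measurable (fun x => (starRingEnd ℂ) (w k x)) := fun k => Complex.continuous_conj.measurable.comp (hwm k)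
  have e1 : (X.toReal : ℂ) = ∫ x, g x * (starRingEnd ℂ) (∑ j ∈ J, w j x) := by
    simp_rw [map_sum, Finset.mul_sum]
    rw [integral_finsetSum _ (fun j _ => integrable_mul_L2 hg (hconj j) hf (by simpa using hwf j)), hX,
      ENNReal.toReal_sum (fun j _ => huf j)]
    push_cast
    refine Finset.sum_congr rfl fun j _ => ?_
    rw [← enorm_integral_conj _ (hum j)]
    exact conv_adjoint θ j hg (hum j) hf (huf j)
  have e2 : X = ‖∫ x, g x * (starRingEnd ℂ) (∑ j ∈ J, w j x)‖ₑ := by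
    rw [← e1, ← ofReal_norm, Complex.norm_real, Real.norm_eq_abs, abs_of_nonneg ENNReal.toReal_nonneg,
      ENNReal.ofReal_toReal hXf]
  have hDi : D⁻¹ ^ 2 * C ≤ 1 / 2 := by
    have a1 : D⁻¹ ^ 2 ≤ D⁻¹ := by
      rw [sq]; exact mul_le_of_le_one_left' (ENNReal.inv_le_one.2 hD1)
    have a2 : 2 * (D⁻¹ * C) ≤ 1 := by
      calc 2 * (D⁻¹ * C) = D⁻¹ * (2 * C) := by ring
        _ ≤ D⁻¹ * D := by gcongr; exact le_self_add
        _ = 1 := ENNReal.inv_mul_cancel hD0 hDt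
    rw [ENNReal.le_div_iff_mul_le (by simp) (by simp), mul_comm]
    exact le_trans (by gcongr) a2
  have e3 : X ≤ D ^ 2 * (∫⁻ x, ‖g x‖ₑ ^ 2) + 1 / 2 * X := by
    calc X = _ := e2
      _ ≤ ∫⁻ x, ‖g x * (starRingEnd ℂ) (∑ j ∈ J, w j x)‖ₑ := enorm_integral_le_lintegral_enorm _
      _ ≤ ∫⁻ x, (D ^ 2 * ‖g x‖ₑ ^ 2 + D⁻¹ ^ 2 * ‖∑ j ∈ J, w j x‖ₑ ^ 2) := by
          refine lintegral_mono fun x => ?_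
          rw [← mul_pow, ← mul_pow]
          refine le_trans (le_of_eq ?_) (mul_le_sq_add_sq _ _)
          rw [enorm_mul, RCLike.enorm_conj]
          calc _ = (D * D⁻¹) * (‖g x‖ₑ * ‖∑ j ∈ J, w j x‖ₑ) := by rw [ENNReal.mul_inv_cancel hD0 hDt, one_mul]
            _ = _ := by ring
      _ = D ^ 2 * (∫⁻ x, ‖g x‖ₑ ^ 2) + D⁻¹ ^ 2 * ∫⁻ x, ‖∑ j ∈ J, w j x‖ₑ ^ 2 := by
          rw [lintegral_add_left (by fun_prop), lintegral_const_mul _ (by fun_prop), lintegral_const_mul _ (by fun_prop)]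
      _ ≤ D ^ 2 * (∫⁻ x, ‖g x‖ₑ ^ 2) + D⁻¹ ^ 2 * (C * X) := by
          gcongr; exact h J u hum fun j _ => huf j
      _ ≤ _ := by rw [← mul_assoc]; gcongr
  have e4 : 1 / 2 * X + 1 / 2 * X = X := by
    rw [← add_mul, ENNReal.add_halves, one_mul]
  have e5 : 1 / 2 * X ≤ D ^ 2 * (∫⁻ x, ‖g x‖ₑ ^ 2) := by
    have : 1 / 2 * X + 1 / 2 * X ≤ D ^ 2 * (∫⁻ x, ‖g x‖ₑ ^ 2) + 1 / 2 * X := by rw [e4]; exact e3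
    exact (ENNReal.add_le_add_iff_right (by finiteness)).1 this
  calc X = 1 / 2 * X + 1 / 2 * X := e4.symm
    _ ≤ _ := add_le_add e5 e5
    _ = _ := by ring

lemma E3 (N : ℕ) (θ : SchwartzMap ℝ ℂ) (hθ : Ann N θ) : ∃ C : ℝ≥0∞, C ≠ ∞ ∧ ∀ (J : Finset ℤ) (v : ℤ → ℝ → ℂ),
    (∀ j, Measurable (v j)) → (∀ j ∈ J, ∫⁻ x, ‖v j x‖ₑ ^ 2 ≠ ∞) →
    ∫⁻ x, (⨆ n : ℤ, ‖∑ j ∈ J.filter (· ≤ n), conv (dilate θ j) (v j) x‖ₑ) ^ 2 ≤ C * ∑ j ∈ J, ∫⁻ x, ‖v j x‖ₑ ^ 2 := by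
  obtain ⟨C, hC, h⟩ := E1 N θ hθ
  obtain ⟨C0, hC0, h0⟩ := conv_L2 θ
  obtain ⟨C2, hC2, h2⟩ := MF_two
  obtain ⟨ψ, hψ1, hψ0⟩ := exists_lowpass ((2:ℝ) ^ N) (by positivity)
  obtain ⟨Cψ, hCψ, hψ⟩ := conv_le_MF ψ
  set A : ℝ≥0∞ := 2 * Cψ ^ 2 * (2 * N + 1 : ℕ) with hA
  have hAt : A ≠ ∞ := by rw [hA]; finiteness
  refine ⟨A * (C2 * C + C2 * C0), by finiteness, fun J v hv hf => ?_⟩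
  set u : ℤ → ℝ → ℂ := fun j => conv (dilate θ j) (v j) with hu
  have hum : ∀ j, Measurable (u j) := fun j => conv_meas _ _ (hv j)
  have hut : ∀ j ∈ J, Tame (u j) := fun j hj => tame_of_L2 (hum j) (ne_top_of_le_ne_top (ENNReal.mul_ne_top hC0 (hf j hj)) (h0 j _ (hv j)))
  have hvt : ∀ j ∈ J, Tame (v j) := fun j hj => tame_of_L2 (hv j) (hf j hj)
  set G : ℝ → ℂ := fun x => ∑ j ∈ J, u j x with hG
  have hGm : Measurable G := by rw [hG]; fun_prop
  have key : ∀ (n : ℤ) (x : ℝ), ‖∑ j ∈ J.filter (· ≤ n), u j x‖ₑ ^ 2 ≤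
      A * (MF (fun y => ‖G y‖ₑ) x ^ 2 + ∑ j ∈ J, MF (fun y => ‖u j y‖ₑ) x ^ 2) := by
    intro n x
    set W := J.filter (fun j => n < j ∧ j ≤ n + 2 * N) with hW
    have hcard : W.card ≤ 2 * N + 1 := by
      have : W ⊆ Finset.Ioc n (n + 2 * N) := by
        intro k hk; rw [hW, Finset.mem_filter] at hk; exact Finset.mem_Ioc.2 hk.2
      have := Finset.card_le_card this
      rw [Int.card_Ioc] at this; omega
    have e1 : conv (dilate ψ n) G x = ∑ j ∈ J, conv (dilate ψ n) (u j) x := conv_sum ψ n hut x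
    have e2 : ∀ j ∈ J, conv (dilate ψ n) (u j) x = (if j ≤ n then u j x else 0) +
        (if n < j ∧ j ≤ n + 2 * N then conv (dilate ψ n) (u j) x else 0) := by
      intro j hj
      by_cases hjn : j ≤ n
      · rw [if_pos hjn, if_neg (by omega), add_zero]
        apply conv_comp_self _ _ _ _ _ (hvt j hj)
        intro ξ hξ
        have := (hθ.scale j ξ hξ).2
        apply hψ1
        rw [abs_div, abs_of_pos (two_zpow_pos n), div_le_iff₀ (two_zpow_pos n), ← zpow_natCast, ← zpow_add₀ (by norm_num)]
        exact this.le.trans (zpow_le_zpow_right₀ (by norm_num) (by omega))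
      · rw [if_neg hjn, zero_add]
        split_ifs with h3
        · rfl
        · apply conv_comp_eq_zero _ _ _ _ _ (hvt j hj)
          intro ξ
          by_contra hcon
          obtain ⟨h4, h5⟩ := mul_ne_zero_iff.1 hcon
          have a1 := hψ0 _ h4
          have a2 := (hθ.scale j ξ h5).1
          rw [abs_div, abs_of_pos (two_zpow_pos n), div_lt_iff₀ (two_zpow_pos n), ← zpow_natCast,
            ← zpow_one_add₀ (by norm_num), ← zpow_add₀ (by norm_num)] at a1
          have := (zpow_lt_zpow_iff_right₀ (by norm_num : (1:ℝ) < 2)).1 (a2.trans a1)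
          omega
    have e3 : ∑ j ∈ J.filter (· ≤ n), u j x = conv (dilate ψ n) G x - ∑ j ∈ W, conv (dilate ψ n) (u j) x := by
      rw [e1, Finset.sum_congr rfl e2, Finset.sum_add_distrib, Finset.sum_filter, hW, Finset.sum_filter]
      ring
    have e4 : ‖∑ j ∈ J.filter (· ≤ n), u j x‖ₑ ≤ Cψ * (MF (fun y => ‖G y‖ₑ) x + ∑ j ∈ W, MF (fun y => ‖u j y‖ₑ) x) := by
      rw [e3]
      refine enorm_sub_le.trans ?_
      rw [mul_add, Finset.mul_sum]
      exact add_le_add (hψ n G hGm x) ((enorm_sum_le _ _).trans (Finset.sum_le_sum fun j _ => hψ n _ (hum j) x))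
    calc _ ≤ (Cψ * (MF (fun y => ‖G y‖ₑ) x + ∑ j ∈ W, MF (fun y => ‖u j y‖ₑ) x)) ^ 2 := by gcongr
      _ = Cψ ^ 2 * (MF (fun y => ‖G y‖ₑ) x + ∑ j ∈ W, MF (fun y => ‖u j y‖ₑ) x) ^ 2 := by rw [mul_pow]
      _ ≤ Cψ ^ 2 * (2 * (MF (fun y => ‖G y‖ₑ) x ^ 2 + (∑ j ∈ W, MF (fun y => ‖u j y‖ₑ) x) ^ 2)) := by
          gcongr; exact enn_sq_add _ _
      _ ≤ Cψ ^ 2 * (2 * ((2 * N + 1 : ℕ) * MF (fun y => ‖G y‖ₑ) x ^ 2 + ((2 * N + 1 : ℕ) * ∑ j ∈ J, MF (fun y => ‖u j y‖ₑ) x ^ 2))) := by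
          gcongr
          · refine le_mul_of_one_le_left' ?_
            exact_mod_cast (by omega : 1 ≤ 2 * N + 1)
          · refine (enn_sq_sum _ _).trans ?_
            gcongr
            rw [hW]; exact Finset.filter_subset _ _
      _ = _ := by rw [hA]; ring
  have hMm : ∀ w, Measurable (MF w) := fun w => measurable_MF w
  calc _ ≤ ∫⁻ x, A * (MF (fun y => ‖G y‖ₑ) x ^ 2 + ∑ j ∈ J, MF (fun y => ‖u j y‖ₑ) x ^ 2) := by
        refine lintegral_mono fun x => ?_
        have : (⨆ n : ℤ, ‖∑ j ∈ J.filter (· ≤ n), u j x‖ₑ) ^ 2 = ⨆ n : ℤ, ‖∑ j ∈ J.filter (· ≤ n), u j x‖ₑ ^ 2 := by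
          exact ENNReal.iSup_pow (fun n : ℤ => ‖∑ j ∈ J.filter (· ≤ n), u j x‖ₑ) 2
        rw [this]
        exact iSup_le fun n => key n x
    _ = A * ((∫⁻ x, MF (fun y => ‖G y‖ₑ) x ^ 2) + ∑ j ∈ J, ∫⁻ x, MF (fun y => ‖u j y‖ₑ) x ^ 2) := by
        rw [lintegral_const_mul _ (by fun_prop), lintegral_add_left (by fun_prop), lintegral_finsetSum _ (by intros; fun_prop)]
    _ ≤ A * (C2 * (C * ∑ j ∈ J, ∫⁻ x, ‖v j x‖ₑ ^ 2) + ∑ j ∈ J, C2 * (C0 * ∫⁻ x, ‖v j x‖ₑ ^ 2)) := by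
        gcongr with j hj
        · exact (h2 _ (by fun_prop)).trans (by gcongr; exact h J v hv hf)
        · exact (h2 _ (by fun_prop)).trans (by gcongr; exact h0 j _ (hv j))
    _ = _ := by simp_rw [← Finset.mul_sum]; ring



lemma piecewise_meas {T : Set (ℝ × ℝ)} (hc : T.Countable)
    (hd : T.PairwiseDisjoint (fun a => Set.Ioo a.1 a.2)) (m : ℝ × ℝ → ℂ) {g : ℝ → ℂ} (hg : Measurable g) :
    ∃ G : ℝ → ℂ, Measurable G ∧ (∀ a ∈ T, ∀ x ∈ Set.Ioo a.1 a.2, G x = m a) ∧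
      ∀ x, x ∉ (⋃ a ∈ T, Set.Ioo a.1 a.2) → G x = g x := by
  classical
  let G : ℝ → ℂ := fun x => if h : ∃ a, a ∈ T ∧ x ∈ Set.Ioo a.1 a.2 then m (Classical.choose h) else g x
  have h1 : ∀ a ∈ T, ∀ x ∈ Set.Ioo a.1 a.2, G x = m a := by
    intro a ha x hx
    have h : ∃ a, a ∈ T ∧ x ∈ Set.Ioo a.1 a.2 := ⟨a, ha, hx⟩
    simp only [G, dif_pos h]
    have hs := Classical.choose_spec h
    congr 1
    by_contra hne
    exact Set.disjoint_left.1 (hd hs.1 ha hne) hs.2 hx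
  have h2 : ∀ x, x ∉ (⋃ a ∈ T, Set.Ioo a.1 a.2) → G x = g x := by
    intro x hx
    simp only [Set.mem_iUnion, not_exists] at hx
    have h : ¬ ∃ a, a ∈ T ∧ x ∈ Set.Ioo a.1 a.2 := by
      rintro ⟨a, ha, hxa⟩; exact hx a ha hxa
    simp only [G, dif_neg h]
  refine ⟨G, ?_, h1, h2⟩
  have hΩ : MeasurableSet (⋃ a ∈ T, Set.Ioo a.1 a.2) := MeasurableSet.biUnion hc fun _ _ => measurableSet_Ioo
  intro s hs
  have : G ⁻¹' s = (g ⁻¹' s ∩ (⋃ a ∈ T, Set.Ioo a.1 a.2)ᶜ) ∪ ⋃ a ∈ T ∩ {a | m a ∈ s}, Set.Ioo a.1 a.2 := by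
    ext x
    by_cases hx : x ∈ (⋃ a ∈ T, Set.Ioo a.1 a.2)
    · have hx' := hx
      simp only [Set.mem_iUnion] at hx'
      obtain ⟨a, ha, hxa⟩ := hx'
      simp only [Set.mem_preimage, Set.mem_union, Set.mem_inter_iff, Set.mem_compl_iff, hx, not_true, and_false, false_or, h1 a ha x hxa]
      simp only [Set.mem_iUnion]
      constructor
      · intro h; exact ⟨a, ⟨ha, h⟩, hxa⟩
      · rintro ⟨a', ⟨ha', h⟩, hxa'⟩
        have : m a = m a' := by rw [← h1 a ha x hxa, ← h1 a' ha' x hxa']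
        rw [this]; exact h
    · have : x ∉ ⋃ a ∈ T ∩ {a | m a ∈ s}, Set.Ioo a.1 a.2 := by
        intro h; apply hx
        simp only [Set.mem_iUnion] at h ⊢
        obtain ⟨a, ha, h⟩ := h
        exact ⟨a, ha.1, h⟩
      rw [Set.mem_preimage, Set.mem_union, or_iff_left this, Set.mem_inter_iff, Set.mem_compl_iff, h2 x hx,
        and_iff_left hx, Set.mem_preimage]
  rw [this]
  exact ((hg hs).inter hΩ.compl).union
    (MeasurableSet.biUnion (hc.mono Set.inter_subset_left) fun _ _ => measurableSet_Ioo)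

/-- Calderon-Zygmund decomposition -/
lemma cz {g : ℝ → ℂ} (hg : Measurable g) (hfin : ∫⁻ x, ‖g x‖ₑ ≠ ∞) (t : ℝ≥0∞) (ht0 : t ≠ 0) (ht : t ≠ ∞) :
    ∃ (T : Set (ℝ × ℝ)) (G : ℝ → ℂ), T.Countable ∧ (∀ a ∈ T, a.1 < a.2) ∧
      T.PairwiseDisjoint (fun a => Set.Ioo a.1 a.2) ∧ Measurable G ∧
      (∀ᵐ x, ‖G x‖ₑ ≤ 2 * t) ∧ ∫⁻ x, ‖G x‖ₑ ≤ ∫⁻ x, ‖g x‖ₑ ∧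
      (∀ x, x ∉ (⋃ a ∈ T, Set.Ioo a.1 a.2) → g x - G x = 0) ∧
      (∀ a ∈ T, ∫ x in Set.Ioo a.1 a.2, (g x - G x) = 0) ∧
      ∑' a : T, ∫⁻ x in Set.Ioo a.1.1 a.1.2, ‖g x - G x‖ₑ ≤ 2 * ∫⁻ x, ‖g x‖ₑ ∧
      t * ∑' a : T, ENNReal.ofReal (a.1.2 - a.1.1) ≤ 4 * ∫⁻ x, ‖g x‖ₑ := by
  have hweak := MF_weak (fun x => ‖g x‖ₑ) t ht0 ht
  set Ω := {x | t < MF (fun x => ‖g x‖ₑ) x} with hΩ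
  have hΩo : IsOpen Ω := isOpen_MF _ _
  have hΩv : volume Ω ≠ ∞ := by
    intro h
    rw [h, ENNReal.mul_top ht0, top_le_iff] at hweak
    exact ENNReal.mul_ne_top (by simp) hfin hweak
  obtain ⟨T, hTc, hlt, hTd, hU, hend⟩ := open_decomp Ω hΩo hΩv
  have := hTc.to_subtype
  set m : ℝ × ℝ → ℂ := fun a => ((a.2 - a.1)⁻¹ : ℝ) • ∫ x in Set.Ioo a.1 a.2, g x with hm
  obtain ⟨G, hGm, hG1, hG2⟩ := piecewise_meas hTc hTd m hg
  have hIntg : Integrable g := ⟨hg.aestronglyMeasurable, by rw [hasFiniteIntegral_iff_enorm]; exact hfin.lt_top⟩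
  have hGae : ∀ a ∈ T, Set.EqOn G (fun _ => m a) (Set.Ioo a.1 a.2) := fun a ha x hx => hG1 a ha x hx
  have hlen : ∀ a ∈ T, ENNReal.ofReal (a.2 - a.1) * ‖m a‖ₑ ≤ ∫⁻ x in Set.Ioo a.1 a.2, ‖g x‖ₑ := by
    intro a ha
    have hl : 0 < a.2 - a.1 := sub_pos.2 (hlt a ha)
    rw [hm]; simp only
    rw [enorm_smul, ← mul_assoc]
    have : ENNReal.ofReal (a.2 - a.1) * ‖(a.2 - a.1)⁻¹‖ₑ = 1 := by
      rw [Real.enorm_eq_ofReal (by positivity), ← ENNReal.ofReal_mul hl.le, mul_inv_cancel₀ hl.ne', ENNReal.ofReal_one]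
    rw [this, one_mul]
    exact enorm_integral_le_lintegral_enorm _
  have hmt : ∀ a ∈ T, ‖m a‖ₑ ≤ 2 * t := by
    intro a ha
    have hl : 0 < a.2 - a.1 := sub_pos.2 (hlt a ha)
    have h1 : ∫⁻ x in Set.Ioo a.1 a.2, ‖g x‖ₑ ≤ ENNReal.ofReal (2 * (a.2 - a.1)) * t := by
      calc _ ≤ ∫⁻ x in Metric.ball a.1 (a.2 - a.1), ‖g x‖ₑ := by
            apply lintegral_mono_set
            intro x hx
            rw [Metric.mem_ball, Real.dist_eq, abs_lt]
            constructor <;> linarith [hx.1, hx.2]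
        _ ≤ _ := lintegral_ball_le_MF _ (Metric.mem_ball_self hl)
        _ ≤ _ := by
            gcongr
            have := (hend a ha).1
            rw [hΩ, Set.mem_ofPred_eq, not_lt] at this
            exact this
    have h2 := (hlen a ha).trans h1
    rw [mul_comm 2, ENNReal.ofReal_mul hl.le, mul_assoc] at h2
    have := (ENNReal.mul_le_mul_iff_right (by simpa using hlt a ha) (by simp)).1 h2
    simpa using this
  have hGlen : ∀ a ∈ T, ∫⁻ x in Set.Ioo a.1 a.2, ‖G x‖ₑ ≤ ∫⁻ x in Set.Ioo a.1 a.2, ‖g x‖ₑ := by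
    intro a ha
    rw [setLIntegral_congr_fun measurableSet_Ioo (g := fun _ => ‖m a‖ₑ) (fun x hx => by rw [hG1 a ha x hx])]
    rw [setLIntegral_const, Real.volume_Ioo, mul_comm]
    exact hlen a ha
  have hΩm : MeasurableSet Ω := hΩo.measurableSet
  have hsplit : ∀ w : ℝ → ℝ≥0∞, ∫⁻ x in Ω, w x = ∑' a : T, ∫⁻ x in Set.Ioo a.1.1 a.1.2, w x := by
    intro w
    rw [hU, lintegral_biUnion hTc (fun _ _ => measurableSet_Ioo) hTd]
  refine ⟨T, G, hTc, hlt, hTd, hGm, ?_, ?_, ?_, ?_, ?_, ?_⟩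
  · filter_upwards [le_MF_ae (fun x => ‖g x‖ₑ) (by fun_prop) hfin] with x hx
    by_cases hxΩ : x ∈ Ω
    · have h := hxΩ
      rw [hU] at h
      simp only [Set.mem_iUnion] at h
      obtain ⟨a, ha, hxa⟩ := h
      rw [hG1 a ha x hxa]; exact hmt a ha
    · rw [hG2 x (by rw [← hU]; exact hxΩ)]
      rw [hΩ, Set.mem_ofPred_eq, not_lt] at hxΩ
      exact (hx.trans hxΩ).trans (by rw [two_mul]; exact le_self_add)
  · rw [← lintegral_add_compl _ hΩm, ← lintegral_add_compl (fun x => ‖g x‖ₑ) hΩm, hsplit, hsplit]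
    gcongr ?_ + ?_
    · exact ENNReal.tsum_le_tsum fun a => hGlen a.1 a.2
    · rw [setLIntegral_congr_fun hΩm.compl (fun x hx => by rw [hG2 x (by rw [← hU]; exact hx)])]
  · intro x hx; rw [hG2 x hx, sub_self]
  · intro a ha
    have hl : 0 < a.2 - a.1 := sub_pos.2 (hlt a ha)
    rw [setIntegral_congr_fun measurableSet_Ioo (g := fun x => g x - m a) (fun x hx => by simp only [hG1 a ha x hx])]
    rw [integral_sub hIntg.integrableOn (by simp), setIntegral_const, hm]
    simp only
    rw [smul_smul, Measure.real, Real.volume_Ioo, ENNReal.toReal_ofReal hl.le, mul_inv_cancel₀ hl.ne', one_smul, sub_self]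
  · rw [← hsplit]
    calc ∫⁻ x in Ω, ‖g x - G x‖ₑ ≤ ∫⁻ x in Ω, (‖g x‖ₑ + ‖G x‖ₑ) := lintegral_mono fun x => enorm_sub_le
      _ = (∫⁻ x in Ω, ‖g x‖ₑ) + ∫⁻ x in Ω, ‖G x‖ₑ := lintegral_add_left (by fun_prop) _
      _ ≤ (∫⁻ x in Ω, ‖g x‖ₑ) + ∫⁻ x in Ω, ‖g x‖ₑ := by
          gcongr ?_ + ?_
          · rfl
          · rw [hsplit, hsplit]; exact ENNReal.tsum_le_tsum fun a => hGlen a.1 a.2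
      _ = 2 * ∫⁻ x in Ω, ‖g x‖ₑ := by rw [two_mul]
      _ ≤ _ := by gcongr; exact Measure.restrict_le_self
  · rw [tsum_len hTc hTd, ← hU]; exact hweak

/-- l2 norm -/
def l2 (J : Finset ℤ) (a : ℤ → ℝ≥0∞) : ℝ≥0∞ := (∑ j ∈ J, a j ^ 2) ^ (1/2:ℝ)

lemma l2_sq (J : Finset ℤ) (a : ℤ → ℝ≥0∞) : l2 J a ^ 2 = ∑ j ∈ J, a j ^ 2 := by
  rw [l2, ← ENNReal.rpow_two, ← ENNReal.rpow_mul]; norm_num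

lemma l2_mono {J : Finset ℤ} {a b : ℤ → ℝ≥0∞} (h : ∀ j ∈ J, a j ≤ b j) : l2 J a ≤ l2 J b := by
  unfold l2; gcongr with j hj; exact h j hj

lemma l2_add (J : Finset ℤ) (a b : ℤ → ℝ≥0∞) : l2 J (fun j => a j + b j) ≤ l2 J a + l2 J b := by
  have := ENNReal.Lp_add_le J a b (p := 2) (by norm_num)
  simpa [l2] using this

lemma le_l2 {J : Finset ℤ} (a : ℤ → ℝ≥0∞) {j : ℤ} (hj : j ∈ J) : a j ≤ l2 J a := by
  have : a j ^ 2 ≤ l2 J a ^ 2 := by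
    rw [l2_sq]; exact Finset.single_le_sum (f := fun j => a j ^ 2) (fun _ _ => zero_le) hj
  exact (ENNReal.pow_le_pow_left_iff (by norm_num)).1 this

lemma l2_le_sum (J : Finset ℤ) (a : ℤ → ℝ≥0∞) : l2 J a ≤ ∑ j ∈ J, a j := by
  have : l2 J a ^ 2 ≤ (∑ j ∈ J, a j) ^ 2 := by
    rw [l2_sq, sq (∑ j ∈ J, a j), Finset.sum_mul]
    refine Finset.sum_le_sum fun j hj => ?_
    rw [sq]; gcongr
    exact Finset.single_le_sum (f := fun j => a j) (fun _ _ => zero_le) hj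
  exact (ENNReal.pow_le_pow_left_iff (by norm_num)).1 this

lemma l2_const_mul (J : Finset ℤ) (c : ℝ≥0∞) (a : ℤ → ℝ≥0∞) : l2 J (fun j => c * a j) = c * l2 J a := by
  unfold l2
  simp_rw [mul_pow]
  rw [← Finset.mul_sum, ENNReal.mul_rpow_of_nonneg _ _ (by norm_num), ← ENNReal.rpow_two, ← ENNReal.rpow_mul]
  norm_num

lemma l2_meas (J : Finset ℤ) {a : ℤ → ℝ → ℝ≥0∞} (h : ∀ j, Measurable (a j)) : Measurable (fun x => l2 J (fun j => a j x)) := by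
  unfold l2; fun_prop

/-- smoothed absolute value of the frequency piece -/
def Pq (n : ℕ) (φ : SchwartzMap ℝ ℂ) (j : ℤ) (g : ℝ → ℂ) (x : ℝ) : ℝ≥0∞ :=
  ∫⁻ y, kn n j (x - y) * ‖conv (dilate φ j) g y‖ₑ

lemma knw_meas (n : ℕ) (j : ℤ) {w : ℝ → ℝ≥0∞} (hw : Measurable w) :
    Measurable (fun x => ∫⁻ y, kn n j (x - y) * w y) := by
  have : Measurable (fun p : ℝ × ℝ => kn n j (p.1 - p.2) * w p.2) := by fun_prop
  exact this.lintegral_prod_right'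

lemma Pq_meas (n : ℕ) (φ : SchwartzMap ℝ ℂ) (j : ℤ) {g : ℝ → ℂ} (hg : Measurable g) : Measurable (Pq n φ j g) :=
  knw_meas n j (conv_meas φ j hg).enorm

lemma knw_slow (n : ℕ) (j : ℤ) (w : ℝ → ℝ≥0∞) (x x' : ℝ) :
    ∫⁻ y, kn n j (x - y) * w y ≤ ENNReal.ofReal ((1 + 2 ^ j * |x - x'|) ^ n) * ∫⁻ y, kn n j (x' - y) * w y := by
  rw [← lintegral_const_mul' _ _ (by simp)]
  refine lintegral_mono fun y => ?_
  rw [← mul_assoc]; gcongr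
  exact kn_slow n j x x' y

lemma Pq_le_MF (n : ℕ) (hn : 2 ≤ n) (φ : SchwartzMap ℝ ℂ) (j : ℤ) {g : ℝ → ℂ} (hg : Measurable g) (x : ℝ) :
    Pq n φ j g x ≤ 16 * MF (fun y => ‖conv (dilate φ j) g y‖ₑ) x := by
  have := conv_meas φ j hg
  refine le_trans ?_ (kn_MF j _ (by fun_prop) x)
  refine lintegral_mono fun y => ?_
  gcongr; exact kn_anti hn j _

lemma Pq_sub (n : ℕ) (φ : SchwartzMap ℝ ℂ) (j : ℤ) {f g h : ℝ → ℂ} (hf : Tame f) (hg : Tame g) (e : h = fun x => f x + g x) (x : ℝ) :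
    Pq n φ j h x ≤ Pq n φ j f x + Pq n φ j g x := by
  unfold Pq
  have := conv_meas φ j hf.1
  rw [← lintegral_add_left (by fun_prop)]
  refine lintegral_mono fun y => ?_
  rw [← mul_add, e, conv_add φ j hf hg]
  gcongr; exact enorm_add_le _ _



lemma kn_conv_lin (n : ℕ) (j : ℤ) {w : ℝ → ℝ≥0∞} (hw : Measurable w) (x : ℝ) :
    ∫⁻ y, kn n j (x - y) * ∫⁻ z, kn (n + 2) j (y - z) * w z ≤ 16 * ∫⁻ z, kn n j (x - z) * w z := by
  calc _ = ∫⁻ y, ∫⁻ z, kn n j (x - y) * (kn (n + 2) j (y - z) * w z) := by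
        refine lintegral_congr fun y => ?_
        rw [lintegral_const_mul _ (by fun_prop)]
    _ = ∫⁻ z, ∫⁻ y, kn n j (x - y) * (kn (n + 2) j (y - z) * w z) := by
        apply lintegral_lintegral_swap
        unfold Function.uncurry
        fun_prop
    _ = ∫⁻ z, (∫⁻ y, kn n j (x - y) * kn (n + 2) j (y - z)) * w z := by
        refine lintegral_congr fun z => ?_
        rw [← lintegral_mul_const _ (by fun_prop)]
        simp_rw [mul_assoc]
    _ ≤ ∫⁻ z, 16 * (kn n j (x - z) * w z) := by
        refine lintegral_mono fun z => ?_
        rw [← mul_assoc]; gcongr; exact kn_conv n j x z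
    _ = _ := by rw [lintegral_const_mul _ (by fun_prop)]

lemma conv_diff (θ : SchwartzMap ℝ ℂ) (n : ℕ) : ∃ C : ℝ≥0∞, C ≠ ∞ ∧ ∀ (j : ℤ) (f : ℝ → ℂ), Tame f → ∀ x x',
    ‖conv (dilate θ j) f x - conv (dilate θ j) f x'‖ₑ ≤ C * ENNReal.ofReal (min 1 (2 ^ j * |x - x'|)) *
      ((∫⁻ z, kn n j (x - z) * ‖f z‖ₑ) + ∫⁻ z, kn n j (x' - z) * ‖f z‖ₑ) := by
  obtain ⟨C, hC, h⟩ := dilate_diff θ n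
  refine ⟨C, hC, fun j f hf x x' => ?_⟩
  have hfm := hf.1
  unfold conv
  rw [← integral_sub (hf.integrable θ j x) (hf.integrable θ j x'), ← lintegral_add_left (by fun_prop),
    ← lintegral_const_mul' _ _ (by finiteness)]
  refine (enorm_integral_le_lintegral_enorm _).trans (lintegral_mono fun z => ?_)
  simp only
  rw [← sub_mul, enorm_mul, ← add_mul, ← mul_assoc]
  gcongr
  refine (h j _ _).trans_eq ?_
  rw [sub_sub_sub_cancel_right]

lemma atom_conv (θ : SchwartzMap ℝ ℂ) (n : ℕ) : ∃ C : ℝ≥0∞, C ≠ ∞ ∧ ∀ (j : ℤ) (c l : ℝ) (β : ℝ → ℂ), Measurable β →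
    (∀ z, z ∉ Metric.ball c l → β z = 0) → ∫⁻ z, ‖β z‖ₑ ≠ ∞ → ∫ z, β z = 0 → ∀ y,
    ‖conv (dilate θ j) β y‖ₑ ≤ C * ENNReal.ofReal (min 1 (2 ^ j * l)) *
      ((∫⁻ z, kn n j (y - z) * ‖β z‖ₑ) + kn n j (y - c) * ∫⁻ z, ‖β z‖ₑ) := by
  obtain ⟨C, hC, h⟩ := dilate_diff θ n
  refine ⟨C, hC, fun j c l β hm hs hf h0 y => ?_⟩
  have ht : Tame β := tame_of_lp hm 1 le_rfl (by simpa using hf)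
  have hIntg : Integrable β := ⟨hm.aestronglyMeasurable, by rw [hasFiniteIntegral_iff_enorm]; exact hf.lt_top⟩
  have e : conv (dilate θ j) β y = ∫ z, (dilate θ j (y - z) - dilate θ j (y - c)) * β z := by
    simp_rw [sub_mul]
    rw [integral_sub (ht.integrable θ j y) (hIntg.const_mul _), integral_const_mul, h0, mul_zero, sub_zero]
    rfl
  rw [e, ← lintegral_const_mul _ (by fun_prop), ← lintegral_add_left (by fun_prop), ← lintegral_const_mul' _ _ (by finiteness)]
  refine (enorm_integral_le_lintegral_enorm _).trans (lintegral_mono fun z => ?_)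
  simp only
  by_cases hz : z ∈ Metric.ball c l
  · rw [enorm_mul, ← add_mul, ← mul_assoc]
    gcongr
    refine (h j _ _).trans ?_
    have : |y - z - (y - c)| ≤ l := by
      rw [show y - z - (y - c) = -(z - c) by ring, abs_neg]
      rw [Metric.mem_ball, Real.dist_eq] at hz; exact hz.le
    have := two_zpow_pos j
    gcongr
  · rw [hs z hz]; simp

lemma min_mul_le (a : ℝ) (ha : 0 < a) : ENNReal.ofReal (min 1 a) * ENNReal.ofReal (1 / (1 + a)) ≤ ENNReal.ofReal (min a (1 / a)) := by
  rw [← ENNReal.ofReal_mul (by positivity)]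
  apply ENNReal.ofReal_le_ofReal
  have h1 : 1 / (1 + a) ≤ 1 := by rw [div_le_one (by positivity)]; linarith
  have h2 : 1 / (1 + a) ≤ 1 / a := by gcongr; linarith
  have h3 : 0 < 1 / (1 + a) := by positivity
  apply le_min
  · calc _ ≤ a * 1 := by gcongr; exact min_le_right _ _
      _ = a := mul_one a
  · calc _ ≤ 1 * (1 / a) := by gcongr; exact min_le_left _ _
      _ = _ := one_mul _

/-- the smoothed pieces of an atom, away from the atom -/
lemma atom_P (θ : SchwartzMap ℝ ℂ) : ∃ C : ℝ≥0∞, C ≠ ∞ ∧ ∀ (j : ℤ) (c l : ℝ) (β : ℝ → ℂ), 0 < l → Measurable β →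
    (∀ z, z ∉ Metric.ball c l → β z = 0) → ∫⁻ z, ‖β z‖ₑ ≠ ∞ → ∫ z, β z = 0 →
    ∫⁻ x in (Metric.ball c (2 * l))ᶜ, Pq 6 θ j β x ≤ C * ENNReal.ofReal (min (2 ^ j * l) (1 / (2 ^ j * l))) * ∫⁻ z, ‖β z‖ₑ := by
  obtain ⟨C, hC, h⟩ := atom_conv θ 8
  refine ⟨C * 16 * 32, by finiteness, fun j c l β hl hm hs hf h0 => ?_⟩
  set m := ENNReal.ofReal (min 1 (2 ^ j * l)) with hmd
  set D := ENNReal.ofReal (1 / (1 + 2 ^ j * l)) with hD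
  have key : ∀ x ∈ (Metric.ball c (2 * l))ᶜ, Pq 6 θ j β x ≤
      C * m * (16 * D * ((∫⁻ z, kn 2 j (x - z) * ‖β z‖ₑ) + kn 2 j (x - c) * ∫⁻ z, ‖β z‖ₑ)) := by
    intro x hx
    rw [Set.mem_compl_iff, Metric.mem_ball, Real.dist_eq, not_lt] at hx
    have hfar : ∀ z, l ≤ |x - z| → kn 6 j (x - z) ≤ D * kn 2 j (x - z) := fun z hz =>
      (kn_anti (by norm_num : 2 + 1 ≤ 6) j _).trans (kn_far 2 j _ l hl.le hz)
    have m1 : Measurable (fun y => ∫⁻ z, kn 8 j (y - z) * ‖β z‖ₑ) := knw_meas 8 j (by fun_prop)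
    calc Pq 6 θ j β x ≤ ∫⁻ y, kn 6 j (x - y) * (C * m *
          ((∫⁻ z, kn 8 j (y - z) * ‖β z‖ₑ) + kn 8 j (y - c) * ∫⁻ z, ‖β z‖ₑ)) := by
          refine lintegral_mono fun y => ?_
          gcongr; exact h j c l β hm hs hf h0 y
      _ = C * m * ((∫⁻ y, kn 6 j (x - y) * (∫⁻ z, kn 8 j (y - z) * ‖β z‖ₑ)) +
          (∫⁻ y, kn 6 j (x - y) * kn 8 j (y - c)) * ∫⁻ z, ‖β z‖ₑ) := by
          rw [← lintegral_mul_const _ (by fun_prop), ← lintegral_add_left (by fun_prop),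
            ← lintegral_const_mul _ (by fun_prop)]
          refine lintegral_congr fun y => ?_
          ring
      _ ≤ C * m * (16 * (∫⁻ z, kn 6 j (x - z) * ‖β z‖ₑ) + 16 * kn 6 j (x - c) * ∫⁻ z, ‖β z‖ₑ) := by
          gcongr
          · exact kn_conv_lin 6 j (by fun_prop) x
          · exact kn_conv 6 j x c
      _ ≤ C * m * (16 * (∫⁻ z, D * (kn 2 j (x - z) * ‖β z‖ₑ)) + 16 * (D * kn 2 j (x - c)) * ∫⁻ z, ‖β z‖ₑ) := by
          gcongr C * m * (16 * ?_ + 16 * ?_ * _)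
          · refine lintegral_mono fun z => ?_
            by_cases hz : z ∈ Metric.ball c l
            · rw [← mul_assoc]
              gcongr
              apply hfar
              rw [Metric.mem_ball, Real.dist_eq] at hz
              have := abs_sub_le x z c
              linarith
            · simp only [hs z hz]; simp
          · apply hfar; linarith
      _ = _ := by
          rw [lintegral_const_mul _ (by fun_prop)]; ring
  have m1 : Measurable (fun y => ∫⁻ z, kn 2 j (y - z) * ‖β z‖ₑ) := knw_meas 2 j (by fun_prop)
  calc _ ≤ ∫⁻ x in (Metric.ball c (2 * l))ᶜ, C * m * (16 * D * ((∫⁻ z, kn 2 j (x - z) * ‖β z‖ₑ) + kn 2 j (x - c) * ∫⁻ z, ‖β z‖ₑ)) :=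
        setLIntegral_mono' Metric.isOpen_ball.measurableSet.compl key
    _ ≤ ∫⁻ x, C * m * (16 * D * ((∫⁻ z, kn 2 j (x - z) * ‖β z‖ₑ) + kn 2 j (x - c) * ∫⁻ z, ‖β z‖ₑ)) :=
        setLIntegral_le_lintegral _ _
    _ = C * m * (16 * D * ((∫⁻ x, ∫⁻ z, kn 2 j (x - z) * ‖β z‖ₑ) + (∫⁻ x, kn 2 j (x - c)) * ∫⁻ z, ‖β z‖ₑ)) := by
        rw [lintegral_const_mul _ (by fun_prop), lintegral_const_mul _ (by fun_prop), lintegral_add_left (by fun_prop),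
          lintegral_mul_const _ (by fun_prop)]
    _ ≤ C * m * (16 * D * (16 * (∫⁻ z, ‖β z‖ₑ) + 16 * ∫⁻ z, ‖β z‖ₑ)) := by
        gcongr
        · rw [lintegral_lintegral_swap (by unfold Function.uncurry; fun_prop), ← lintegral_const_mul _ (by fun_prop)]
          refine lintegral_mono fun z => ?_
          rw [lintegral_mul_const _ (by fun_prop)]
          gcongr; exact kn_int' j z
        · exact kn_int' j c
    _ = C * 16 * 32 * (m * D) * ∫⁻ z, ‖β z‖ₑ := by ring
    _ ≤ _ := by
        gcongr
        exact min_mul_le _ (mul_pos (two_zpow_pos j) hl)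

lemma Pq_diff (θ : SchwartzMap ℝ ℂ) : ∃ C : ℝ≥0∞, C ≠ ∞ ∧ ∀ (j : ℤ) (f : ℝ → ℂ), Tame f → ∀ x x',
    Pq 6 θ j f x ≤ Pq 6 θ j f x' + C * ENNReal.ofReal (min 1 (2 ^ j * |x - x'|)) *
      ((∫⁻ z, kn 6 j (x - z) * ‖f z‖ₑ) + ∫⁻ z, kn 6 j (x' - z) * ‖f z‖ₑ) := by
  obtain ⟨C, hC, h⟩ := conv_diff θ 8
  refine ⟨C * 16, by finiteness, fun j f hf x x' => ?_⟩
  have hfm := hf.1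
  have hcm := conv_meas θ j hfm
  have tr : ∀ (w : ℝ → ℝ≥0∞) (x : ℝ), ∫⁻ y, kn 6 j (x - y) * w y = ∫⁻ u, kn 6 j u * w (x - u) := by
    intro w x
    rw [← lintegral_sub_left_eq_self _ x]
    simp
  have m1 : Measurable (fun y => ∫⁻ z, kn 8 j (y - z) * ‖f z‖ₑ) := knw_meas 8 j (by fun_prop)
  have A : ∀ x, ∫⁻ u, kn 6 j u * (∫⁻ z, kn 8 j (x - u - z) * ‖f z‖ₑ) ≤ 16 * ∫⁻ z, kn 6 j (x - z) * ‖f z‖ₑ := by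
    intro x
    rw [← tr (fun y => ∫⁻ z, kn 8 j (y - z) * ‖f z‖ₑ) x]
    exact kn_conv_lin 6 j (by fun_prop) x
  unfold Pq
  rw [tr, tr _ x']
  calc _ ≤ ∫⁻ u, (kn 6 j u * ‖conv (dilate θ j) f (x' - u)‖ₑ + C * ENNReal.ofReal (min 1 (2 ^ j * |x - x'|)) *
      (kn 6 j u * (∫⁻ z, kn 8 j (x - u - z) * ‖f z‖ₑ) + kn 6 j u * ∫⁻ z, kn 8 j (x' - u - z) * ‖f z‖ₑ)) := by
        refine lintegral_mono fun u => ?_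
        have h1 := h j f hf (x - u) (x' - u)
        rw [sub_sub_sub_cancel_right] at h1
        calc kn 6 j u * ‖conv (dilate θ j) f (x - u)‖ₑ ≤ kn 6 j u * (‖conv (dilate θ j) f (x' - u)‖ₑ + ‖conv (dilate θ j) f (x - u) - conv (dilate θ j) f (x' - u)‖ₑ) := by
              gcongr
              refine le_trans (le_of_eq ?_) (enorm_add_le _ _)
              congr 1; ring
          _ ≤ kn 6 j u * (‖conv (dilate θ j) f (x' - u)‖ₑ + _) := mul_le_mul_right (add_le_add_right h1 _) _
          _ = _ := by simp only [mul_add]; ring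
    _ = (∫⁻ u, kn 6 j u * ‖conv (dilate θ j) f (x' - u)‖ₑ) + C * ENNReal.ofReal (min 1 (2 ^ j * |x - x'|)) *
      ((∫⁻ u, kn 6 j u * (∫⁻ z, kn 8 j (x - u - z) * ‖f z‖ₑ)) + ∫⁻ u, kn 6 j u * ∫⁻ z, kn 8 j (x' - u - z) * ‖f z‖ₑ) := by
        have m2 : ∀ x, Measurable (fun u => ∫⁻ z, kn 8 j (x - u - z) * ‖f z‖ₑ) := fun x => m1.comp (measurable_const.sub measurable_id)
        have m3 := m2 x
        have m4 := m2 x'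
        rw [lintegral_add_left (by fun_prop), lintegral_const_mul _ (by fun_prop), lintegral_add_left (by fun_prop)]
    _ ≤ (∫⁻ u, kn 6 j u * ‖conv (dilate θ j) f (x' - u)‖ₑ) + C * ENNReal.ofReal (min 1 (2 ^ j * |x - x'|)) *
      (16 * (∫⁻ z, kn 6 j (x - z) * ‖f z‖ₑ) + 16 * ∫⁻ z, kn 6 j (x' - z) * ‖f z‖ₑ) := by
        gcongr
        · exact A x
        · exact A x'
    _ = _ := by ring



lemma U_L2 (N : ℕ) (φ : SchwartzMap ℝ ℂ) (hφ : Ann N φ) : ∃ C : ℝ≥0∞, C ≠ ∞ ∧ ∀ (J : Finset ℤ) (G : ℝ → ℂ),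
    Measurable G → ∫⁻ x, ‖G x‖ₑ ^ 2 ≠ ∞ → ∫⁻ x, ∑ j ∈ J, Pq 6 φ j G x ^ 2 ≤ C * ∫⁻ x, ‖G x‖ₑ ^ 2 := by
  obtain ⟨C, hC, h⟩ := E2 N φ hφ
  obtain ⟨C2, hC2, h2⟩ := MF_two
  refine ⟨16 ^ 2 * C2 * C, by finiteness, fun J G hG hf => ?_⟩
  have hm : ∀ j, Measurable (Pq 6 φ j G) := fun j => Pq_meas 6 φ j hG
  rw [lintegral_finsetSum _ (fun j _ => (hm j).pow_const 2)]
  calc _ ≤ ∑ j ∈ J, 16 ^ 2 * C2 * ∫⁻ x, ‖conv (dilate φ j) G x‖ₑ ^ 2 := by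
        refine Finset.sum_le_sum fun j _ => ?_
        have hc := conv_meas φ j hG
        calc _ ≤ ∫⁻ x, 16 ^ 2 * MF (fun y => ‖conv (dilate φ j) G y‖ₑ) x ^ 2 := by
              refine lintegral_mono fun x => ?_
              rw [← mul_pow]; gcongr
              exact Pq_le_MF 6 (by norm_num) φ j hG x
          _ = 16 ^ 2 * ∫⁻ x, MF (fun y => ‖conv (dilate φ j) G y‖ₑ) x ^ 2 :=
              lintegral_const_mul _ ((measurable_MF _).pow_const 2)
          _ ≤ _ := by
              rw [mul_assoc]; gcongr; exact h2 _ (by fun_prop)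
    _ = 16 ^ 2 * C2 * ∑ j ∈ J, ∫⁻ x, ‖conv (dilate φ j) G x‖ₑ ^ 2 := by rw [Finset.mul_sum]
    _ ≤ _ := by rw [mul_assoc (16 ^ 2 * C2)]; gcongr; exact h J G hG hf

lemma U_bad (φ : SchwartzMap ℝ ℂ) : ∃ C : ℝ≥0∞, C ≠ ∞ ∧ ∀ (J : Finset ℤ) (b : ℝ → ℂ) (T : Set (ℝ × ℝ)),
    Measurable b → ∫⁻ x, ‖b x‖ₑ ≠ ∞ → T.Countable → (∀ a ∈ T, a.1 < a.2) →
    T.PairwiseDisjoint (fun a => Set.Ioo a.1 a.2) →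
    (∀ x, x ∉ (⋃ a ∈ T, Set.Ioo a.1 a.2) → b x = 0) →
    (∀ a ∈ T, ∫ x in Set.Ioo a.1 a.2, b x = 0) →
    ∫⁻ x in (⋃ a ∈ T, Metric.ball ((a.1 + a.2) / 2) (a.2 - a.1))ᶜ, ∑ j ∈ J, Pq 6 φ j b x ≤
      C * ∑' a : T, ∫⁻ x in Set.Ioo a.1.1 a.1.2, ‖b x‖ₑ := by
  obtain ⟨C, hC, h⟩ := atom_P φ
  refine ⟨C * 8, by finiteness, fun J b T hb hf hTc hlt hTd hs h0 => ?_⟩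
  have := hTc.to_subtype
  set β : T → ℝ → ℂ := fun a => (Set.Ioo a.1.1 a.1.2).indicator b with hβ
  have hβm : ∀ a, Measurable (β a) := fun a => hb.indicator measurableSet_Ioo
  have hβn : ∀ a, ∫⁻ z, ‖β a z‖ₑ = ∫⁻ x in Set.Ioo a.1.1 a.1.2, ‖b x‖ₑ := fun a => by
    rw [← lintegral_indicator measurableSet_Ioo]
    simp only [hβ, enorm_indicator_eq_indicator_enorm]
  have hβf : ∀ a, ∫⁻ z, ‖β a z‖ₑ ≠ ∞ := fun a => by
    rw [hβn]; exact ne_top_of_le_ne_top hf (setLIntegral_le_lintegral _ _)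
  have ht : Tame b := tame_of_lp hb 1 le_rfl (by simpa using hf)
  have e1 : ∀ j y, ‖conv (dilate φ j) b y‖ₑ ≤ ∑' a : T, ‖conv (dilate φ j) (β a) y‖ₑ := by
    intro j y
    have : conv (dilate φ j) b y = ∑' a : T, conv (dilate φ j) (β a) y := by
      have hU : (⋃ a ∈ T, Set.Ioo a.1 a.2) = ⋃ a : T, Set.Ioo a.1.1 a.1.2 := Set.biUnion_eq_iUnion _ _
      unfold conv
      rw [← setIntegral_eq_integral_of_forall_compl_eq_zero (s := ⋃ a : T, Set.Ioo a.1.1 a.1.2),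
        integral_iUnion (fun _ => measurableSet_Ioo) _ (ht.integrable φ j y).integrableOn]
      · congr 1; ext a
        rw [← integral_indicator measurableSet_Ioo]
        congr 1; ext z
        simp only [hβ, Set.indicator]
        split_ifs <;> simp
      · intro a a' hne
        exact hTd a.2 a'.2 (fun hh => hne (Subtype.ext hh))
      · intro z hz
        rw [hs z (by rw [hU]; exact hz), mul_zero]
    rw [this]
    exact enorm_tsum_le_tsum_enorm
  have e2 : ∀ j x, Pq 6 φ j b x ≤ ∑' a : T, Pq 6 φ j (β a) x := by
    intro j x
    unfold Pq
    rw [← lintegral_tsum]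
    · refine lintegral_mono fun y => ?_
      rw [ENNReal.tsum_mul_left]; gcongr; exact e1 j y
    · intro a
      have := conv_meas φ j (hβm a)
      fun_prop
  have e3 : ∀ j (a : T), ∫⁻ x in (⋃ a ∈ T, Metric.ball ((a.1 + a.2) / 2) (a.2 - a.1))ᶜ, Pq 6 φ j (β a) x ≤
      C * ENNReal.ofReal (min (2 ^ j * ((a.1.2 - a.1.1) / 2)) (1 / (2 ^ j * ((a.1.2 - a.1.1) / 2)))) *
        ∫⁻ x in Set.Ioo a.1.1 a.1.2, ‖b x‖ₑ := by
    intro j a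
    have hl : 0 < (a.1.2 - a.1.1) / 2 := by linarith [hlt a.1 a.2]
    have := h j ((a.1.1 + a.1.2) / 2) ((a.1.2 - a.1.1) / 2) (β a) hl (hβm a) (by
      intro z hz
      rw [← Real.Ioo_eq_ball] at hz
      exact Set.indicator_of_notMem hz _) (hβf a) (by
      rw [hβ]; simp only
      rw [integral_indicator measurableSet_Ioo]; exact h0 a.1 a.2)
    rw [hβn] at this
    refine le_trans (lintegral_mono_set ?_) this
    rw [Set.compl_subset_compl, mul_div_cancel₀ _ (by norm_num : (2:ℝ) ≠ 0)]
    exact Set.subset_biUnion_of_mem (u := fun a : ℝ × ℝ => Metric.ball ((a.1 + a.2) / 2) (a.2 - a.1)) a.2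
  calc _ = ∑ j ∈ J, ∫⁻ x in (⋃ a ∈ T, Metric.ball ((a.1 + a.2) / 2) (a.2 - a.1))ᶜ, Pq 6 φ j b x :=
        lintegral_finsetSum _ fun j _ => Pq_meas 6 φ j hb
    _ ≤ ∑ j ∈ J, ∑' a : T, ∫⁻ x in (⋃ a ∈ T, Metric.ball ((a.1 + a.2) / 2) (a.2 - a.1))ᶜ, Pq 6 φ j (β a) x := by
        refine Finset.sum_le_sum fun j _ => ?_
        rw [← lintegral_tsum fun a => (Pq_meas 6 φ j (hβm a)).aemeasurable]
        exact lintegral_mono fun x => e2 j x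
    _ ≤ ∑ j ∈ J, ∑' a : T, C * ENNReal.ofReal (min (2 ^ j * ((a.1.2 - a.1.1) / 2)) (1 / (2 ^ j * ((a.1.2 - a.1.1) / 2)))) *
        ∫⁻ x in Set.Ioo a.1.1 a.1.2, ‖b x‖ₑ :=
        Finset.sum_le_sum fun j _ => ENNReal.tsum_le_tsum fun a => e3 j a
    _ = ∑' a : T, ∑ j ∈ J, C * ENNReal.ofReal (min (2 ^ j * ((a.1.2 - a.1.1) / 2)) (1 / (2 ^ j * ((a.1.2 - a.1.1) / 2)))) *
        ∫⁻ x in Set.Ioo a.1.1 a.1.2, ‖b x‖ₑ := by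
        rw [Summable.tsum_finsetSum fun _ _ => ENNReal.summable]
    _ ≤ ∑' a : T, C * 8 * ∫⁻ x in Set.Ioo a.1.1 a.1.2, ‖b x‖ₑ := by
        refine ENNReal.tsum_le_tsum fun a => ?_
        have hl : 0 < (a.1.2 - a.1.1) / 2 := by linarith [hlt a.1 a.2]
        rw [← Finset.sum_mul, ← Finset.mul_sum]
        gcongr
        exact (ENNReal.sum_le_tsum J).trans (sum_min _ hl)
    _ = _ := ENNReal.tsum_mul_left

lemma U_weak (N : ℕ) (φ : SchwartzMap ℝ ℂ) (hφ : Ann N φ) : ∃ C : ℝ≥0∞, C ≠ ∞ ∧ ∀ (J : Finset ℤ) (g : ℝ → ℂ),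
    Measurable g → ∫⁻ x, ‖g x‖ₑ ≠ ∞ → ∀ t : ℝ≥0∞, t ≠ 0 → t ≠ ∞ →
    t * volume {x | t < l2 J (fun j => Pq 6 φ j g x)} ≤ C * ∫⁻ x, ‖g x‖ₑ := by
  obtain ⟨C1, hC1, h1⟩ := U_L2 N φ hφ
  obtain ⟨C2, hC2, h2⟩ := U_bad φ
  refine ⟨8 + C1 * 8 + C2 * 4, by finiteness, fun J g hg hf t ht0 ht => ?_⟩
  obtain ⟨T, G, hTc, hlt, hTd, hGm, hG2, hG1, hbs, hb0, hbn, hlen⟩ := cz hg hf t ht0 ht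
  have := hTc.to_subtype
  set X := ∫⁻ x, ‖g x‖ₑ with hX
  have hbm : Measurable (fun x => g x - G x) := by fun_prop
  have hGf : ∫⁻ x, ‖G x‖ₑ ≠ ∞ := ne_top_of_le_ne_top hf hG1
  have hbf : ∫⁻ x, ‖g x - G x‖ₑ ≠ ∞ := by
    refine ne_top_of_le_ne_top (b := X + X) (by finiteness) ?_
    calc _ ≤ ∫⁻ x, (‖g x‖ₑ + ‖G x‖ₑ) := lintegral_mono fun x => enorm_sub_le
      _ = X + ∫⁻ x, ‖G x‖ₑ := lintegral_add_left (by fun_prop) _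
      _ ≤ _ := by gcongr
  have hG22 : ∫⁻ x, ‖G x‖ₑ ^ 2 ≤ 2 * t * X := by
    calc _ ≤ ∫⁻ x, 2 * t * ‖G x‖ₑ := by
          refine lintegral_mono_ae ?_
          filter_upwards [hG2] with x hx
          rw [sq]; gcongr
      _ = 2 * t * ∫⁻ x, ‖G x‖ₑ := lintegral_const_mul _ (by fun_prop)
      _ ≤ _ := by gcongr
  set O := ⋃ a ∈ T, Metric.ball ((a.1 + a.2) / 2) (a.2 - a.1) with hO
  have hOm : MeasurableSet O := MeasurableSet.biUnion hTc fun _ _ => Metric.isOpen_ball.measurableSet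
  have hth : t / 2 ≠ 0 := by simp [ht0]
  have htt : t / 2 ≠ ∞ := by finiteness
  have A1 : t * volume O ≤ 8 * X := by
    calc t * volume O ≤ t * ∑' a : T, volume (Metric.ball ((a.1.1 + a.1.2) / 2) (a.1.2 - a.1.1)) := by
          gcongr; exact measure_biUnion_le _ hTc _
      _ = 2 * (t * ∑' a : T, ENNReal.ofReal (a.1.2 - a.1.1)) := by
          simp_rw [Real.volume_ball]
          rw [← mul_assoc, mul_comm 2 t, mul_assoc, ← ENNReal.tsum_mul_left (a := 2)]
          congr 2; ext a
          rw [ENNReal.ofReal_mul (by norm_num)]; simp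
      _ ≤ 2 * (4 * X) := by gcongr
      _ = _ := by ring
  set Y1 := {x | t / 2 < l2 J (fun j => Pq 6 φ j G x)} with hY1
  set Y2 := {x | x ∈ Oᶜ ∧ t / 2 < ∑ j ∈ J, Pq 6 φ j (fun x => g x - G x) x} with hY2
  have hm1 : ∀ j, Measurable (Pq 6 φ j G) := fun j => Pq_meas 6 φ j hGm
  have hm2 : ∀ j, Measurable (Pq 6 φ j (fun x => g x - G x)) := fun j => Pq_meas 6 φ j hbm
  have A2 : t * volume Y1 ≤ C1 * 8 * X := by
    have a1 : (t / 2) ^ 2 * volume Y1 ≤ C1 * (2 * t * X) := by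
      calc _ ≤ (t / 2) ^ 2 * volume {x | (t / 2) ^ 2 ≤ ∑ j ∈ J, Pq 6 φ j G x ^ 2} := by
            gcongr
            intro x hx
            rw [hY1, Set.mem_ofPred_eq] at hx
            rw [Set.mem_ofPred_eq, ← l2_sq J (fun j => Pq 6 φ j G x)]
            gcongr
        _ ≤ ∫⁻ x, ∑ j ∈ J, Pq 6 φ j G x ^ 2 := mul_meas_ge_le_lintegral (by fun_prop) _
        _ ≤ C1 * ∫⁻ x, ‖G x‖ₑ ^ 2 := h1 J G hGm (ne_top_of_le_ne_top (by finiteness) hG22)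
        _ ≤ _ := by gcongr
    have e : t * (t * volume Y1) = 4 * ((t / 2) ^ 2 * volume Y1) := by
      have : t = 2 * (t / 2) := (ENNReal.mul_div_cancel (by norm_num) (by norm_num)).symm
      conv_lhs => rw [this]
      ring
    have a2 : t * (t * volume Y1) ≤ t * (C1 * 8 * X) := by
      rw [e]
      calc _ ≤ 4 * (C1 * (2 * t * X)) := by gcongr
        _ = _ := by ring
    exact (ENNReal.mul_le_mul_iff_right ht0 ht).1 a2
  have A3 : t * volume Y2 ≤ C2 * 4 * X := by
    have a1 : (t / 2) * volume Y2 ≤ C2 * (2 * X) := by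
      calc _ ≤ (t / 2) * (volume.restrict Oᶜ) {x | t / 2 ≤ ∑ j ∈ J, Pq 6 φ j (fun x => g x - G x) x} := by
            rw [Measure.restrict_apply' hOm.compl]
            gcongr
            intro x hx
            exact ⟨hx.2.le, hx.1⟩
        _ ≤ ∫⁻ x in Oᶜ, ∑ j ∈ J, Pq 6 φ j (fun x => g x - G x) x := mul_meas_ge_le_lintegral (by fun_prop) _
        _ ≤ C2 * _ := h2 J _ T hbm hbf hTc hlt hTd hbs hb0
        _ ≤ _ := by gcongr
    calc t * volume Y2 = 2 * ((t / 2) * volume Y2) := by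
          rw [← mul_assoc, ENNReal.mul_div_cancel (by norm_num) (by norm_num)]
      _ ≤ 2 * (C2 * (2 * X)) := by gcongr
      _ = _ := by ring
  have hsub : {x | t < l2 J (fun j => Pq 6 φ j g x)} ⊆ O ∪ Y1 ∪ Y2 := by
    intro x hx
    by_contra hcon
    simp only [Set.mem_union, not_or, hY1, hY2, Set.mem_ofPred_eq, not_and, not_lt] at hcon
    obtain ⟨⟨c1, c2⟩, c3⟩ := hcon
    have c3 := c3 c1
    have hGt : Tame G := tame_of_lp hGm 1 le_rfl (by simpa using hGf)
    have hbt : Tame (fun x => g x - G x) := tame_of_lp hbm 1 le_rfl (by simpa using hbf)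
    have : l2 J (fun j => Pq 6 φ j g x) ≤ t := by
      calc _ ≤ l2 J (fun j => Pq 6 φ j G x + Pq 6 φ j (fun x => g x - G x) x) :=
            l2_mono fun j _ => Pq_sub 6 φ j hGt hbt (by ext; ring) x
        _ ≤ _ := l2_add _ _ _
        _ ≤ t / 2 + t / 2 := add_le_add c2 ((l2_le_sum _ _).trans c3)
        _ = t := ENNReal.add_halves t
    exact absurd hx (not_lt.2 this)
  calc _ ≤ t * (volume O + volume Y1 + volume Y2) := by
        gcongr
        exact (measure_mono hsub).trans ((measure_union_le _ _).trans (by gcongr; exact measure_union_le _ _))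
    _ = t * volume O + t * volume Y1 + t * volume Y2 := by ring
    _ ≤ 8 * X + C1 * 8 * X + C2 * 4 * X := by gcongr
    _ = _ := by ring



lemma kn_three (n : ℕ) (j : ℤ) {x y : ℝ} (h : |y| ≤ 3 * |x|) :
    kn n j x ≤ ENNReal.ofReal (3 ^ n) * kn n j y := by
  unfold kn
  have h1 := om_pos j x
  have h3 := om_pos j y
  have h2 := two_zpow_pos j
  rw [← ENNReal.ofReal_mul (by positivity)]
  apply ENNReal.ofReal_le_ofReal
  rw [mul_div_assoc', div_le_div_iff₀ (by positivity) (by positivity)]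
  have : (1 + 2 ^ j * |y|) ^ n ≤ (3 * (1 + 2 ^ j * |x|)) ^ n := by
    apply pow_le_pow_left₀ (by linarith)
    nlinarith
  rw [mul_pow] at this
  nlinarith

lemma Pq_neg (n : ℕ) (φ : SchwartzMap ℝ ℂ) (j : ℤ) (g : ℝ → ℂ) (x : ℝ) :
    Pq n φ j (fun x => - g x) x = Pq n φ j g x := by
  unfold Pq conv
  simp only [mul_neg, integral_neg, enorm_neg]

lemma far_ker (j : ℤ) {w : ℝ → ℝ≥0∞} (hw : Measurable w) {c ρ x x1 : ℝ} (hx : x ∈ Metric.ball c ρ)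
    (hx1 : x1 ∈ Metric.ball c ρ) :
    ∫⁻ z, kn 6 j (x - z) * (Metric.ball c (2 * ρ))ᶜ.indicator w z ≤
      ENNReal.ofReal (1 / (1 + 2 ^ j * ρ)) * (144 * MF w x1) := by
  have hρ : 0 < ρ := Metric.pos_of_mem_ball hx
  rw [Metric.mem_ball, Real.dist_eq] at hx hx1
  have key : ∀ z, kn 6 j (x - z) * (Metric.ball c (2 * ρ))ᶜ.indicator w z ≤
      ENNReal.ofReal (1 / (1 + 2 ^ j * ρ)) * (9 * (kn 2 j (x1 - z) * w z)) := by
    intro z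
    by_cases hz : z ∈ (Metric.ball c (2 * ρ))ᶜ
    · rw [Set.indicator_of_mem hz]
      rw [Set.mem_compl_iff, Metric.mem_ball, not_lt, Real.dist_eq] at hz
      have a1 : ρ ≤ |x - z| := by
        have := abs_sub_le z x c
        rw [abs_sub_comm z x] at this
        linarith
      have a2 : |x1 - z| ≤ 3 * |x - z| := by
        have := abs_sub_le x1 x z
        have h2 := abs_sub_le x1 c x
        rw [abs_sub_comm c x] at h2
        linarith
      calc _ ≤ (ENNReal.ofReal (1 / (1 + 2 ^ j * ρ)) * (ENNReal.ofReal (3 ^ 2) * kn 2 j (x1 - z))) * w z := by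
            gcongr
            refine (kn_anti (by norm_num : 2 + 1 ≤ 6) j _).trans ((kn_far 2 j _ ρ hρ.le a1).trans ?_)
            gcongr
            exact kn_three 2 j a2
        _ = _ := by
            rw [show ENNReal.ofReal (3 ^ 2) = 9 by norm_num]; ring
    · rw [Set.indicator_of_notMem hz]; simp
  refine (lintegral_mono key).trans ?_
  rw [lintegral_const_mul' _ _ (by finiteness), lintegral_const_mul' _ _ (by finiteness)]
  gcongr ENNReal.ofReal (1 / (1 + 2 ^ j * ρ)) * ?_
  calc _ ≤ 9 * (16 * MF w x1) := by gcongr; exact kn_MF j w hw x1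
    _ = 144 * MF w x1 := by rw [← mul_assoc]; norm_num

lemma U_strong (N : ℕ) (φ : SchwartzMap ℝ ℂ) (hφ : Ann N φ) (q : ℝ) (hq : 1 < q) : ∃ C : ℝ≥0∞, C ≠ ∞ ∧
    ∀ (J : Finset ℤ) (g : ℝ → ℂ), Measurable g → ∫⁻ x, ‖g x‖ₑ ^ q ≠ ∞ →
    ∫⁻ x, (l2 J (fun j => Pq 6 φ j g x)) ^ q ≤ C * ∫⁻ x, ‖g x‖ₑ ^ q := by
  have hq0 : 0 < q := by linarith
  obtain ⟨ε, hε0, hε1, hgl⟩ := good_lambda q hq0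
  obtain ⟨Cw, hCw, hw⟩ := U_weak N φ hφ
  obtain ⟨Cd, hCd, hd⟩ := Pq_diff φ
  obtain ⟨Cm, hCm, hm⟩ := MF_strong q hq
  obtain ⟨Cc, hCc, hcm⟩ := conv_le_MF φ
  set Cf : ℝ≥0∞ := Cd * 2 * 288 * 8 with hCf
  have hCft : Cf ≠ ∞ := by rw [hCf]; finiteness
  set D : ℝ≥0∞ := 16 * Cw + 2 * Cf + 1 with hD
  have hDt : D ≠ ∞ := by rw [hD]; finiteness
  have hD0 : D ≠ 0 := by rw [hD]; simp
  set γ : ℝ≥0∞ := ENNReal.ofReal ε / D with hγ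
  have hγD : γ * D = ENNReal.ofReal ε := ENNReal.div_mul_cancel hD0 hDt
  obtain ⟨C, hC, hgl⟩ := hgl γ (by rw [hγ]; simp [hε0, hDt]) (by rw [hγ]; exact ENNReal.div_ne_top (by finiteness) hD0)
  refine ⟨C * Cm, by finiteness, fun J g hg hgf => ?_⟩
  have hgn : Measurable (fun y => ‖g y‖ₑ) := by fun_prop
  have hT : Tame g := tame_of_lp hg q hq.le hgf
  have main := hgl (fun x => l2 J (fun j => Pq 6 φ j g x)) (MF (fun y => ‖g y‖ₑ))
    (l2_meas J (fun j => Pq_meas 6 φ j hg)) (measurable_MF _) ?_ ?_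
  · refine main.trans ?_
    rw [mul_assoc]; gcongr
    exact hm _ hgn
  · intro k c ρ hρ x1 hx1 hK
    set g1 := (Metric.ball c (2 * ρ)).indicator g with hg1
    set g2 := (Metric.ball c (2 * ρ))ᶜ.indicator g with hg2
    have hT1 : Tame g1 := hT.indicator Metric.isOpen_ball.measurableSet
    have hT2 : Tame g2 := hT.indicator Metric.isOpen_ball.measurableSet.compl
    have e1 : g = fun x => g1 x + g2 x := by
      ext x; simp only [hg1, hg2]
      exact (congrFun (Set.indicator_self_add_compl (Metric.ball c (2 * ρ)) g) x).symm
    have e2 : g2 = fun x => g x + - g1 x := by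
      ext x; rw [congrFun e1 x]; ring
    have h2k0 : (2:ℝ≥0∞) ^ k ≠ 0 := (ENNReal.zpow_pos (by norm_num) (by norm_num) k).ne'
    have h2kt : (2:ℝ≥0∞) ^ k ≠ ∞ := ENNReal.zpow_ne_top (by norm_num) (by norm_num) k
    have hγt : γ ≠ ∞ := by rw [hγ]; exact ENNReal.div_ne_top (by finiteness) hD0
    have i1 : ∫⁻ x, ‖g1 x‖ₑ ≤ ENNReal.ofReal (4 * ρ) * (γ * 2 ^ k) := by
      have : ∀ x, ‖g1 x‖ₑ = (Metric.ball c (2 * ρ)).indicator (fun y => ‖g y‖ₑ) x := fun x => by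
        rw [hg1, enorm_indicator_eq_indicator_enorm]
      simp_rw [this]
      rw [lintegral_indicator Metric.isOpen_ball.measurableSet]
      refine (lintegral_ball_le_MF _ (Metric.ball_subset_ball (by linarith) hx1)).trans ?_
      rw [show 2 * (2 * ρ) = 4 * ρ by ring]; gcongr
    have i1t : ∫⁻ x, ‖g1 x‖ₑ ≠ ∞ := ne_top_of_le_ne_top (by finiteness) i1
    set t : ℝ≥0∞ := 2 ^ k / 4 with ht
    have ht0 : t ≠ 0 := by rw [ht]; simp [h2k0]
    have htt : t ≠ ∞ := by rw [ht]; exact ENNReal.div_ne_top h2kt (by norm_num)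
    have ht4 : t * 4 = 2 ^ k := ENNReal.div_mul_cancel (by norm_num) (by norm_num)
    refine ⟨{x | t < l2 J (fun j => Pq 6 φ j g1 x)}, ?_, ?_⟩
    · have := hw J g1 hT1.1 i1t t ht0 htt
      rw [← ENNReal.mul_le_mul_iff_right ht0 htt]
      refine this.trans ?_
      calc _ ≤ Cw * (ENNReal.ofReal (4 * ρ) * (γ * 2 ^ k)) := by gcongr
        _ = t * (ENNReal.ofReal ρ * (γ * (16 * Cw))) := by
            rw [← ht4, ENNReal.ofReal_mul (by norm_num)]; norm_num; ring
        _ ≤ t * (ENNReal.ofReal ρ * (γ * D)) := by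
            gcongr
            rw [hD, add_assoc]; exact le_self_add
        _ = _ := by rw [hγD, ENNReal.ofReal_mul hε0.le]; ring
    · intro x hx x' hx' hxZ hx'Z
      simp only [Set.mem_ofPred_eq, not_lt] at hxZ hx'Z
      have hxx : |x - x'| ≤ 2 * ρ := by
        rw [Metric.mem_ball, Real.dist_eq] at hx hx'
        have h2 := abs_sub_le x c x'
        rw [abs_sub_comm c x'] at h2
        linarith
      have n2 : ∀ z, ‖g2 z‖ₑ = (Metric.ball c (2 * ρ))ᶜ.indicator (fun y => ‖g y‖ₑ) z := fun z => by
        rw [hg2, enorm_indicator_eq_indicator_enorm]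
      set M := MF (fun y => ‖g y‖ₑ) x1
      have hP : ∀ j, Pq 6 φ j g x ≤ (Pq 6 φ j g x' + (Pq 6 φ j g1 x + Pq 6 φ j g1 x')) +
          Cd * 2 * 288 * M * ENNReal.ofReal (min (2 ^ j * ρ) (1 / (2 ^ j * ρ))) := by
        intro j
        have b1 := Pq_sub 6 φ j hT1 hT2 e1 x
        have b2 := hd j g2 hT2 x x'
        have b3 := Pq_sub 6 φ j hT hT1.neg e2 x'
        rw [Pq_neg] at b3
        have h2j := two_zpow_pos j
        have b4 : Cd * ENNReal.ofReal (min 1 (2 ^ j * |x - x'|)) *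
            ((∫⁻ z, kn 6 j (x - z) * ‖g2 z‖ₑ) + ∫⁻ z, kn 6 j (x' - z) * ‖g2 z‖ₑ) ≤
            Cd * 2 * 288 * M * ENNReal.ofReal (min (2 ^ j * ρ) (1 / (2 ^ j * ρ))) := by
          simp_rw [n2]
          have m1 : ENNReal.ofReal (min 1 (2 ^ j * |x - x'|)) ≤ 2 * ENNReal.ofReal (min 1 (2 ^ j * ρ)) := by
            rw [show (2:ℝ≥0∞) = ENNReal.ofReal 2 by norm_num, ← ENNReal.ofReal_mul (by norm_num)]
            apply ENNReal.ofReal_le_ofReal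
            rcases le_total 1 (2 ^ j * ρ) with h | h
            · rw [min_eq_left h]; exact (min_le_left _ _).trans (by norm_num)
            · rw [min_eq_right h]; refine (min_le_right _ _).trans ?_
              nlinarith
          calc _ ≤ Cd * (2 * ENNReal.ofReal (min 1 (2 ^ j * ρ))) *
              (ENNReal.ofReal (1 / (1 + 2 ^ j * ρ)) * (144 * M) + ENNReal.ofReal (1 / (1 + 2 ^ j * ρ)) * (144 * M)) := by
                gcongr
                · exact far_ker j hgn hx hx1
                · exact far_ker j hgn hx' hx1
            _ = Cd * 2 * 288 * M * (ENNReal.ofReal (min 1 (2 ^ j * ρ)) * ENNReal.ofReal (1 / (1 + 2 ^ j * ρ))) := by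
                ring
            _ ≤ _ := by gcongr; exact min_mul_le _ (by positivity)
        calc _ ≤ _ := b1
          _ ≤ Pq 6 φ j g1 x + ((Pq 6 φ j g x' + Pq 6 φ j g1 x') + _) := by
            gcongr
            refine b2.trans ?_
            gcongr
          _ ≤ Pq 6 φ j g1 x + ((Pq 6 φ j g x' + Pq 6 φ j g1 x') + _) := by
            gcongr Pq 6 φ j g1 x + ((Pq 6 φ j g x' + Pq 6 φ j g1 x') + ?_)
          _ = _ := by ring
      have sumD : ∑ j ∈ J, Cd * 2 * 288 * M * ENNReal.ofReal (min (2 ^ j * ρ) (1 / (2 ^ j * ρ))) ≤ t * 2 := by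
        rw [← Finset.mul_sum]
        calc _ ≤ Cd * 2 * 288 * M * 8 := by
              gcongr
              exact (ENNReal.sum_le_tsum J).trans (sum_min ρ hρ)
          _ = Cf * M := by rw [hCf]; ring
          _ ≤ Cf * (γ * 2 ^ k) := by gcongr
          _ = (γ * (2 * Cf)) * (t * 2) := by rw [← ht4]; ring
          _ ≤ (γ * D) * (t * 2) := by
            gcongr; rw [hD]; exact (le_add_self).trans le_self_add
          _ ≤ 1 * (t * 2) := by
            gcongr; rw [hγD]; exact ENNReal.ofReal_le_one.2 hε1.le
          _ = _ := one_mul _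
      calc l2 J (fun j => Pq 6 φ j g x) ≤ _ := l2_mono (fun j _ => hP j)
        _ ≤ _ := l2_add J _ _
        _ ≤ (l2 J (fun j => Pq 6 φ j g x') + (t + t)) + t * 2 := by
          gcongr
          · refine (l2_add J _ _).trans ?_
            gcongr
            refine (l2_add J _ _).trans ?_
            gcongr
          · exact (l2_le_sum J _).trans sumD
        _ = _ := by rw [← ht4]; ring
  · -- a priori finiteness
    have f1 : ∀ j, ∫⁻ x, ‖conv (dilate φ j) g x‖ₑ ^ q ≠ ∞ := by
      intro j
      refine ne_top_of_le_ne_top (b := Cc ^ q * (Cm * ∫⁻ x, ‖g x‖ₑ ^ q)) (ENNReal.mul_ne_top (by finiteness) (by finiteness)) ?_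
      calc _ ≤ ∫⁻ x, Cc ^ q * MF (fun y => ‖g y‖ₑ) x ^ q := by
            refine lintegral_mono fun x => ?_
            rw [← ENNReal.mul_rpow_of_nonneg _ _ hq0.le]
            exact ENNReal.rpow_le_rpow (hcm j g hg x) hq0.le
        _ ≤ _ := by
            rw [lintegral_const_mul' _ _ (by finiteness)]
            gcongr; exact hm _ hgn
    have f2 : ∀ j, ∫⁻ x, Pq 6 φ j g x ^ q ≠ ∞ := by
      intro j
      have hcj := conv_meas φ j hg
      refine ne_top_of_le_ne_top (b := 16 ^ q * (Cm * ∫⁻ x, ‖conv (dilate φ j) g x‖ₑ ^ q))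
        (ENNReal.mul_ne_top (by finiteness) (ENNReal.mul_ne_top hCm (f1 j))) ?_
      calc _ ≤ ∫⁻ x, 16 ^ q * MF (fun y => ‖conv (dilate φ j) g y‖ₑ) x ^ q := by
            refine lintegral_mono fun x => ?_
            rw [← ENNReal.mul_rpow_of_nonneg _ _ hq0.le]
            exact ENNReal.rpow_le_rpow (Pq_le_MF 6 (by norm_num) φ j hg x) hq0.le
        _ ≤ _ := by
            rw [lintegral_const_mul' _ _ (by finiteness)]
            gcongr; exact hm _ (by fun_prop)
    have f3 : ∀ x, (l2 J (fun j => Pq 6 φ j g x)) ^ q ≤ (J.card : ℝ≥0∞) ^ (q - 1) * ∑ j ∈ J, Pq 6 φ j g x ^ q := by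
      intro x
      refine (ENNReal.rpow_le_rpow (l2_le_sum J _) hq0.le).trans ?_
      have := ENNReal.inner_le_Lp_mul_Lq J (fun j => Pq 6 φ j g x) (fun _ => 1) (Real.HolderConjugate.conjExponent hq)
      simpa using ENNReal.rpow_sum_le_const_mul_sum_rpow J (fun j => Pq 6 φ j g x) hq.le
    refine ne_top_of_le_ne_top ?_ (lintegral_mono f3)
    rw [lintegral_const_mul' _ _ (ENNReal.rpow_ne_top_of_nonneg (by linarith) (by finiteness)), lintegral_finsetSum _ (fun j _ => (Pq_meas 6 φ j hg).pow_const q)]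
    refine ENNReal.mul_ne_top (ENNReal.rpow_ne_top_of_nonneg (by linarith) (by finiteness)) ?_
    exact ENNReal.sum_ne_top.2 fun j _ => f2 j



/-- slowly varying at scale `2^{-j}` -/
def Slow (j : ℤ) (P : ℝ → ℝ≥0∞) : Prop :=
  ∀ x y, P x ≤ ENNReal.ofReal ((1 + 2 ^ j * |x - y|) ^ 12) * P y

lemma Slow.pt {j : ℤ} {P : ℝ → ℝ≥0∞} (h : Slow j P) (m : ℕ) (x z : ℝ) :
    kn (12 + m) j (x - z) * P z ≤ kn m j (x - z) * P x := by
  calc _ ≤ kn (12 + m) j (x - z) * (ENNReal.ofReal ((1 + 2 ^ j * |z - x|) ^ 12) * P x) := by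
        gcongr; exact h z x
    _ = (ENNReal.ofReal ((1 + 2 ^ j * |x - z|) ^ 12) * kn (12 + m) j (x - z)) * P x := by
        rw [abs_sub_comm]; ring
    _ = _ := by rw [kn_split]

lemma Slow.avg {j : ℤ} {P : ℝ → ℝ≥0∞} (h : Slow j P) (x : ℝ) :
    ∫⁻ z, kn 14 j (x - z) * P z ≤ 16 * P x := by
  calc _ ≤ ∫⁻ z, kn 2 j (x - z) * P x := lintegral_mono fun z => h.pt 2 x z
    _ = (∫⁻ z, kn 2 j (x - z)) * P x := lintegral_mul_const _ (by fun_prop)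
    _ ≤ _ := by gcongr; exact kn_int j x

lemma I_low (θ : SchwartzMap ℝ ℂ) : ∃ C : ℝ≥0∞, C ≠ ∞ ∧ ∀ (j : ℤ) (F : ℝ → ℂ) (P : ℝ → ℝ≥0∞), Tame F →
    (∀ x, ‖F x‖ₑ ≤ P x) → Slow j P → (∀ x, conv (dilate θ j) F x = F x) → ∀ x x' τ ρ, 0 < ρ → 2 ^ j * ρ ≤ 1 →
    |x - x'| ≤ 2 * ρ → P x ≤ τ → P x' ≤ τ →
    ‖F x - F x'‖ₑ ≤ C * τ * ENNReal.ofReal (min (2 ^ j * ρ) (1 / (2 ^ j * ρ))) := by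
  obtain ⟨C, hC, h⟩ := conv_diff θ 14
  refine ⟨C * 64, by finiteness, fun j F P hF hFP hP hc x x' τ ρ hρ hj hxx hx hx' => ?_⟩
  have h2 := two_zpow_pos j
  have h0 := h j F hF x x'
  rw [hc, hc] at h0
  refine h0.trans ?_
  have m1 : ENNReal.ofReal (min 1 (2 ^ j * |x - x'|)) ≤ 2 * ENNReal.ofReal (min (2 ^ j * ρ) (1 / (2 ^ j * ρ))) := by
    rw [show (2:ℝ≥0∞) = ENNReal.ofReal 2 by norm_num, ← ENNReal.ofReal_mul (by norm_num)]
    apply ENNReal.ofReal_le_ofReal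
    have : 1 ≤ 1 / (2 ^ j * ρ) := by rw [le_div_iff₀ (by positivity)]; linarith
    rw [min_eq_left (hj.trans this)]
    refine (min_le_right _ _).trans ?_
    nlinarith
  have a : ∀ x, ∫⁻ z, kn 14 j (x - z) * ‖F z‖ₑ ≤ 16 * P x := fun x =>
    (lintegral_mono fun z => by gcongr; exact hFP z).trans (hP.avg x)
  calc _ ≤ C * (2 * ENNReal.ofReal (min (2 ^ j * ρ) (1 / (2 ^ j * ρ)))) * (16 * τ + 16 * τ) := by
        gcongr
        · exact (a x).trans (by gcongr)
        · exact (a x').trans (by gcongr)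
    _ = _ := by ring

lemma I_far (θ : SchwartzMap ℝ ℂ) : ∃ C : ℝ≥0∞, C ≠ ∞ ∧ ∀ (j : ℤ) (F : ℝ → ℂ) (P : ℝ → ℝ≥0∞), Measurable F →
    (∀ x, ‖F x‖ₑ ≤ P x) → Slow j P → ∀ c ρ x τ, x ∈ Metric.ball c ρ → 1 < 2 ^ j * ρ → P x ≤ τ →
    ‖conv (dilate θ j) ((Metric.ball c (2 * ρ))ᶜ.indicator F) x‖ₑ ≤
      C * τ * ENNReal.ofReal (min (2 ^ j * ρ) (1 / (2 ^ j * ρ))) := by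
  obtain ⟨C, hC, h⟩ := conv_le θ 15
  refine ⟨C * 16, by finiteness, fun j F P hF hFP hP c ρ x τ hx hj hPx => ?_⟩
  have h2 := two_zpow_pos j
  have hρ : 0 < ρ := Metric.pos_of_mem_ball hx
  rw [Metric.mem_ball, Real.dist_eq] at hx
  refine (h j _ (hF.indicator Metric.isOpen_ball.measurableSet.compl) x).trans ?_
  have m1 : ENNReal.ofReal (1 / (1 + 2 ^ j * ρ)) ≤ ENNReal.ofReal (min (2 ^ j * ρ) (1 / (2 ^ j * ρ))) := by
    apply ENNReal.ofReal_le_ofReal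
    have h3 : 1 / (2 ^ j * ρ) ≤ 1 := by rw [div_le_one (by positivity)]; linarith
    rw [min_eq_right (h3.trans hj.le)]
    gcongr; linarith
  calc _ ≤ C * ∫⁻ z, ENNReal.ofReal (1 / (1 + 2 ^ j * ρ)) * (kn 14 j (x - z) * P z) := by
        refine mul_le_mul' le_rfl (lintegral_mono fun z => ?_)
        by_cases hz : z ∈ (Metric.ball c (2 * ρ))ᶜ
        · rw [Set.indicator_of_mem hz]
          rw [Set.mem_compl_iff, Metric.mem_ball, not_lt, Real.dist_eq] at hz
          have a1 : ρ ≤ |x - z| := by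
            have := abs_sub_le z x c
            rw [abs_sub_comm z x] at this
            linarith
          rw [← mul_assoc]
          gcongr
          · exact kn_far 14 j _ ρ hρ.le a1
          · exact hFP z
        · rw [Set.indicator_of_notMem hz]; simp
    _ ≤ C * (ENNReal.ofReal (min (2 ^ j * ρ) (1 / (2 ^ j * ρ))) * (16 * τ)) := by
        rw [lintegral_const_mul' _ _ (by finiteness)]
        exact mul_le_mul' le_rfl (mul_le_mul' m1 ((hP.avg x).trans (by gcongr)))
    _ = _ := by ring

lemma I_bad (θ : SchwartzMap ℝ ℂ) : ∃ C : ℝ≥0∞, C ≠ ∞ ∧ ∀ (j : ℤ) (F : ℝ → ℂ) (P : ℝ → ℝ≥0∞), Measurable F →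
    (∀ x, ‖F x‖ₑ ≤ P x) → Slow j P → ∀ (D : Set ℝ), MeasurableSet D → ∀ x τ, P x ≤ τ →
    ‖conv (dilate θ j) (D.indicator F) x‖ₑ ≤ C * τ * ∫⁻ z in D, kn 3 j (x - z) := by
  obtain ⟨C, hC, h⟩ := conv_le θ 15
  refine ⟨C, by finiteness, fun j F P hF hFP hP D hD x τ hPx => ?_⟩
  refine (h j _ (hF.indicator hD) x).trans ?_
  rw [mul_assoc, ← lintegral_indicator hD, ← lintegral_const_mul τ (Measurable.indicator (by fun_prop) hD)]
  refine mul_le_mul' le_rfl (lintegral_mono fun z => ?_)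
  by_cases hz : z ∈ D
  · rw [Set.indicator_of_mem hz, Set.indicator_of_mem hz]
    calc _ ≤ kn (12 + 3) j (x - z) * P z := by gcongr; exact hFP z
      _ ≤ kn 3 j (x - z) * P x := hP.pt 3 x z
      _ ≤ _ := by rw [mul_comm]; gcongr
  · rw [Set.indicator_of_notMem hz]; simp

lemma I_bad_sum (O : Set ℝ) (hO : IsOpen O) (hv : volume O ≠ ∞) (J : Finset ℤ) :
    ∫⁻ x in Oᶜ, ∑ j ∈ J, ∫⁻ z in {z | (2:ℝ) ^ (-j) ≤ Metric.infDist z Oᶜ}, kn 3 j (x - z) ≤ 128 * volume O := by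
  have hne : Oᶜ.Nonempty := by
    by_contra h
    rw [Set.not_nonempty_iff_eq_empty, Set.compl_empty_iff] at h
    rw [h] at hv; simp at hv
  have hDm : ∀ j : ℤ, MeasurableSet {z | (2:ℝ) ^ (-j) ≤ Metric.infDist z Oᶜ} := fun j =>
    (isClosed_le continuous_const (Metric.continuous_infDist_pt _)).measurableSet
  have hkm : ∀ j : ℤ, Measurable (fun a : ℝ × ℝ => kn 3 j (a.1 - a.2)) := fun j => by fun_prop
  rw [lintegral_finsetSum _ (fun j _ => Measurable.lintegral_prod_right (hkm j))]
  calc _ ≤ ∑ j ∈ J, ∫⁻ z, O.indicator (fun z => 16 * ENNReal.ofReal (min (2 ^ j * Metric.infDist z Oᶜ) (1 / (2 ^ j * Metric.infDist z Oᶜ)))) z := by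
        refine Finset.sum_le_sum fun j _ => ?_
        have h2 := two_zpow_pos j
        rw [lintegral_lintegral_swap (hkm j).aemeasurable, ← lintegral_indicator (hDm j)]
        refine lintegral_mono fun z => ?_
        by_cases hz : z ∈ {z | (2:ℝ) ^ (-j) ≤ Metric.infDist z Oᶜ}
        · rw [Set.indicator_of_mem hz]
          rw [Set.mem_ofPred_eq] at hz
          set d := Metric.infDist z Oᶜ with hd
          have h2n := two_zpow_pos (-j)
          have hd0 : 0 < d := h2n.trans_le hz
          have hzO : z ∈ O := by
            by_contra hzO
            have := Metric.infDist_zero_of_mem (x := z) (s := Oᶜ) hzO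
            rw [← hd] at this; linarith
          rw [Set.indicator_of_mem hzO]
          have hj1 : 1 ≤ 2 ^ j * d := by
            have : (2:ℝ) ^ j * 2 ^ (-j) = 1 := by rw [← zpow_add₀ (by norm_num)]; simp
            nlinarith
          calc _ ≤ ∫⁻ x in Oᶜ, ENNReal.ofReal (1 / (1 + 2 ^ j * d)) * kn 2 j (x - z) := by
                refine setLIntegral_mono' hO.measurableSet.compl fun x hx => ?_
                refine kn_far 2 j _ d hd0.le ?_
                have := Metric.infDist_le_dist_of_mem (x := z) hx
                rwa [Real.dist_eq, abs_sub_comm] at this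
            _ ≤ ∫⁻ x, ENNReal.ofReal (1 / (1 + 2 ^ j * d)) * kn 2 j (x - z) := setLIntegral_le_lintegral _ _
            _ = ENNReal.ofReal (1 / (1 + 2 ^ j * d)) * ∫⁻ x, kn 2 j (x - z) := lintegral_const_mul' _ _ (by finiteness)
            _ ≤ ENNReal.ofReal (min (2 ^ j * d) (1 / (2 ^ j * d))) * 16 := by
                gcongr
                · have h3 : 1 / (2 ^ j * d) ≤ 1 := by rw [div_le_one (by positivity)]; linarith
                  rw [min_eq_right (h3.trans hj1)]
                  gcongr; linarith
                · exact kn_int' j z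
            _ = _ := mul_comm _ _
        · rw [Set.indicator_of_notMem hz]; exact zero_le
    _ = ∫⁻ z, ∑ j ∈ J, O.indicator (fun z => 16 * ENNReal.ofReal (min (2 ^ j * Metric.infDist z Oᶜ) (1 / (2 ^ j * Metric.infDist z Oᶜ)))) z := by
        rw [lintegral_finsetSum]
        intro j _
        refine Measurable.indicator ?_ hO.measurableSet
        have := (Metric.continuous_infDist_pt (Oᶜ)).measurable
        fun_prop
    _ ≤ ∫⁻ z, O.indicator (fun _ => 128) z := by
        refine lintegral_mono fun z => ?_
        by_cases hz : z ∈ O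
        · simp only [Set.indicator_of_mem hz]
          have hd : 0 < Metric.infDist z Oᶜ :=
            (hO.isClosed_compl.notMem_iff_infDist_pos hne).1 (by simpa using hz)
          rw [← Finset.mul_sum]
          calc _ ≤ (16:ℝ≥0∞) * 8 := by
                gcongr; exact (ENNReal.sum_le_tsum J).trans (sum_min _ hd)
            _ = 128 := by norm_num
        · simp [Set.indicator_of_notMem hz]
    _ = _ := by rw [lintegral_indicator hO.measurableSet]; simp

lemma I_good (J : Finset ℤ) (P : ℤ → ℝ → ℝ≥0∞) (hPm : ∀ j, Measurable (P j)) (hP : ∀ j, Slow j (P j))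
    (c ρ : ℝ) (hρ : 0 < ρ) (τ : ℝ≥0∞) (hJ : ∀ j ∈ J, 1 < (2:ℝ) ^ j * ρ) (J' : Finset ℤ) (hJJ : J ⊆ J')
    (B : Set ℝ) (hBm : MeasurableSet B) (hB : ∀ x ∈ Metric.ball c (4 * ρ), x ∉ B → l2 J' (fun j => P j x) ≤ τ)
    (O : Set ℝ) (hO : O = {x | 1 / 2 < MF (B.indicator 1) x}) (hne : Oᶜ.Nonempty) :
    ∑ j ∈ J, ∫⁻ z in Metric.ball c (2 * ρ) ∩ {z | (2:ℝ) ^ (-j) ≤ Metric.infDist z Oᶜ}ᶜ, P j z ^ 2 ≤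
      2 ^ 33 * τ ^ 2 * ENNReal.ofReal ρ := by
  set A : Set ℝ := Metric.ball c (4 * ρ) \ B with hA
  have hAm : MeasurableSet A := Metric.isOpen_ball.measurableSet.diff hBm
  have key : ∀ j ∈ J, ∀ z ∈ Metric.ball c (2 * ρ) ∩ {z | (2:ℝ) ^ (-j) ≤ Metric.infDist z Oᶜ}ᶜ,
      P j z ^ 2 ≤ 2 ^ 26 * ∫⁻ y, kn 2 j (z - y) * A.indicator (fun y => P j y ^ 2) y := by
    intro j hj z hz
    obtain ⟨hz1, hz2⟩ := hz
    have hjρ := hJ j hj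
    have h2 := two_zpow_pos j
    have h2n := two_zpow_pos (-j)
    have hmul : (2:ℝ) ^ j * 2 ^ (-j) = 1 := by rw [← zpow_add₀ (by norm_num)]; simp
    have hr : (2:ℝ) ^ (-j) < ρ := by nlinarith
    rw [Set.mem_compl_iff, Set.mem_ofPred_eq, not_le, Metric.infDist_lt_iff hne] at hz2
    obtain ⟨y, hy, hzy⟩ := hz2
    rw [hO, Set.mem_compl_iff, Set.mem_ofPred_eq, not_lt] at hy
    set b := Metric.ball z ((2:ℝ) ^ (-j)) with hb
    have hbm : MeasurableSet b := Metric.isOpen_ball.measurableSet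
    have v1 : volume (B ∩ b) ≤ ENNReal.ofReal (2 ^ (-j)) := by
      have h3 : ∫⁻ y in b, B.indicator 1 y = volume (B ∩ b) := by
        rw [lintegral_indicator_one hBm, Measure.restrict_apply hBm]
      rw [← h3]
      refine (lintegral_ball_le_MF (x := y) _ (by rwa [Metric.mem_ball, dist_comm])).trans ?_
      refine (mul_le_mul' le_rfl hy).trans ?_
      rw [mul_comm 2, ENNReal.ofReal_mul h2n.le, mul_assoc]
      simp [ENNReal.mul_inv_cancel]
    have hbI : b ⊆ Metric.ball c (4 * ρ) := by
      refine Metric.ball_subset_ball' ?_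
      rw [Metric.mem_ball] at hz1; linarith
    have v2 : ENNReal.ofReal (2 ^ (-j)) ≤ volume (A ∩ b) := by
      have h4 : volume b ≤ volume (A ∩ b) + volume (B ∩ b) := by
        refine (measure_mono ?_).trans (measure_union_le _ _)
        intro u hu
        by_cases huB : u ∈ B
        · exact Or.inr ⟨huB, hu⟩
        · exact Or.inl ⟨⟨hbI hu, huB⟩, hu⟩
      rw [hb, Real.volume_ball, two_mul, ENNReal.ofReal_add h2n.le h2n.le, ← hb] at h4
      have h5 := h4.trans (add_le_add le_rfl v1)
      exact (ENNReal.add_le_add_iff_right (by finiteness)).1 h5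
    have v3 : ∀ y, (A ∩ b).indicator (fun _ => P j z ^ 2 * ENNReal.ofReal (2 ^ j)) y ≤
        2 ^ 26 * (kn 2 j (z - y) * A.indicator (fun y => P j y ^ 2) y) := by
      intro y
      by_cases hy : y ∈ A ∩ b
      · rw [Set.indicator_of_mem hy, Set.indicator_of_mem hy.1]
        have hd : |z - y| < 2 ^ (-j) := by
          have := hy.2; rwa [hb, Metric.mem_ball, dist_comm, Real.dist_eq] at this
        have hw : 1 + 2 ^ j * |z - y| ≤ 2 := by nlinarith
        have hw0 := om_pos j (z - y)
        have w1 : P j z ≤ 2 ^ 12 * P j y := by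
          refine (hP j z y).trans ?_
          gcongr
          rw [show (2:ℝ≥0∞) ^ 12 = ENNReal.ofReal (2 ^ 12) by norm_num]
          apply ENNReal.ofReal_le_ofReal
          exact pow_le_pow_left₀ (by linarith) hw _
        have w2 : ENNReal.ofReal (2 ^ j) ≤ 2 ^ 2 * kn 2 j (z - y) := by
          unfold kn
          rw [show (2:ℝ≥0∞) ^ 2 = ENNReal.ofReal (2 ^ 2) by norm_num, ← ENNReal.ofReal_mul (by norm_num)]
          apply ENNReal.ofReal_le_ofReal
          rw [mul_div_assoc', le_div_iff₀ (by positivity), mul_comm]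
          gcongr
        calc _ ≤ (2 ^ 12 * P j y) ^ 2 * (2 ^ 2 * kn 2 j (z - y)) := by gcongr
          _ = _ := by ring
      · rw [Set.indicator_of_notMem hy]; exact zero_le
    have v4 := lintegral_mono v3 (μ := volume)
    rw [lintegral_const_mul' _ _ (by finiteness), lintegral_indicator (hAm.inter hbm), setLIntegral_const] at v4
    refine le_trans ?_ v4
    rw [mul_assoc]
    calc P j z ^ 2 = P j z ^ 2 * (ENNReal.ofReal (2 ^ j) * ENNReal.ofReal (2 ^ (-j))) := by
          rw [← ENNReal.ofReal_mul h2.le, hmul]; simp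
      _ ≤ _ := by gcongr
  calc _ ≤ ∑ j ∈ J, 2 ^ 30 * ∫⁻ y in A, P j y ^ 2 := by
        refine Finset.sum_le_sum fun j hj => ?_
        have hAi : Measurable (A.indicator (fun y => P j y ^ 2)) := ((hPm j).pow_const 2).indicator hAm
        calc _ ≤ ∫⁻ z in Metric.ball c (2 * ρ) ∩ {z | (2:ℝ) ^ (-j) ≤ Metric.infDist z Oᶜ}ᶜ,
              2 ^ 26 * ∫⁻ y, kn 2 j (z - y) * A.indicator (fun y => P j y ^ 2) y := by
              refine setLIntegral_mono' ?_ (key j hj)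
              exact Metric.isOpen_ball.measurableSet.inter
                (isClosed_le continuous_const (Metric.continuous_infDist_pt _)).measurableSet.compl
          _ ≤ ∫⁻ z, 2 ^ 26 * ∫⁻ y, kn 2 j (z - y) * A.indicator (fun y => P j y ^ 2) y := setLIntegral_le_lintegral _ _
          _ = 2 ^ 26 * ∫⁻ y, ∫⁻ z, kn 2 j (z - y) * A.indicator (fun y => P j y ^ 2) y := by
              rw [lintegral_const_mul' _ _ (by finiteness), lintegral_lintegral_swap]
              exact Measurable.aemeasurable (by fun_prop)
          _ ≤ 2 ^ 26 * ∫⁻ y, 16 * A.indicator (fun y => P j y ^ 2) y := by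
              gcongr with y
              rw [lintegral_mul_const _ (by fun_prop)]
              gcongr
              exact kn_int' j y
          _ = _ := by
              rw [lintegral_const_mul' _ _ (by finiteness), lintegral_indicator hAm, ← mul_assoc]; norm_num
    _ = 2 ^ 30 * ∫⁻ y in A, ∑ j ∈ J, P j y ^ 2 := by
        rw [← Finset.mul_sum, lintegral_finsetSum _ (fun j _ => (hPm j).pow_const 2)]
    _ ≤ 2 ^ 30 * ∫⁻ y in A, τ ^ 2 := by
        gcongr 2 ^ 30 * ?_
        refine setLIntegral_mono' hAm fun y hy => ?_
        calc _ ≤ ∑ j ∈ J', P j y ^ 2 := Finset.sum_le_sum_of_subset hJJ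
          _ = l2 J' (fun j => P j y) ^ 2 := (l2_sq _ _).symm
          _ ≤ _ := by gcongr; exact hB y hy.1 hy.2
    _ ≤ 2 ^ 30 * (τ ^ 2 * ENNReal.ofReal (2 * (4 * ρ))) := by
        rw [setLIntegral_const]
        gcongr
        refine (measure_mono Set.sdiff_subset).trans (by rw [Real.volume_ball])
    _ = _ := by
        rw [show 2 * (4 * ρ) = 2 ^ 3 * ρ by ring, ENNReal.ofReal_mul (by norm_num),
          show ENNReal.ofReal (2 ^ 3) = 2 ^ 3 by norm_num]; ring



/-- maximal partial sums -/
def Hs (J : Finset ℤ) (F : ℤ → ℝ → ℂ) (x : ℝ) : ℝ≥0∞ := ⨆ n : ℤ, ‖∑ j ∈ J.filter (· ≤ n), F j x‖ₑ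

lemma Hs_meas (J : Finset ℤ) {F : ℤ → ℝ → ℂ} (h : ∀ j, Measurable (F j)) : Measurable (Hs J F) := by
  unfold Hs
  refine Measurable.iSup fun n => ?_
  exact (Finset.measurable_sum _ (fun j _ => h j)).enorm

lemma Hs_le_sum (J : Finset ℤ) (F : ℤ → ℝ → ℂ) (x : ℝ) : Hs J F x ≤ ∑ j ∈ J, ‖F j x‖ₑ := by
  refine iSup_le fun n => (enorm_sum_le _ _).trans ?_
  exact Finset.sum_le_sum_of_subset (Finset.filter_subset _ _)

/-- admissible families -/
structure Adm (θ : SchwartzMap ℝ ℂ) (F : ℤ → ℝ → ℂ) (P : ℤ → ℝ → ℝ≥0∞) : Prop where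
  tame : ∀ j, Tame (F j)
  le : ∀ j x, ‖F j x‖ₑ ≤ P j x
  slow : ∀ j, Slow j (P j)
  meas : ∀ j, Measurable (P j)
  rep : ∀ j x, conv (dilate θ j) (F j) x = F j x

lemma Hs_compare (J : Finset ℤ) (F : ℤ → ℝ → ℂ) (p : ℤ → Prop) [DecidablePred p] (x x' : ℝ) (E E' : ℝ≥0∞)
    (h : ∀ n : ℤ, ‖∑ j ∈ (J.filter p).filter (· ≤ n), F j x‖ₑ ≤ E)
    (h' : ∀ n : ℤ, ‖∑ j ∈ (J.filter p).filter (· ≤ n), F j x'‖ₑ ≤ E') :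
    Hs J F x ≤ Hs J F x' + (∑ j ∈ J.filter (fun j => ¬ p j), ‖F j x - F j x'‖ₑ) + E + E' := by
  refine iSup_le fun n => ?_
  have e : ∀ y, ∑ j ∈ J.filter (· ≤ n), F j y = ∑ j ∈ (J.filter p).filter (· ≤ n), F j y +
      ∑ j ∈ (J.filter (fun j => ¬ p j)).filter (· ≤ n), F j y := by
    intro y
    rw [← Finset.sum_filter_add_sum_filter_not (J.filter (· ≤ n)) p]
    congr 1
    · refine Finset.sum_congr ?_ fun _ _ => rfl
      ext; simp; tauto
    · refine Finset.sum_congr ?_ fun _ _ => rfl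
      ext; simp; tauto
  have e2 : ∑ j ∈ J.filter (· ≤ n), F j x = ∑ j ∈ J.filter (· ≤ n), F j x' +
      ∑ j ∈ (J.filter (fun j => ¬ p j)).filter (· ≤ n), (F j x - F j x') +
      ∑ j ∈ (J.filter p).filter (· ≤ n), F j x - ∑ j ∈ (J.filter p).filter (· ≤ n), F j x' := by
    rw [e x, e x', Finset.sum_sub_distrib]; ring
  rw [e2]
  refine (enorm_sub_le).trans ?_
  refine add_le_add ((enorm_add_le _ _).trans ?_) (h' n)
  refine add_le_add ((enorm_add_le _ _).trans ?_) (h n)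
  refine add_le_add (le_iSup (fun n : ℤ => ‖∑ j ∈ J.filter (· ≤ n), F j x'‖ₑ) n) ((enorm_sum_le _ _).trans ?_)
  exact Finset.sum_le_sum_of_subset (Finset.filter_subset _ _)

lemma I_local (M : ℕ) (θ : SchwartzMap ℝ ℂ) (hθ : Ann M θ) : ∃ C : ℝ≥0∞, C ≠ ∞ ∧
    ∀ (J : Finset ℤ) (F : ℤ → ℝ → ℂ) (P : ℤ → ℝ → ℝ≥0∞), Adm θ F P → ∀ (c ρ : ℝ), 0 < ρ →
    ∀ (δ t : ℝ≥0∞), δ ≠ 0 → δ ≠ ∞ → t ≠ 0 → t ≠ ∞ → ∃ Z : Set ℝ,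
      volume Z ≤ C * ((1 + δ) * volume (Metric.ball c (4 * ρ) ∩ {x | δ * t < l2 J (fun j => P j x)}) +
        δ ^ 2 * ENNReal.ofReal ρ) ∧
      ∀ x ∈ Metric.ball c ρ, ∀ x' ∈ Metric.ball c ρ, x ∉ Z → x' ∉ Z →
        Hs J F x ≤ Hs J F x' + 4 * t + C * δ * t := by
  obtain ⟨Cl, hCl, hl⟩ := I_low θ
  obtain ⟨Cf, hCf, hf⟩ := I_far θ
  obtain ⟨Cb, hCb, hb⟩ := I_bad θ
  obtain ⟨C3, hC3, h3⟩ := E3 M θ hθ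
  refine ⟨9 + Cb * 128 * 8 + C3 * 2 ^ 33 + 8 * Cl + 16 * Cf, by finiteness,
    fun J F P hA c ρ hρ δ t hδ0 hδt ht0 htt => ?_⟩
  set K : ℝ≥0∞ := 9 + Cb * 128 * 8 + C3 * 2 ^ 33 + 8 * Cl + 16 * Cf with hK
  have K1 : 9 ≤ K := by
    rw [hK, add_assoc, add_assoc, add_assoc]; exact le_self_add
  have K2 : C3 * 2 ^ 33 ≤ K := by
    rw [hK, add_assoc]; exact le_add_self.trans le_self_add
  have K3 : Cb * 128 * 8 ≤ K := by
    rw [hK, add_assoc, add_assoc]; exact le_add_self.trans le_self_add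
  have K4 : 8 * Cl + 16 * Cf ≤ K := by
    rw [hK, add_assoc]; exact le_add_self
  set τ := δ * t with hτ
  set B : Set ℝ := Metric.ball c (4 * ρ) ∩ {x | τ < l2 J (fun j => P j x)} with hB
  have hBm : MeasurableSet B := Metric.isOpen_ball.measurableSet.inter
    (measurableSet_lt measurable_const (l2_meas J hA.meas))
  have hBt : volume B ≠ ∞ :=
    ne_top_of_le_ne_top (by rw [Real.volume_ball]; finiteness) (measure_mono (Set.inter_subset_left (s := Metric.ball c (4 * ρ))))
  set O : Set ℝ := {x | 1 / 2 < MF (B.indicator 1) x} with hO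
  have hOo : IsOpen O := isOpen_MF _ _
  have hOv : volume O ≤ 8 * volume B := by
    have := MF_weak (B.indicator 1) (1/2) (by norm_num) (by norm_num)
    rw [lintegral_indicator_one hBm, ← hO] at this
    calc volume O = 2 * (1 / 2 * volume O) := by rw [← mul_assoc, one_div, ENNReal.mul_inv_cancel (by norm_num) (by norm_num), one_mul]
      _ ≤ 2 * (4 * volume B) := by gcongr
      _ = _ := by rw [← mul_assoc]; norm_num
  have hOt : volume O ≠ ∞ := ne_top_of_le_ne_top (by finiteness) hOv
  have hne : Oᶜ.Nonempty := by
    by_contra h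
    rw [Set.not_nonempty_iff_eq_empty, Set.compl_empty_iff] at h
    rw [h] at hOt; simp at hOt
  set Jh := J.filter (fun j => 1 < (2:ℝ) ^ j * ρ) with hJh
  have hJhJ : Jh ⊆ J := Finset.filter_subset _ _
  set I := Metric.ball c (2 * ρ) with hI
  have hIm : MeasurableSet I := Metric.isOpen_ball.measurableSet
  set D : ℤ → Set ℝ := fun j => {z | (2:ℝ) ^ (-j) ≤ Metric.infDist z Oᶜ} with hD
  have hDm : ∀ j : ℤ, MeasurableSet (D j) := fun j =>
    (isClosed_le continuous_const (Metric.continuous_infDist_pt _)).measurableSet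
  have hnB : ∀ x ∈ Metric.ball c (4 * ρ), x ∉ B → l2 J (fun j => P j x) ≤ τ := by
    intro x hx hxB
    by_contra h
    exact hxB ⟨hx, not_le.1 h⟩
  have hgood := I_good Jh P hA.meas hA.slow c ρ hρ τ (fun j hj => (Finset.mem_filter.1 hj).2) J hJhJ B hBm hnB O hO hne
  set v : ℤ → ℝ → ℂ := fun j => (I ∩ (D j)ᶜ).indicator (F j) with hv
  set u : ℤ → ℝ → ℂ := fun j => (I ∩ D j).indicator (F j) with hu
  set w : ℤ → ℝ → ℂ := fun j => Iᶜ.indicator (F j) with hw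
  have Tv : ∀ j, Tame (v j) := fun j => (hA.tame j).indicator (hIm.inter (hDm j).compl)
  have Tu : ∀ j, Tame (u j) := fun j => (hA.tame j).indicator (hIm.inter (hDm j))
  have Tw : ∀ j, Tame (w j) := fun j => (hA.tame j).indicator hIm.compl
  have dec : ∀ j, F j = fun x => v j x + (u j x + w j x) := by
    intro j; ext x
    simp only [hv, hu, hw]
    by_cases h1 : x ∈ I <;> by_cases h2 : x ∈ D j <;> simp [h1, h2]
  have hvn : ∀ j, ∫⁻ x, ‖v j x‖ₑ ^ 2 ≤ ∫⁻ z in I ∩ (D j)ᶜ, P j z ^ 2 := by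
    intro j
    rw [← lintegral_indicator (hIm.inter (hDm j).compl)]
    refine lintegral_mono fun z => ?_
    simp only [hv]
    by_cases hz : z ∈ I ∩ (D j)ᶜ
    · rw [Set.indicator_of_mem hz, Set.indicator_of_mem hz]; gcongr; exact hA.le j z
    · rw [Set.indicator_of_notMem hz]; simp
  set V := Hs Jh (fun j x => conv (dilate θ j) (v j) x) with hV
  have hVm : Measurable V := Hs_meas Jh (fun j => conv_meas θ j (Tv j).1)
  have hV2 : ∫⁻ x, V x ^ 2 ≤ C3 * (2 ^ 33 * τ ^ 2 * ENNReal.ofReal ρ) := by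
    refine (h3 Jh v (fun j => (Tv j).1) (fun j hj => ?_)).trans ?_
    · refine ne_top_of_le_ne_top ?_ ((hvn j).trans ((Finset.single_le_sum (f := fun j => ∫⁻ z in I ∩ (D j)ᶜ, P j z ^ 2)
        (fun _ _ => zero_le) hj).trans hgood))
      rw [hτ]; finiteness
    · gcongr
      exact (Finset.sum_le_sum fun j _ => hvn j).trans hgood
  set R : ℝ → ℝ≥0∞ := fun x => ∑ j ∈ Jh, ∫⁻ z in D j, kn 3 j (x - z) with hR
  have hRm : Measurable R := by
    refine Finset.measurable_sum _ fun j _ => ?_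
    have hkm : Measurable (fun a : ℝ × ℝ => kn 3 j (a.1 - a.2)) := by fun_prop
    exact Measurable.lintegral_prod_right hkm
  have hR2 : ∫⁻ x in Oᶜ, R x ≤ 128 * volume O := I_bad_sum O hOo hOt Jh
  refine ⟨B ∪ O ∪ {x | t ≤ V x} ∪ {x | t ≤ Oᶜ.indicator (fun x => Cb * τ * R x) x}, ?_, ?_⟩
  · have z1 : volume {x | t ≤ V x} ≤ C3 * 2 ^ 33 * (δ ^ 2 * ENNReal.ofReal ρ) := by
      have c1 := mul_meas_ge_le_lintegral (μ := volume) (hVm.pow_const 2) (t ^ 2)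
      have c2 : {x | t ^ 2 ≤ V x ^ 2} = {x | t ≤ V x} := by
        ext x; simp only [Set.mem_ofPred_eq]; exact ENNReal.pow_le_pow_left_iff (by norm_num)
      rw [c2] at c1
      rw [← ENNReal.mul_le_mul_iff_right (a := t ^ 2) (by positivity) (by finiteness)]
      refine (c1.trans hV2).trans (le_of_eq ?_)
      rw [hτ]; ring
    have z2 : volume {x | t ≤ Oᶜ.indicator (fun x => Cb * τ * R x) x} ≤ Cb * 128 * 8 * (δ * volume B) := by
      have c1 := mul_meas_ge_le_lintegral (μ := volume) ((hRm.const_mul (Cb * τ)).indicator hOo.measurableSet.compl) t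
      rw [← ENNReal.mul_le_mul_iff_right (a := t) ht0 htt]
      refine c1.trans ?_
      rw [lintegral_indicator hOo.measurableSet.compl, lintegral_const_mul _ hRm]
      calc _ ≤ Cb * τ * (128 * (8 * volume B)) := by gcongr; exact hR2.trans (by gcongr)
        _ = _ := by rw [hτ]; ring
    calc _ ≤ volume B + volume O + volume {x | t ≤ V x} + volume {x | t ≤ Oᶜ.indicator (fun x => Cb * τ * R x) x} := by
          refine (measure_union_le _ _).trans ?_
          gcongr
          refine (measure_union_le _ _).trans ?_
          gcongr
          exact measure_union_le _ _
      _ ≤ volume B + 8 * volume B + C3 * 2 ^ 33 * (δ ^ 2 * ENNReal.ofReal ρ) + Cb * 128 * 8 * (δ * volume B) := by gcongr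
      _ = 9 * volume B + C3 * 2 ^ 33 * (δ ^ 2 * ENNReal.ofReal ρ) + Cb * 128 * 8 * (δ * volume B) := by ring
      _ ≤ K * volume B + K * (δ ^ 2 * ENNReal.ofReal ρ) + K * (δ * volume B) := by
          gcongr
      _ = _ := by ring
  · have aux : ∀ x ∈ Metric.ball c ρ, x ∉ B ∪ O ∪ {x | t ≤ V x} ∪ {x | t ≤ Oᶜ.indicator (fun x => Cb * τ * R x) x} →
        (∀ j ∈ J, P j x ≤ τ) ∧ ∀ n : ℤ, ‖∑ j ∈ Jh.filter (· ≤ n), F j x‖ₑ ≤ t + (t + Cf * τ * 8) := by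
      intro x hx hxZ
      simp only [Set.mem_union, not_or, Set.mem_ofPred_eq, not_le] at hxZ
      obtain ⟨⟨⟨x1, x2⟩, x3⟩, x4⟩ := hxZ
      have hxP : ∀ j ∈ J, P j x ≤ τ := fun j hj =>
        (le_l2 (fun j => P j x) hj).trans (hnB x (Metric.ball_subset_ball (by linarith) hx) x1)
      refine ⟨hxP, fun n => ?_⟩
      rw [Set.indicator_of_mem (show x ∈ Oᶜ from x2)] at x4
      have e : ∑ j ∈ Jh.filter (· ≤ n), F j x = ∑ j ∈ Jh.filter (· ≤ n), conv (dilate θ j) (v j) x +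
          (∑ j ∈ Jh.filter (· ≤ n), conv (dilate θ j) (u j) x + ∑ j ∈ Jh.filter (· ≤ n), conv (dilate θ j) (w j) x) := by
        rw [← Finset.sum_add_distrib, ← Finset.sum_add_distrib]
        refine Finset.sum_congr rfl fun j _ => ?_
        rw [← hA.rep j x, ← conv_add θ j (Tu j) (Tw j), ← conv_add θ j (Tv j) ((Tu j).add (Tw j)), ← dec j]
      rw [e]
      refine (enorm_add_le _ _).trans (add_le_add ?_ ((enorm_add_le _ _).trans (add_le_add ?_ ?_)))
      · exact (le_iSup (fun n : ℤ => ‖∑ j ∈ Jh.filter (· ≤ n), conv (dilate θ j) (v j) x‖ₑ) n).trans x3.le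
      · refine le_trans ?_ x4.le
        refine (enorm_sum_le _ _).trans ?_
        refine (Finset.sum_le_sum_of_subset (Finset.filter_subset _ _)).trans ?_
        rw [hR, Finset.mul_sum]
        refine Finset.sum_le_sum fun j hj => ?_
        refine (hb j (F j) (P j) (hA.tame j).1 (hA.le j) (hA.slow j) _ (hIm.inter (hDm j)) x τ (hxP j (hJhJ hj))).trans ?_
        gcongr
        exact Set.inter_subset_right
      · refine (enorm_sum_le _ _).trans ?_
        refine (Finset.sum_le_sum_of_subset (Finset.filter_subset _ _)).trans ?_
        calc _ ≤ ∑ j ∈ Jh, Cf * τ * ENNReal.ofReal (min (2 ^ j * ρ) (1 / (2 ^ j * ρ))) := by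
              refine Finset.sum_le_sum fun j hj => ?_
              exact hf j (F j) (P j) (hA.tame j).1 (hA.le j) (hA.slow j) c ρ x τ hx (Finset.mem_filter.1 hj).2 (hxP j (hJhJ hj))
          _ ≤ _ := by
              rw [← Finset.mul_sum]; gcongr
              exact (ENNReal.sum_le_tsum _).trans (sum_min ρ hρ)
    intro x hx x' hx' hxZ hx'Z
    obtain ⟨p1, q1⟩ := aux x hx hxZ
    obtain ⟨p2, q2⟩ := aux x' hx' hx'Z
    have hxx : |x - x'| ≤ 2 * ρ := by
      rw [Metric.mem_ball, Real.dist_eq] at hx hx'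
      have h2 := abs_sub_le x c x'
      rw [abs_sub_comm c x'] at h2
      linarith
    have low : ∑ j ∈ J.filter (fun j => ¬ 1 < (2:ℝ) ^ j * ρ), ‖F j x - F j x'‖ₑ ≤ Cl * τ * 8 := by
      calc _ ≤ ∑ j ∈ J.filter (fun j => ¬ 1 < (2:ℝ) ^ j * ρ), Cl * τ * ENNReal.ofReal (min (2 ^ j * ρ) (1 / (2 ^ j * ρ))) := by
            refine Finset.sum_le_sum fun j hj => ?_
            rw [Finset.mem_filter, not_lt] at hj
            exact hl j (F j) (P j) (hA.tame j) (hA.le j) (hA.slow j) (hA.rep j) x x' τ ρ hρ hj.2 hxx (p1 j hj.1) (p2 j hj.1)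
        _ ≤ _ := by
            rw [← Finset.mul_sum]; gcongr
            exact (ENNReal.sum_le_tsum _).trans (sum_min ρ hρ)
    refine (Hs_compare J F (fun j => 1 < (2:ℝ) ^ j * ρ) x x' _ _ q1 q2).trans ?_
    calc _ ≤ Hs J F x' + Cl * τ * 8 + (t + (t + Cf * τ * 8)) + (t + (t + Cf * τ * 8)) := by gcongr
      _ = Hs J F x' + 4 * t + (8 * Cl + 16 * Cf) * δ * t := by rw [hτ]; ring
      _ ≤ _ := by
        gcongr

lemma thmI (M : ℕ) (θ : SchwartzMap ℝ ℂ) (hθ : Ann M θ) (r : ℝ) (hr : 0 < r) : ∃ C : ℝ≥0∞, C ≠ ∞ ∧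
    ∀ (J : Finset ℤ) (F : ℤ → ℝ → ℂ) (P : ℤ → ℝ → ℝ≥0∞), Adm θ F P → ∫⁻ x, Hs J F x ^ r ≠ ∞ →
    ∫⁻ x, Hs J F x ^ r ≤ C * ∫⁻ x, (l2 J (fun j => P j x)) ^ r := by
  obtain ⟨ε, hε0, hε1, hgl⟩ := good_lambda r hr
  obtain ⟨C0, hC0, h0⟩ := I_local M θ hθ
  obtain ⟨C2, hC2, h2⟩ := MF_strong 2 (by norm_num)
  set s : ℝ := r / 2 with hs
  have hs0 : 0 < s := by positivity
  set ε' := ENNReal.ofReal ε with hε'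
  have hε'0 : ε' ≠ 0 := by simp [hε', hε0]
  have hε't : ε' ≠ ∞ := by simp [hε']
  have hε'1 : ε' ≤ 1 := by simp [hε', hε1.le]
  set G : ℝ≥0∞ := 32 * (C0 + 1) with hG
  have hGt : G ≠ ∞ := by rw [hG]; finiteness
  have hG0 : G ≠ 0 := by rw [hG]; simp
  set δ : ℝ≥0∞ := ε' / G with hδ
  have hδG : G * δ = ε' := by rw [mul_comm]; exact ENNReal.div_mul_cancel hG0 hGt
  have hδ0 : δ ≠ 0 := by rw [hδ]; simp [hε'0, hGt]
  have hδt : δ ≠ ∞ := by rw [hδ]; exact ENNReal.div_ne_top hε't hG0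
  have hC0G : 32 * C0 ≤ G := by rw [hG]; gcongr; exact le_self_add
  have h32G : 32 ≤ G := by rw [hG]; calc (32:ℝ≥0∞) = 32 * 1 := by ring
                                      _ ≤ _ := by gcongr; exact le_add_self
  have hC0δ : 32 * C0 * δ ≤ ε' := by rw [← hδG]; gcongr
  have h32δ : 32 * δ ≤ ε' := by rw [← hδG]; gcongr
  have hδ1 : δ ≤ 1 := by
    calc δ = 1 * δ := (one_mul _).symm
      _ ≤ 32 * δ := by gcongr; norm_num
      _ ≤ 1 := h32δ.trans hε'1
  set η : ℝ≥0∞ := δ ^ (1 / s) with hη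
  have hηs : η ^ s = δ := by rw [hη, ← ENNReal.rpow_mul]; field_simp; simp
  have hη0 : η ≠ 0 := by rw [hη]; simp [hδ0, hδt]
  have hηt : η ≠ ∞ := by rw [hη]; finiteness
  set γ : ℝ≥0∞ := δ * η / 8 with hγ
  have hγ8 : γ * 8 = δ * η := ENNReal.div_mul_cancel (by norm_num) (by norm_num)
  obtain ⟨C, hC, hgl⟩ := hgl γ (by rw [hγ]; simp [hδ0, hη0]) (by rw [hγ]; finiteness)
  refine ⟨C * C2, by finiteness, fun J F P hA hfin => ?_⟩
  set S : ℝ → ℝ≥0∞ := fun x => l2 J (fun j => P j x) with hS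
  have hSm : Measurable S := l2_meas J hA.meas
  have main := hgl (Hs J F) (fun x => (MF (fun y => S y ^ s) x) ^ (1 / s)) (Hs_meas J fun j => (hA.tame j).1)
    ((measurable_MF _).pow_const _) ?_ hfin
  · refine main.trans ?_
    rw [mul_assoc]; gcongr
    have := h2 (fun y => S y ^ s) (hSm.pow_const _)
    have e1 : ∀ a : ℝ≥0∞, (a ^ (1/s)) ^ r = a ^ (2:ℝ) := fun a => by
      rw [← ENNReal.rpow_mul]; congr 1; rw [hs]; field_simp
    have e2 : ∀ a : ℝ≥0∞, (a ^ s) ^ (2:ℝ) = a ^ r := fun a => by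
      rw [← ENNReal.rpow_mul]; congr 1; rw [hs]; field_simp
    simp_rw [e1]
    simp_rw [e2] at this
    exact this
  · intro k c ρ hρ x1 hx1 hK
    have h2k0 : (2:ℝ≥0∞) ^ k ≠ 0 := (ENNReal.zpow_pos (by norm_num) (by norm_num) k).ne'
    have h2kt : (2:ℝ≥0∞) ^ k ≠ ∞ := ENNReal.zpow_ne_top (by norm_num) (by norm_num) k
    set t : ℝ≥0∞ := 2 ^ k / 8 with ht
    have ht0 : t ≠ 0 := by rw [ht]; simp [h2k0]
    have htt : t ≠ ∞ := by rw [ht]; exact ENNReal.div_ne_top h2kt (by norm_num)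
    have ht8 : t * 8 = 2 ^ k := ENNReal.div_mul_cancel (by norm_num) (by norm_num)
    obtain ⟨Z, hZ, hcmp⟩ := h0 J F P hA c ρ hρ δ t hδ0 hδt ht0 htt
    set B := Metric.ball c (4 * ρ) ∩ {x | δ * t < l2 J (fun j => P j x)} with hB
    have hMF : MF (fun y => S y ^ s) x1 ≤ (δ * t) ^ s * δ := by
      calc _ = (MF (fun y => S y ^ s) x1 ^ (1 / s)) ^ s := by rw [← ENNReal.rpow_mul]; field_simp; simp
        _ ≤ (γ * 2 ^ k) ^ s := ENNReal.rpow_le_rpow hK hs0.le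
        _ = (δ * t * η) ^ s := by rw [← ht8, show γ * (t * 8) = (γ * 8) * t by ring, hγ8]; congr 1; ring
        _ = _ := by rw [ENNReal.mul_rpow_of_nonneg _ _ hs0.le, hηs]
    have hBv : volume B ≤ 8 * ENNReal.ofReal ρ * δ := by
      have a0 : (δ * t) ^ s ≠ 0 := by
        have : δ * t ≠ 0 := mul_ne_zero hδ0 ht0
        have h3 : δ * t ≠ ∞ := by finiteness
        simp [this, h3]
      have at' : (δ * t) ^ s ≠ ∞ := ENNReal.rpow_ne_top_of_nonneg hs0.le (by finiteness)
      rw [← ENNReal.mul_le_mul_iff_right a0 at']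
      have i1 : ∫⁻ y in Metric.ball c (4 * ρ), S y ^ s ≤ _ :=
        lintegral_ball_le_MF (fun y => S y ^ s) (Metric.ball_subset_ball (by linarith) hx1)
      calc (δ * t) ^ s * volume B = ∫⁻ y in B, (δ * t) ^ s := (setLIntegral_const _ _).symm
        _ ≤ ∫⁻ y in B, S y ^ s := by
            refine setLIntegral_mono (hSm.pow_const _) fun y hy => ?_
            exact ENNReal.rpow_le_rpow (le_of_lt hy.2) hs0.le
        _ ≤ ∫⁻ y in Metric.ball c (4 * ρ), S y ^ s := lintegral_mono_set Set.inter_subset_left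
        _ ≤ ENNReal.ofReal (2 * (4 * ρ)) * ((δ * t) ^ s * δ) := by
            refine i1.trans ?_
            gcongr
        _ = _ := by
            rw [show 2 * (4 * ρ) = 8 * ρ by ring, ENNReal.ofReal_mul (by norm_num)]; norm_num; ring
    refine ⟨Z, ?_, ?_⟩
    · refine hZ.trans ?_
      calc _ ≤ C0 * ((1 + 1) * (8 * ENNReal.ofReal ρ * δ) + (δ * 1) * ENNReal.ofReal ρ) := by
            rw [sq]; gcongr
        _ = (17 * C0 * δ) * ENNReal.ofReal ρ := by ring
        _ ≤ (32 * C0 * δ) * ENNReal.ofReal ρ := by gcongr; norm_num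
        _ ≤ ε' * ENNReal.ofReal ρ := by gcongr
        _ = _ := by rw [ENNReal.ofReal_mul hε0.le]
    · intro x hx x' hx' hxZ hx'Z
      refine (hcmp x hx x' hx' hxZ hx'Z).trans ?_
      have : C0 * δ ≤ 4 := by
        calc C0 * δ = 1 * C0 * δ := by ring
          _ ≤ 32 * C0 * δ := by gcongr; norm_num
          _ ≤ 1 := hC0δ.trans hε'1
          _ ≤ 4 := by norm_num
      calc _ ≤ Hs J F x' + 4 * t + 4 * t := by gcongr
        _ = _ := by rw [← ht8]; ring



/-- symmetric block of integers -/
def blk (L : ℕ) : Finset ℤ := Finset.Ioc (-(L:ℤ)) L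

lemma cs_l2 (J : Finset ℤ) (a b : ℤ → ℝ≥0∞) : ∑ j ∈ J, a j * b j ≤ l2 J a * l2 J b := by
  have := ENNReal.inner_le_Lp_mul_Lq J a b (p := 2) (q := 2) (by constructor <;> norm_num)
  simpa [l2] using this

lemma cs_shift (J : Finset ℤ) (a b : ℤ → ℂ) (s : ℤ) :
    ∑ j ∈ J, ‖(if j - s ∈ J then a (j - s) else 0) * b j‖ₑ ≤ l2 J (fun j => ‖a j‖ₑ) * l2 J (fun j => ‖b j‖ₑ) := by
  simp_rw [enorm_mul]
  refine (cs_l2 J _ _).trans ?_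
  refine mul_le_mul' ?_ le_rfl
  unfold l2
  refine ENNReal.rpow_le_rpow ?_ (by norm_num)
  calc _ = ∑ j ∈ J.filter (fun j => j - s ∈ J), ‖a (j - s)‖ₑ ^ 2 := by
        rw [Finset.sum_filter]
        refine Finset.sum_congr rfl fun j _ => ?_
        by_cases h : j - s ∈ J <;> simp [h]
    _ = ∑ i ∈ (J.filter (fun j => j - s ∈ J)).image (fun j => j - s), ‖a i‖ₑ ^ 2 := by
        rw [Finset.sum_image]
        intro x _ y _ h; simpa using h
    _ ≤ _ := by
        refine Finset.sum_le_sum_of_subset ?_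
        intro i hi
        simp only [Finset.mem_image, Finset.mem_filter] at hi
        obtain ⟨j, ⟨_, hj⟩, rfl⟩ := hi
        exact hj

lemma para_alg (a b : ℤ → ℂ) (L m : ℕ) (N0 N1 : ℤ) (h0 : -(L:ℤ) ≤ N0) (h01 : N0 ≤ N1) (h1 : N1 ≤ L) (HF HA HB : ℝ≥0∞)
    (hF : ∀ n : ℤ, ‖∑ j ∈ (blk L).filter (· ≤ n), (∑ i ∈ (blk L).filter (· ≤ j - 1 - m), a i) * b j‖ₑ ≤ HF)
    (hA : ∀ n : ℤ, ‖∑ j ∈ (blk L).filter (· ≤ n), a j‖ₑ ≤ HA)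
    (hB : ∀ n : ℤ, ‖∑ j ∈ (blk L).filter (· ≤ n), b j‖ₑ ≤ HB) :
    ‖∑ j ∈ Finset.Ioc N0 N1, ∑ i ∈ Finset.Ioo N0 j, a i * b j‖ₑ ≤
      2 * HF + m * (l2 (blk L) (fun j => ‖a j‖ₑ) * l2 (blk L) (fun j => ‖b j‖ₑ)) + 2 * (HA * HB) := by
  set J := blk L with hJ
  set A : ℤ → ℂ := fun k => ∑ i ∈ J.filter (· ≤ k), a i with hAd
  set a' : ℤ → ℂ := fun k => if k ∈ J then a k else 0 with ha'
  have tel : ∀ X : ℤ → ℂ, ∑ j ∈ Finset.Ioc N0 N1, X j = ∑ j ∈ J.filter (· ≤ N1), X j - ∑ j ∈ J.filter (· ≤ N0), X j := by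
    intro X
    rw [eq_sub_iff_add_eq, ← Finset.sum_sdiff (s₁ := J.filter (· ≤ N0)) (s₂ := J.filter (· ≤ N1))]
    · congr 1
      refine Finset.sum_congr ?_ fun _ _ => rfl
      ext i; simp [hJ, blk]; omega
    · intro i hi; simp only [Finset.mem_filter] at hi ⊢; exact ⟨hi.1, by omega⟩
  have tel2 : ∀ j ∈ Finset.Ioc N0 N1, ∑ i ∈ Finset.Ioo N0 j, a i = A (j - 1) - A N0 := by
    intro j hj
    rw [Finset.mem_Ioc] at hj
    rw [eq_sub_iff_add_eq, hAd]
    simp only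
    rw [← Finset.sum_sdiff (s₁ := J.filter (· ≤ N0)) (s₂ := J.filter (· ≤ j - 1))]
    · congr 1
      refine Finset.sum_congr ?_ fun _ _ => rfl
      ext i; simp [hJ, blk]; omega
    · intro i hi; simp only [Finset.mem_filter] at hi ⊢; exact ⟨hi.1, by omega⟩
  have step : ∀ k, A k - A (k - 1) = a' k := by
    intro k
    rw [sub_eq_iff_eq_add, hAd, ha']
    simp only
    rw [← Finset.sum_sdiff (s₁ := J.filter (· ≤ k - 1)) (s₂ := J.filter (· ≤ k))]
    · congr 1
      split_ifs with hk
      · rw [← Finset.sum_singleton a k]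
        refine Finset.sum_congr ?_ fun _ _ => rfl
        ext i; simp
        constructor
        · rintro ⟨⟨h1, h2⟩, h3⟩; have := h3 h1; omega
        · rintro rfl; exact ⟨⟨hk, le_rfl⟩, fun _ => by omega⟩
      · refine Finset.sum_eq_zero fun i hi => ?_
        simp at hi
        exfalso
        have := hi.2 hi.1.1
        have e : i = k := by omega
        exact hk (e ▸ hi.1.1)
    · intro i hi; simp only [Finset.mem_filter] at hi ⊢; exact ⟨hi.1, by omega⟩
  have tel3 : ∀ j : ℤ, A (j - 1) = A (j - 1 - m) + ∑ s ∈ Finset.range m, a' (j - (1 + s)) := by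
    intro j
    have := Finset.sum_range_sub' (fun s : ℕ => A (j - 1 - s)) m
    simp only [Nat.cast_zero, sub_zero] at this
    rw [← sub_eq_iff_eq_add', ← this]
    refine Finset.sum_congr rfl fun s _ => ?_
    rw [← step]; congr 2 <;> push_cast <;> ring
  have main : ∑ j ∈ Finset.Ioc N0 N1, ∑ i ∈ Finset.Ioo N0 j, a i * b j =
      (∑ j ∈ J.filter (· ≤ N1), A (j - 1 - m) * b j - ∑ j ∈ J.filter (· ≤ N0), A (j - 1 - m) * b j) +
      ∑ s ∈ Finset.range m, ∑ j ∈ Finset.Ioc N0 N1, a' (j - (1 + s)) * b j -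
      A N0 * (∑ j ∈ J.filter (· ≤ N1), b j - ∑ j ∈ J.filter (· ≤ N0), b j) := by
    rw [← tel, ← tel, Finset.sum_comm, Finset.mul_sum, ← Finset.sum_add_distrib, ← Finset.sum_sub_distrib]
    refine Finset.sum_congr rfl fun j hj => ?_
    rw [← Finset.sum_mul, tel2 j hj, tel3 j, ← Finset.sum_mul]; ring
  rw [main]
  have hIJ : Finset.Ioc N0 N1 ⊆ J := by intro i; simp [hJ, blk]; omega
  refine enorm_sub_le.trans (add_le_add ((enorm_add_le _ _).trans (add_le_add ?_ ?_)) ?_)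
  · refine enorm_sub_le.trans ?_
    rw [two_mul]; exact add_le_add (hF _) (hF _)
  · refine (enorm_sum_le _ _).trans ?_
    calc _ ≤ ∑ s ∈ Finset.range m, l2 J (fun j => ‖a j‖ₑ) * l2 J (fun j => ‖b j‖ₑ) := by
          refine Finset.sum_le_sum fun s _ => ?_
          refine (enorm_sum_le _ _).trans ?_
          refine (Finset.sum_le_sum_of_subset hIJ).trans ?_
          exact cs_shift J a b (1 + s)
      _ = _ := by simp
  · rw [enorm_mul, show 2 * (HA * HB) = HA * (HB + HB) by ring]
    gcongr
    · exact hA _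
    · exact enorm_sub_le.trans (add_le_add (hB _) (hB _))



/-- `θ` reproduces the fattened annulus -/
def RepA (N : ℕ) (θ : SchwartzMap ℝ ℂ) : Prop :=
  ∀ (j : ℤ) (ξ : ℝ), (2:ℝ) ^ (j - N - 1) ≤ |ξ| → |ξ| ≤ 2 ^ (j + N + 1) → 𝓕 (⇑θ) (ξ / 2 ^ j) = 1

lemma exists_rep (N : ℕ) : ∃ θ : SchwartzMap ℝ ℂ, RepA N θ ∧ Ann (N + 2) θ := by
  have h1 : (1:ℝ) ≤ 2 ^ N := one_le_pow₀ (by norm_num)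
  have h2 : ((2:ℝ) ^ (N + 1))⁻¹ < 2 ^ (N + 1) := by
    have : (1:ℝ) < 2 ^ (N+1) := one_lt_pow₀ (by norm_num) (by simp)
    exact (inv_lt_one_of_one_lt₀ this).trans this
  obtain ⟨θ, h3, h4⟩ := exists_bandpass ((2:ℝ) ^ (N + 1))⁻¹ (2 ^ (N + 1)) (by positivity) h2
  refine ⟨θ, ?_, ?_⟩
  · intro j ξ ha hb
    have hj := two_zpow_pos j
    apply h3
    · rw [abs_div, abs_of_pos hj, le_div_iff₀ hj]
      refine le_of_eq_of_le ?_ ha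
      rw [sub_sub, zpow_sub₀ (by norm_num), div_eq_inv_mul]
      norm_cast
    · rw [abs_div, abs_of_pos hj, div_le_iff₀ hj]
      refine hb.trans_eq ?_
      rw [add_assoc, zpow_add₀ (by norm_num), mul_comm]
      norm_cast
  · intro ξ hξ
    obtain ⟨h5, h6⟩ := h4 ξ hξ
    constructor
    · refine lt_of_eq_of_lt ?_ h5
      rw [pow_succ _ (N+1), mul_inv]; ring
    · refine h6.trans_eq ?_
      rw [pow_succ _ (N+1)]; ring

lemma rep_self {N : ℕ} {θ φ : SchwartzMap ℝ ℂ} (hθ : RepA N θ) (hφ : Ann N φ) (j : ℤ) {f : ℝ → ℂ} (hf : Tame f) (x : ℝ) :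
    conv (dilate θ j) (conv (dilate φ j) f) x = conv (dilate φ j) f x := by
  refine conv_comp_self θ φ j j (fun ξ hξ => ?_) hf x
  obtain ⟨h1, h2⟩ := hφ.scale j ξ hξ
  refine hθ j ξ (le_trans ?_ h1.le) (h2.le.trans ?_)
  · exact zpow_le_zpow_right₀ (by norm_num) (by omega)
  · exact zpow_le_zpow_right₀ (by norm_num) (by omega)

lemma core_rep {N : ℕ} {θ φ : SchwartzMap ℝ ℂ} (hθ : RepA N θ) (hφ : Ann N φ) (i j : ℤ) (hij : i ≤ j - 1 - 2 * N)
    (u y x : ℝ) : conv (dilate θ j) (fun t => dilate φ j (t - y) * dilate φ i (t - u)) x =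
      dilate φ j (x - y) * dilate φ i (x - u) := by
  obtain ⟨c, hc, hc'⟩ := mul_support ((dilS φ j).compSubConstCLM ℝ y) ((dilS φ i).compSubConstCLM ℝ u)
  have e : ∀ t, c t = dilate φ j (t - y) * dilate φ i (t - u) := by
    intro t; rw [hc, SchwartzMap.compSubConstCLM_apply, SchwartzMap.compSubConstCLM_apply, dilS_apply, dilS_apply]
  have := conv_schwartz_eq (dilS θ j) c c ?_ x
  · rw [dilS_coe, e, show (⇑c) = _ from funext e] at this
    exact this
  intro ξ
  by_cases h0 : 𝓕 (⇑c) ξ = 0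
  · rw [h0, mul_zero]
  obtain ⟨η, h1, h2⟩ := hc' ξ h0
  rw [fourier_translate, fourier_dilS] at h1 h2
  have h1' := hφ.scale j η (fun h => h1 (by rw [h, smul_zero]))
  have h2' := (hφ.scale i (ξ - η) (fun h => h2 (by rw [h, smul_zero]))).2
  rw [fourier_dilS, hθ j ξ, one_mul]
  · have h3 : (2:ℝ) ^ (i + N) ≤ 2 ^ (j - N - 1) := zpow_le_zpow_right₀ (by norm_num) (by omega)
    have h4 : (2:ℝ) ^ (j - N) = 2 * 2 ^ (j - N - 1) := by
      rw [show (j - N : ℤ) = (j - N - 1) + 1 by ring, zpow_add_one₀ (by norm_num)]; ring_nf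
    have h5 := abs_sub_abs_le_abs_sub η ξ
    rw [abs_sub_comm] at h5
    linarith [h1'.1]
  · have h3 : (2:ℝ) ^ (i + N) ≤ 2 ^ (j + N) := zpow_le_zpow_right₀ (by norm_num) (by omega)
    have h4 : (2:ℝ) ^ (j + N + 1) = 2 * 2 ^ (j + N) := by
      rw [zpow_add_one₀ (by norm_num)]; ring
    have h5 := abs_sub_abs_le_abs_sub ξ η
    linarith [h1'.2]

lemma dilate_bdd (φ : SchwartzMap ℝ ℂ) (j : ℤ) : ∃ M : ℝ≥0∞, M ≠ ∞ ∧ ∀ x, ‖dilate φ j x‖ₑ ≤ M := by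
  obtain ⟨C, hC, h⟩ := dilate_le φ 0
  refine ⟨C * ENNReal.ofReal (2 ^ j), by finiteness, fun x => ?_⟩
  have := h j x
  simpa [kn] using this

lemma prod_rep {N : ℕ} {θ φ : SchwartzMap ℝ ℂ} (hθ : RepA N θ) (hφ : Ann N φ) (i j : ℤ) (hij : i ≤ j - 1 - 2 * N)
    {f g : ℝ → ℂ} (hf : Tame f) (hg : Tame g) (x : ℝ) :
    conv (dilate θ j) (fun t => conv (dilate φ i) f t * conv (dilate φ j) g t) x =
      conv (dilate φ i) f x * conv (dilate φ j) g x := by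
  obtain ⟨M, hM, h⟩ := hf.conv_bdd φ i
  rw [conv_fubini θ φ j j (conv_meas φ i hf.1) M hM h hg x]
  have key : ∀ y, conv (dilate θ j) (fun t => conv (dilate φ i) f t * dilate φ j (t - y)) x =
      conv (dilate φ i) f x * dilate φ j (x - y) := by
    intro y
    obtain ⟨M', hM', h'⟩ := dilate_bdd φ j
    have hm := dilate_measurable φ j
    have := conv_fubini θ φ j i (w := fun t => dilate φ j (t - y)) (by fun_prop) M' hM' (fun t => h' _) hf x
    simp_rw [core_rep hθ hφ i j hij] at this
    simp_rw [mul_comm (conv (dilate φ i) f _)]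
    rw [this]
    simp_rw [mul_assoc]
    rw [integral_const_mul]; rfl
  simp_rw [key, mul_assoc]
  rw [integral_const_mul]; rfl

/-- partial sums -/
def As (φ : SchwartzMap ℝ ℂ) (J : Finset ℤ) (f : ℝ → ℂ) (k : ℤ) (x : ℝ) : ℂ :=
  ∑ i ∈ J.filter (· ≤ k), conv (dilate φ i) f x

lemma As_tame (φ : SchwartzMap ℝ ℂ) (J : Finset ℤ) {f : ℝ → ℂ} (hf : Tame f) (k : ℤ) : Tame (As φ J f k) :=
  Tame.sum fun i _ => hf.conv φ i

lemma As_bdd (φ : SchwartzMap ℝ ℂ) (J : Finset ℤ) {f : ℝ → ℂ} (hf : Tame f) (k : ℤ) :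
    ∃ M : ℝ≥0∞, M ≠ ∞ ∧ ∀ x, ‖As φ J f k x‖ₑ ≤ M := by
  choose M hM h using fun i => hf.conv_bdd φ i
  refine ⟨∑ i ∈ J.filter (· ≤ k), M i, by simp [ENNReal.sum_eq_top, hM], fun x => ?_⟩
  exact (enorm_sum_le _ _).trans (Finset.sum_le_sum fun i _ => h i x)

lemma As_le (N : ℕ) (φ : SchwartzMap ℝ ℂ) (hφ : Ann N φ) : ∃ C : ℝ≥0∞, C ≠ ∞ ∧ ∀ (J : Finset ℤ) (f : ℝ → ℂ), Tame f →
    ∀ k x, ‖As φ J f k x‖ₑ ≤ C * ∫⁻ y, kn 6 k (x - y) * ‖As φ J f k y‖ₑ := by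
  obtain ⟨ψ, h1, _⟩ := exists_lowpass (2 ^ N) (by positivity)
  obtain ⟨C, hC, h⟩ := conv_le ψ 6
  refine ⟨C, hC, fun J f hf k x => ?_⟩
  refine le_of_eq_of_le ?_ (h k _ (As_tame φ J hf k).1 x)
  congr 1
  unfold As
  rw [conv_sum ψ k (fun i _ => hf.conv φ i)]
  refine Finset.sum_congr rfl fun i hi => ?_
  rw [Finset.mem_filter] at hi
  symm
  refine conv_comp_self ψ φ k i (fun ξ hξ => ?_) hf x
  have hk := two_zpow_pos k
  obtain ⟨_, h2⟩ := hφ.scale i ξ hξ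
  apply h1
  rw [abs_div, abs_of_pos hk, div_le_iff₀ hk]
  refine h2.le.trans ?_
  rw [zpow_add₀ (by norm_num), mul_comm, zpow_natCast]
  gcongr
  · norm_num
  · exact hi.2

lemma As_prod_rep {N : ℕ} {θ φ : SchwartzMap ℝ ℂ} (hθ : RepA N θ) (hφ : Ann N φ) (J : Finset ℤ) (j : ℤ)
    {f g : ℝ → ℂ} (hf : Tame f) (hg : Tame g) (x : ℝ) :
    conv (dilate θ j) (fun t => As φ J f (j - 1 - (2 * N : ℕ)) t * conv (dilate φ j) g t) x =
      As φ J f (j - 1 - (2 * N : ℕ)) x * conv (dilate φ j) g x := by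
  unfold As
  simp_rw [Finset.sum_mul]
  rw [conv_sum]
  · refine Finset.sum_congr rfl fun i hi => ?_
    rw [Finset.mem_filter] at hi
    exact prod_rep hθ hφ i j (by have := hi.2; push_cast at this; exact this) hf hg x
  · intro i _
    obtain ⟨M, hM, h⟩ := hf.conv_bdd φ i
    obtain ⟨M', hM', h'⟩ := hg.conv_bdd φ j
    have hm1 := conv_meas φ i hf.1
    have hm2 := conv_meas φ j hg.1
    refine tame_of_bdd (by fun_prop) (M * M') (by finiteness) fun x => ?_
    rw [enorm_mul]; exact mul_le_mul' (h x) (h' x)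



lemma holder_r (p q : ℝ) (hp : 0 < p) (hq : 0 < q) {X Y : ℝ → ℝ≥0∞} (hX : Measurable X) (hY : Measurable Y) :
    ∫⁻ x, (X x * Y x) ^ (p * q / (p + q)) ≤ (∫⁻ x, X x ^ p) ^ (q / (p + q)) * (∫⁻ x, Y x ^ q) ^ (p / (p + q)) := by
  have hc : Real.HolderConjugate ((p + q) / q) ((p + q) / p) := by
    rw [Real.holderConjugate_iff]
    constructor
    · rw [lt_div_iff₀ hq]; linarith
    · field_simp; ring
  have := ENNReal.lintegral_mul_le_Lp_mul_Lq volume hc (f := fun x => X x ^ (p * q / (p + q)))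
    (g := fun x => Y x ^ (p * q / (p + q))) (by fun_prop) (by fun_prop)
  simp only [Pi.mul_apply, ← ENNReal.rpow_mul] at this
  rw [show p * q / (p + q) * ((p + q) / q) = p by field_simp,
    show p * q / (p + q) * ((p + q) / p) = q by field_simp] at this
  simp_rw [one_div_div] at this
  refine le_trans (le_of_eq ?_) this
  refine lintegral_congr fun x => ?_
  rw [ENNReal.mul_rpow_of_nonneg _ _ (by positivity)]

lemma lint_const_rpow (r : ℝ) (hr : 0 < r) (c : ℝ≥0∞) (hc : c ≠ ∞) (X : ℝ → ℝ≥0∞) :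
    ∫⁻ x, (c * X x) ^ r = c ^ r * ∫⁻ x, X x ^ r := by
  rw [← lintegral_const_mul' _ _ (by finiteness)]
  refine lintegral_congr fun x => ?_
  rw [ENNReal.mul_rpow_of_nonneg _ _ hr.le]

lemma om_pow_mono (k j : ℤ) (h : k ≤ j) (d : ℝ) (hd : 0 ≤ d) :
    ENNReal.ofReal ((1 + 2 ^ k * d) ^ 6) ≤ ENNReal.ofReal ((1 + 2 ^ j * d) ^ 6) := by
  apply ENNReal.ofReal_le_ofReal
  have := two_zpow_pos k
  gcongr
  · norm_num

lemma Slow.const {j : ℤ} {P : ℝ → ℝ≥0∞} (h : Slow j P) (c : ℝ≥0∞) : Slow j (fun x => c * P x) := by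
  intro x y
  calc _ ≤ c * _ := mul_le_mul' le_rfl (h x y)
    _ = _ := by ring

lemma slow_of_6 {j : ℤ} {P : ℝ → ℝ≥0∞} (h : ∀ x y, P x ≤ ENNReal.ofReal ((1 + 2 ^ j * |x - y|) ^ 6) * P y) : Slow j P := by
  intro x y
  refine (h x y).trans (mul_le_mul' (ENNReal.ofReal_le_ofReal ?_) le_rfl)
  have : (1:ℝ) ≤ 1 + 2 ^ j * |x - y| := om_pos j _
  exact pow_le_pow_right₀ this (by norm_num)

lemma slow_mul_6 {k j : ℤ} (hkj : k ≤ j) {P Q : ℝ → ℝ≥0∞} (h : ∀ x y, P x ≤ ENNReal.ofReal ((1 + 2 ^ k * |x - y|) ^ 6) * P y)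
    (h' : ∀ x y, Q x ≤ ENNReal.ofReal ((1 + 2 ^ j * |x - y|) ^ 6) * Q y) : Slow j (fun x => P x * Q x) := by
  intro x y
  have : (1:ℝ) ≤ 1 + 2 ^ j * |x - y| := om_pos j _
  calc _ ≤ (ENNReal.ofReal ((1 + 2 ^ j * |x - y|) ^ 6) * P y) * (ENNReal.ofReal ((1 + 2 ^ j * |x - y|) ^ 6) * Q y) :=
        mul_le_mul' ((h x y).trans (mul_le_mul' (om_pow_mono k j hkj _ (abs_nonneg _)) le_rfl)) (h' x y)
    _ = _ := by
        rw [show (1 + (2:ℝ) ^ j * |x - y|) ^ 12 = (1 + 2 ^ j * |x - y|) ^ 6 * (1 + 2 ^ j * |x - y|) ^ 6 by ring,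
          ENNReal.ofReal_mul (by positivity)]; ring

lemma a_le_Pq (N : ℕ) (φ : SchwartzMap ℝ ℂ) (hφ : Ann N φ) : ∃ C : ℝ≥0∞, C ≠ ∞ ∧ ∀ (f : ℝ → ℂ), Tame f →
    ∀ j x, ‖conv (dilate φ j) f x‖ₑ ≤ C * Pq 6 φ j f x := by
  obtain ⟨θ, h1, _⟩ := exists_rep N
  obtain ⟨C, hC, h⟩ := conv_le θ 6
  refine ⟨C, hC, fun f hf j x => ?_⟩
  have := h j _ (conv_meas φ j hf.1) x
  rwa [rep_self h1 hφ j hf x] at this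

lemma sum_MF_fin (φ : SchwartzMap ℝ ℂ) (p : ℝ) (hp : 1 < p) (J : Finset ℤ) {f : ℝ → ℂ} (hf : Measurable f)
    (hfin : ∫⁻ x, ‖f x‖ₑ ^ p ≠ ∞) : ∫⁻ x, (∑ j ∈ J, ‖conv (dilate φ j) f x‖ₑ) ^ p ≠ ∞ := by
  obtain ⟨C, hC, h⟩ := conv_le_MF φ
  obtain ⟨D, hD, h'⟩ := MF_strong p hp
  refine ne_top_of_le_ne_top (b := ((J.card : ℝ≥0∞) * C) ^ p * (D * ∫⁻ x, ‖f x‖ₑ ^ p)) (by finiteness) ?_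
  refine le_trans ?_ (mul_le_mul' le_rfl (h' (fun x => ‖f x‖ₑ) (by fun_prop)))
  rw [← lint_const_rpow p (by linarith) _ (by finiteness)]
  refine lintegral_mono fun x => ENNReal.rpow_le_rpow ?_ (by linarith)
  calc _ ≤ ∑ j ∈ J, C * MF (fun y => ‖f y‖ₑ) x := Finset.sum_le_sum fun j _ => h j f hf x
    _ = _ := by simp; ring

lemma a_est (N : ℕ) (φ : SchwartzMap ℝ ℂ) (hφ : Ann N φ) (p : ℝ) (hp : 1 < p) : ∃ C : ℝ≥0∞, C ≠ ∞ ∧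
    ∀ (J : Finset ℤ) (f : ℝ → ℂ), Measurable f → ∫⁻ x, ‖f x‖ₑ ^ p ≠ ∞ →
      ∫⁻ x, Hs J (fun j => conv (dilate φ j) f) x ^ p ≤ C * ∫⁻ x, ‖f x‖ₑ ^ p := by
  obtain ⟨θ, h1, h2⟩ := exists_rep N
  obtain ⟨C1, hC1, hT⟩ := thmI _ θ h2 p (by linarith)
  obtain ⟨C2, hC2, hU⟩ := U_strong N φ hφ p hp
  obtain ⟨C3, hC3, hP⟩ := a_le_Pq N φ hφ
  refine ⟨C1 * (C3 ^ p * C2), by finiteness, fun J f hf hfin => ?_⟩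
  have ht := tame_of_lp hf p hp.le hfin
  refine (hT J (fun j => conv (dilate φ j) f) (fun j x => C3 * Pq 6 φ j f x) ?_ ?_).trans ?_
  · exact ⟨fun j => ht.conv φ j, fun j x => hP f ht j x, fun j => (slow_of_6 (fun x y => knw_slow 6 j _ x y)).const _,
      fun j => (Pq_meas 6 φ j hf).const_mul _, fun j x => rep_self h1 hφ j ht x⟩
  · refine ne_top_of_le_ne_top (sum_MF_fin φ p hp J hf hfin) (lintegral_mono fun x => ?_)
    exact ENNReal.rpow_le_rpow (Hs_le_sum _ _ _) (by linarith)
  · simp_rw [l2_const_mul]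
    rw [lint_const_rpow p (by linarith) _ hC3, mul_assoc, mul_assoc]
    exact mul_le_mul' le_rfl (mul_le_mul' le_rfl (hU J f hf hfin))

lemma As_le_Hs (φ : SchwartzMap ℝ ℂ) (J : Finset ℤ) (f : ℝ → ℂ) (k : ℤ) (x : ℝ) :
    ‖As φ J f k x‖ₑ ≤ Hs J (fun j => conv (dilate φ j) f) x :=
  le_iSup (fun n : ℤ => ‖∑ j ∈ J.filter (· ≤ n), conv (dilate φ j) f x‖ₑ) k

lemma para_est (N : ℕ) (φ : SchwartzMap ℝ ℂ) (hφ : Ann N φ) (p q : ℝ) (hp : 1 < p) (hq : 1 < q) : ∃ C : ℝ≥0∞, C ≠ ∞ ∧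
    ∀ (J : Finset ℤ) (f g : ℝ → ℂ), Measurable f → Measurable g → ∫⁻ x, ‖f x‖ₑ ^ p ≠ ∞ → ∫⁻ x, ‖g x‖ₑ ^ q ≠ ∞ →
      ∫⁻ x, Hs J (fun j x => As φ J f (j - 1 - (2 * N : ℕ)) x * conv (dilate φ j) g x) x ^ (p * q / (p + q)) ≤
        C * ((∫⁻ x, ‖f x‖ₑ ^ p) ^ (q / (p + q)) * (∫⁻ x, ‖g x‖ₑ ^ q) ^ (p / (p + q))) := by
  have hp0 : 0 < p := by linarith
  have hq0 : 0 < q := by linarith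
  have hr : 0 < p * q / (p + q) := by positivity
  have hs : 0 ≤ q / (p + q) := by positivity
  have ht : 0 ≤ p / (p + q) := by positivity
  set r := p * q / (p + q) with hrd
  set s := q / (p + q) with hsd
  set t := p / (p + q) with htd
  obtain ⟨θ, h1, h2⟩ := exists_rep N
  obtain ⟨C1, hC1, hT⟩ := thmI _ θ h2 r hr
  obtain ⟨C2, hC2, hU⟩ := U_strong N φ hφ q hq
  obtain ⟨C3, hC3, hP⟩ := a_le_Pq N φ hφ
  obtain ⟨C4, hC4, hA⟩ := As_le N φ hφ
  obtain ⟨C5, hC5, hE⟩ := a_est N φ hφ p hp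
  obtain ⟨C6, hC6, hM⟩ := MF_strong p hp
  refine ⟨C1 * ((C4 * C3 * 16) ^ r * ((C6 * C5) ^ s * C2 ^ t)), by finiteness, fun J f g hf hg hff hgf => ?_⟩
  have htf := tame_of_lp hf p hp.le hff
  have htg := tame_of_lp hg q hq.le hgf
  set H := Hs J (fun j => conv (dilate φ j) f) with hH
  have hHm : Measurable H := Hs_meas J fun j => conv_meas φ j hf
  have hAm : ∀ k, Measurable (As φ J f k) := fun k => (As_tame φ J htf k).1
  refine (hT J (fun j x => As φ J f (j - 1 - (2 * N : ℕ)) x * conv (dilate φ j) g x)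
    (fun j x => (C4 * C3) * ((∫⁻ y, kn 6 (j - 1 - (2 * N : ℕ)) (x - y) * ‖As φ J f (j - 1 - (2 * N : ℕ)) y‖ₑ) * Pq 6 φ j g x)) ?_ ?_).trans ?_
  · refine ⟨fun j => ?_, fun j x => ?_, fun j => ?_, fun j => ?_, fun j x => ?_⟩
    · obtain ⟨M, hM, h⟩ := As_bdd φ J htf (j - 1 - (2 * N : ℕ))
      obtain ⟨M', hM', h'⟩ := htg.conv_bdd φ j
      have hm2 := conv_meas φ j hg
      refine tame_of_bdd ((hAm _).mul hm2) (M * M') (by finiteness) fun x => ?_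
      rw [enorm_mul]; exact mul_le_mul' (h x) (h' x)
    · rw [enorm_mul]
      refine (mul_le_mul' (hA J f htf _ x) (hP g htg j x)).trans (le_of_eq (by ring))
    · exact (slow_mul_6 (by omega) (fun x y => knw_slow 6 _ _ x y) (fun x y => knw_slow 6 j _ x y)).const _
    · refine Measurable.const_mul ?_ _
      exact (knw_meas 6 _ (hAm _).enorm).mul (Pq_meas 6 φ j hg)
    · exact As_prod_rep h1 hφ J j htf htg x
  · refine ne_top_of_le_ne_top (b := (∫⁻ x, H x ^ p) ^ s * (∫⁻ x, (∑ j ∈ J, ‖conv (dilate φ j) g x‖ₑ) ^ q) ^ t) ?_ ?_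
    · refine ENNReal.mul_ne_top (ENNReal.rpow_ne_top_of_nonneg hs ?_) (ENNReal.rpow_ne_top_of_nonneg ht (sum_MF_fin φ q hq J hg hgf))
      exact ne_top_of_le_ne_top (by finiteness) (hE J f hf hff)
    · refine le_trans ?_ (holder_r p q hp0 hq0 hHm (Finset.measurable_sum _ fun j _ => (conv_meas φ j hg).enorm))
      refine lintegral_mono fun x => ENNReal.rpow_le_rpow ((Hs_le_sum _ _ _).trans ?_) hr.le
      rw [Finset.mul_sum]
      refine Finset.sum_le_sum fun j _ => ?_
      rw [enorm_mul]
      exact mul_le_mul' (As_le_Hs _ _ _ _ _) le_rfl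
  · rw [mul_assoc]
    refine mul_le_mul' le_rfl ?_
    calc _ ≤ ∫⁻ x, ((C4 * C3 * 16) * (MF H x * l2 J (fun j => Pq 6 φ j g x))) ^ r := by
          refine lintegral_mono fun x => ENNReal.rpow_le_rpow ?_ hr.le
          rw [l2_const_mul, mul_assoc (C4 * C3)]
          refine mul_le_mul' le_rfl ?_
          rw [← mul_assoc, ← l2_const_mul]
          refine l2_mono fun j _ => mul_le_mul' ?_ le_rfl
          refine le_trans ?_ (kn_MF (j - 1 - (2 * N : ℕ)) H hHm x)
          exact lintegral_mono fun y => mul_le_mul' (kn_anti (by norm_num) _ _) (As_le_Hs _ _ _ _ _)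
      _ ≤ (C4 * C3 * 16) ^ r * ((∫⁻ x, MF H x ^ p) ^ s * (∫⁻ x, l2 J (fun j => Pq 6 φ j g x) ^ q) ^ t) := by
          rw [lint_const_rpow r hr _ (by finiteness)]
          exact mul_le_mul' le_rfl (holder_r p q hp0 hq0 (measurable_MF H) (l2_meas J fun j => Pq_meas 6 φ j hg))
      _ ≤ (C4 * C3 * 16) ^ r * ((C6 * (C5 * ∫⁻ x, ‖f x‖ₑ ^ p)) ^ s * (C2 * ∫⁻ x, ‖g x‖ₑ ^ q) ^ t) := by
          refine mul_le_mul' le_rfl (mul_le_mul' (ENNReal.rpow_le_rpow ?_ hs) (ENNReal.rpow_le_rpow (hU J g hg hgf) ht))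
          exact (hM H hHm).trans (mul_le_mul' le_rfl (hE J f hf hff))
      _ = _ := by
          rw [← mul_assoc C6, ENNReal.mul_rpow_of_nonneg _ _ hs, ENNReal.mul_rpow_of_nonneg _ _ ht]; ring



lemma add3_rpow (r : ℝ) (hr : 0 < r) (a b c : ℝ≥0∞) : (a + b + c) ^ r ≤ 3 ^ r * (a ^ r + b ^ r + c ^ r) := by
  have key : ∀ m : ℝ≥0∞, a ≤ m → b ≤ m → c ≤ m → (a + b + c) ^ r ≤ 3 ^ r * m ^ r := by
    intro m h1 h2 h3
    rw [← ENNReal.mul_rpow_of_nonneg _ _ hr.le]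
    refine ENNReal.rpow_le_rpow ?_ hr.le
    calc a + b + c ≤ m + m + m := by gcongr
      _ = 3 * m := by ring
  rcases le_total a b with h | h <;> rcases le_total b c with h' | h' <;> rcases le_total a c with h'' | h''
  all_goals first
    | (refine (key a le_rfl (by assumption) (by assumption)).trans (mul_le_mul' le_rfl ?_); rw [add_assoc]; exact le_self_add)
    | (refine (key b (by assumption) le_rfl (by assumption)).trans (mul_le_mul' le_rfl ?_); rw [add_comm (a ^ r), add_assoc]; exact le_self_add)
    | (refine (key c (by assumption) (by assumption) le_rfl).trans (mul_le_mul' le_rfl ?_); exact le_add_self)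
    | (refine (key a le_rfl (by order) (by order)).trans (mul_le_mul' le_rfl ?_); rw [add_assoc]; exact le_self_add)

/-- truncated maximal paraproduct -/
def TL (φ : SchwartzMap ℝ ℂ) (f g : ℝ → ℂ) (L : ℕ) (x : ℝ) : ℝ≥0∞ :=
  ⨆ (N0 : ℤ) (N1 : ℤ) (_ : -(L:ℤ) ≤ N0 ∧ N0 ≤ N1 ∧ N1 ≤ L),
    ‖∑ j ∈ Finset.Ioc N0 N1, ∑ i ∈ Finset.Ioo N0 j, conv (dilate φ i) f x * conv (dilate φ j) g x‖ₑ

lemma TL_meas (φ : SchwartzMap ℝ ℂ) {f g : ℝ → ℂ} (hf : Measurable f) (hg : Measurable g) (L : ℕ) : Measurable (TL φ f g L) := by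
  unfold TL
  refine Measurable.iSup fun N0 => Measurable.iSup fun N1 => Measurable.iSup fun _ => Measurable.enorm ?_
  exact Finset.measurable_sum _ fun j _ => Finset.measurable_sum _ fun i _ => (conv_meas φ i hf).mul (conv_meas φ j hg)

lemma TL_est (N : ℕ) (φ : SchwartzMap ℝ ℂ) (hφ : Ann N φ) (p q : ℝ) (hp : 1 < p) (hq : 1 < q) : ∃ C : ℝ≥0∞, C ≠ ∞ ∧
    ∀ (L : ℕ) (f g : ℝ → ℂ), Measurable f → Measurable g → ∫⁻ x, ‖f x‖ₑ ^ p ≠ ∞ → ∫⁻ x, ‖g x‖ₑ ^ q ≠ ∞ →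
      ∫⁻ x, TL φ f g L x ^ (p * q / (p + q)) ≤
        C * ((∫⁻ x, ‖f x‖ₑ ^ p) ^ (q / (p + q)) * (∫⁻ x, ‖g x‖ₑ ^ q) ^ (p / (p + q))) := by
  have hp0 : 0 < p := by linarith
  have hq0 : 0 < q := by linarith
  obtain ⟨C1, hC1, hPa⟩ := para_est N φ hφ p q hp hq
  obtain ⟨C2, hC2, hUp⟩ := U_strong N φ hφ p hp
  obtain ⟨C3, hC3, hUq⟩ := U_strong N φ hφ q hq
  obtain ⟨C4, hC4, hP⟩ := a_le_Pq N φ hφ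
  obtain ⟨C5, hC5, hEp⟩ := a_est N φ hφ p hp
  obtain ⟨C6, hC6, hEq⟩ := a_est N φ hφ q hq
  have hr : 0 < p * q / (p + q) := by positivity
  have hs : 0 ≤ q / (p + q) := by positivity
  have ht : 0 ≤ p / (p + q) := by positivity
  have hH := fun (X Y : ℝ → ℝ≥0∞) (hX : Measurable X) (hY : Measurable Y) => holder_r p q hp0 hq0 hX hY
  set r := p * q / (p + q) with hrd
  set s := q / (p + q) with hsd
  set t := p / (p + q) with htd
  refine ⟨3 ^ r * (2 ^ r * C1 + ((2 * N : ℕ) * (C4 * C4)) ^ r * (C2 ^ s * C3 ^ t) + 2 ^ r * (C5 ^ s * C6 ^ t)),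
    by finiteness, fun L f g hf hg hff hgf => ?_⟩
  have htf := tame_of_lp hf p hp.le hff
  have htg := tame_of_lp hg q hq.le hgf
  set J := blk L with hJ
  set HF := Hs J (fun j x => As φ J f (j - 1 - (2 * N : ℕ)) x * conv (dilate φ j) g x) with hHF
  set HA := Hs J (fun j => conv (dilate φ j) f) with hHA
  set HB := Hs J (fun j => conv (dilate φ j) g) with hHB
  set UA := fun x => l2 J (fun j => Pq 6 φ j f x) with hUA
  set UB := fun x => l2 J (fun j => Pq 6 φ j g x) with hUB
  have hHFm : Measurable HF := Hs_meas J fun j => (As_tame φ J htf _).1.mul (conv_meas φ j hg)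
  have hHAm : Measurable HA := Hs_meas J fun j => conv_meas φ j hf
  have hHBm : Measurable HB := Hs_meas J fun j => conv_meas φ j hg
  have hUAm : Measurable UA := l2_meas J fun j => Pq_meas 6 φ j hf
  have hUBm : Measurable UB := l2_meas J fun j => Pq_meas 6 φ j hg
  set α := ∫⁻ x, ‖f x‖ₑ ^ p with hα
  set β := ∫⁻ x, ‖g x‖ₑ ^ q with hβ
  have pt : ∀ x, TL φ f g L x ≤ 2 * HF x + ((2 * N : ℕ) * (C4 * C4)) * (UA x * UB x) + 2 * (HA x * HB x) := by
    intro x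
    refine iSup_le fun N0 => iSup_le fun N1 => iSup_le fun h => ?_
    refine (para_alg (fun i => conv (dilate φ i) f x) (fun j => conv (dilate φ j) g x) L (2 * N) N0 N1 h.1 h.2.1 h.2.2
      (HF x) (HA x) (HB x) ?_ ?_ ?_).trans ?_
    · exact fun n => le_iSup (fun n : ℤ => ‖∑ j ∈ J.filter (· ≤ n), As φ J f (j - 1 - (2 * N : ℕ)) x * conv (dilate φ j) g x‖ₑ) n
    · exact fun n => le_iSup (fun n : ℤ => ‖∑ j ∈ J.filter (· ≤ n), conv (dilate φ j) f x‖ₑ) n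
    · exact fun n => le_iSup (fun n : ℤ => ‖∑ j ∈ J.filter (· ≤ n), conv (dilate φ j) g x‖ₑ) n
    · refine add_le_add (add_le_add le_rfl ?_) le_rfl
      rw [mul_assoc]
      refine mul_le_mul' le_rfl ?_
      rw [show C4 * C4 * (UA x * UB x) = (C4 * UA x) * (C4 * UB x) by ring, hUA, hUB]
      simp only
      rw [← l2_const_mul J C4 (fun j => Pq 6 φ j f x), ← l2_const_mul J C4 (fun j => Pq 6 φ j g x)]
      exact mul_le_mul' (l2_mono fun j _ => hP f htf j x) (l2_mono fun j _ => hP g htg j x)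
  calc _ ≤ ∫⁻ x, 3 ^ r * ((2 * HF x) ^ r + (((2 * N : ℕ) * (C4 * C4)) * (UA x * UB x)) ^ r + (2 * (HA x * HB x)) ^ r) :=
        lintegral_mono fun x => (ENNReal.rpow_le_rpow (pt x) hr.le).trans (add3_rpow r hr _ _ _)
    _ = 3 ^ r * (2 ^ r * (∫⁻ x, HF x ^ r) + ((2 * N : ℕ) * (C4 * C4)) ^ r * (∫⁻ x, (UA x * UB x) ^ r) +
          2 ^ r * ∫⁻ x, (HA x * HB x) ^ r) := by
        rw [lintegral_const_mul' _ _ (by finiteness), lintegral_add_left (by fun_prop), lintegral_add_left (by fun_prop),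
          lint_const_rpow r hr _ (by finiteness), lint_const_rpow r hr _ (by finiteness), lint_const_rpow r hr _ (by finiteness)]
    _ ≤ 3 ^ r * (2 ^ r * (C1 * (α ^ s * β ^ t)) + ((2 * N : ℕ) * (C4 * C4)) ^ r * ((C2 * α) ^ s * (C3 * β) ^ t) +
          2 ^ r * ((C5 * α) ^ s * (C6 * β) ^ t)) := by
        refine mul_le_mul' le_rfl (add_le_add (add_le_add ?_ ?_) ?_)
        · exact mul_le_mul' le_rfl (hPa J f g hf hg hff hgf)
        · refine mul_le_mul' le_rfl ((hH UA UB hUAm hUBm).trans ?_)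
          exact mul_le_mul' (ENNReal.rpow_le_rpow (hUp J f hf hff) hs) (ENNReal.rpow_le_rpow (hUq J g hg hgf) ht)
        · refine mul_le_mul' le_rfl ((hH HA HB hHAm hHBm).trans ?_)
          exact mul_le_mul' (ENNReal.rpow_le_rpow (hEp J f hf hff) hs) (ENNReal.rpow_le_rpow (hEq J g hg hgf) ht)
    _ = _ := by
        simp_rw [ENNReal.mul_rpow_of_nonneg _ _ hs, ENNReal.mul_rpow_of_nonneg _ _ ht]; ring

/-- full maximal paraproduct -/
def TM (φ : SchwartzMap ℝ ℂ) (f g : ℝ → ℂ) (x : ℝ) : ℝ≥0∞ :=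
  ⨆ (N0 : ℤ) (N1 : ℤ) (_ : N0 ≤ N1), ENNReal.ofReal
    (‖(∑ j ∈ Finset.Ioc N0 N1, ∑ i ∈ Finset.Ioo N0 j, conv (dilate φ i) f x * conv (dilate φ j) g x)‖)

lemma TM_eq (φ : SchwartzMap ℝ ℂ) (f g : ℝ → ℂ) (x : ℝ) : TM φ f g x ≤ ⨆ L, TL φ f g L x := by
  refine iSup_le fun N0 => iSup_le fun N1 => iSup_le fun h => ?_
  rw [ofReal_norm]
  refine le_iSup_of_le (max N0.natAbs N1.natAbs) ?_
  unfold TL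
  refine le_iSup_of_le N0 (le_iSup_of_le N1 (le_iSup_of_le ⟨?_, h, ?_⟩ le_rfl)) <;> omega

lemma TL_mono (φ : SchwartzMap ℝ ℂ) (f g : ℝ → ℂ) (x : ℝ) : Monotone (fun L => TL φ f g L x) := by
  intro L L' hL
  refine iSup_le fun N0 => iSup_le fun N1 => iSup_le fun h => ?_
  exact le_iSup_of_le N0 (le_iSup_of_le N1 (le_iSup_of_le ⟨by omega, h.2.1, by omega⟩ le_rfl))

lemma TM_est (N : ℕ) (φ : SchwartzMap ℝ ℂ) (hφ : Ann N φ) (p q : ℝ) (hp : 1 < p) (hq : 1 < q) : ∃ C : ℝ≥0∞, C ≠ ∞ ∧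
    ∀ (f g : ℝ → ℂ), Measurable f → Measurable g → ∫⁻ x, ‖f x‖ₑ ^ p ≠ ∞ → ∫⁻ x, ‖g x‖ₑ ^ q ≠ ∞ →
      ∫⁻ x, TM φ f g x ^ (p * q / (p + q)) ≤
        C * ((∫⁻ x, ‖f x‖ₑ ^ p) ^ (q / (p + q)) * (∫⁻ x, ‖g x‖ₑ ^ q) ^ (p / (p + q))) := by
  obtain ⟨C, hC, h⟩ := TL_est N φ hφ p q hp hq
  refine ⟨C, hC, fun f g hf hg hff hgf => ?_⟩
  have hr : 0 < p * q / (p + q) := by have : 0 < p := by linarith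
                                      have : 0 < q := by linarith
                                      positivity
  calc _ ≤ ∫⁻ x, ⨆ L, TL φ f g L x ^ (p * q / (p + q)) := by
        refine lintegral_mono fun x => (ENNReal.rpow_le_rpow (TM_eq φ f g x) hr.le).trans (le_of_eq ?_)
        exact (ENNReal.orderIsoRpow _ hr).map_iSup _
    _ = ⨆ L, ∫⁻ x, TL φ f g L x ^ (p * q / (p + q)) := by
        refine lintegral_iSup (fun L => (TL_meas φ hf hg L).pow_const _) ?_
        intro L L' hL x
        exact ENNReal.rpow_le_rpow (TL_mono φ f g x hL) hr.le
    _ ≤ _ := iSup_le fun L => h L f g hf hg hff hgf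

lemma conv_ae (a : ℝ → ℂ) {f f' : ℝ → ℂ} (h : f =ᵐ[volume] f') : conv a f = conv a f' := by
  funext x
  unfold conv
  refine integral_congr_ae ?_
  filter_upwards [h] with y hy
  rw [hy]

/-- The maximal paraproduct inequality: the `t = ∞` endpoint of the bilinear
variational estimates. -/
theorem maximal_paraproduct
    (p q Nb : ℝ) (hp : 1 < p) (hq : 1 < q) (hNb : 0 < Nb)
    (φ : SchwartzMap ℝ ℂ)
    (hφ : ∀ ξ : ℝ, 𝓕 (⇑φ) ξ ≠ 0 → (2 : ℝ) ^ (-Nb) < |ξ| ∧ |ξ| < (2 : ℝ) ^ Nb) :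
    ∃ C : ℝ≥0, 0 < C ∧
      ∀ (f g : ℝ → ℂ), MemLp f (ENNReal.ofReal p) → MemLp g (ENNReal.ofReal q) →
      (∫⁻ x : ℝ,
          (⨆ (N0 : ℤ) (N1 : ℤ) (_ : N0 ≤ N1),
            ENNReal.ofReal (
              ‖(∑ j ∈ Finset.Ioc N0 N1, ∑ i ∈ Finset.Ioo N0 j,
                conv (dilate φ i) f x * conv (dilate φ j) g x)‖))
            ^ (p * q / (p + q))) ^ ((p + q) / (p * q))
        ≤ (C : ℝ≥0∞) * eLpNorm f (ENNReal.ofReal p) volume *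
            eLpNorm g (ENNReal.ofReal q) volume := by
  have hA : Ann ⌈Nb⌉₊ φ := by
    intro ξ hξ
    obtain ⟨h1, h2⟩ := hφ ξ hξ
    have h3 : (2:ℝ) ^ Nb ≤ 2 ^ ⌈Nb⌉₊ := by
      rw [← Real.rpow_natCast]
      exact Real.rpow_le_rpow_of_exponent_le (by norm_num) (Nat.le_ceil _)
    refine ⟨lt_of_le_of_lt ?_ h1, h2.trans_le h3⟩
    rw [Real.rpow_neg (by norm_num)]
    exact inv_anti₀ (by positivity) h3
  have hp0 : 0 < p := by linarith
  have hq0 : 0 < q := by linarith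
  obtain ⟨C, hC, h⟩ := TM_est _ φ hA p q hp hq
  have he : 0 ≤ (p + q) / (p * q) := by positivity
  have hCe : C ^ ((p + q) / (p * q)) ≠ ∞ := by finiteness
  refine ⟨(C ^ ((p + q) / (p * q))).toNNReal + 1, by positivity, fun f g hf hg => ?_⟩
  have key : ∀ (u : ℝ) (hu : 1 < u) (f : ℝ → ℂ), eLpNorm f (ENNReal.ofReal u) volume = (∫⁻ x, ‖f x‖ₑ ^ u) ^ (1 / u) := by
    intro u hu f
    rw [eLpNorm_eq_lintegral_rpow_enorm_toReal (by simp; linarith) (by simp), ENNReal.toReal_ofReal (by linarith)]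
  have key2 : ∀ (u : ℝ) (hu : 1 < u) (f : ℝ → ℂ), MemLp f (ENNReal.ofReal u) → ∃ f' : ℝ → ℂ, Measurable f' ∧ f =ᵐ[volume] f' ∧
      ∫⁻ x, ‖f' x‖ₑ ^ u ≠ ∞ := by
    intro u hu f hf
    refine ⟨hf.1.mk f, hf.1.stronglyMeasurable_mk.measurable, hf.1.ae_eq_mk, ?_⟩
    have := hf.2
    rw [eLpNorm_congr_ae hf.1.ae_eq_mk, key u hu] at this
    intro h
    rw [h, ENNReal.top_rpow_of_pos (by positivity)] at this
    exact lt_irrefl _ this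
  obtain ⟨f', hf', hff, hfi⟩ := key2 p hp f hf
  obtain ⟨g', hg', hgg, hgi⟩ := key2 q hq g hg
  have := h f' g' hf' hg' hfi hgi
  rw [eLpNorm_congr_ae hff, eLpNorm_congr_ae hgg, key p hp, key q hq]
  simp_rw [conv_ae _ hff, conv_ae _ hgg]
  refine (ENNReal.rpow_le_rpow this he).trans ?_
  rw [ENNReal.mul_rpow_of_nonneg _ _ he, ENNReal.mul_rpow_of_nonneg _ _ he, ← ENNReal.rpow_mul, ← ENNReal.rpow_mul,
    show q / (p + q) * ((p + q) / (p * q)) = 1 / p by field_simp, show p / (p + q) * ((p + q) / (p * q)) = 1 / q by field_simp,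
    mul_assoc]
  refine mul_le_mul' ?_ le_rfl
  rw [ENNReal.coe_add, ENNReal.coe_toNNReal hCe]
  exact le_self_add

end
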